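/- arXiv:math/9903134 — 2 statements merged into one kernel-verified Lean document; each statement's English description precedes it below -/
import Mathlib

section
/- For each q ∈ (0,1), γ ≥ 1 and each ε with 0 < ε < ω(γ,q), there exists ℓ(ε) > 0 such that lim_{N→∞} (1/N²) log ℙ[G(⌊γN⌋, N) ≤ N(ω(γ,q) − ε)] = −ℓ(ε). -/
open MeasureTheory Filter

/-- An up/right path from `(1,1)` to `(M,N)`: a sequence of `M+N-1` lattice sites starting at
`(1,1)`, ending at `(M,N)`, each step increasing one coordinate by one. -/
def UpRightPath (M N : ℕ) (π : ℕ → ℕ × ℕ) : Prop :=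
  π 0 = (1, 1) ∧ π (M + N - 2) = (M, N) ∧
    ∀ k, k < M + N - 2 →
      π (k + 1) = ((π k).1 + 1, (π k).2) ∨ π (k + 1) = ((π k).1, (π k).2 + 1)

/-- `G(M,N)`: the maximum over up/right paths from `(1,1)` to `(M,N)` of the sum of the
site weights `w` along the path. -/
noncomputable def lppSup (w : ℕ × ℕ → ℕ) (M N : ℕ) : ℕ :=
  sSup {s | ∃ π : ℕ → ℕ × ℕ, UpRightPath M N π ∧
    s = ∑ k ∈ Finset.range (M + N - 1), w (π k)}

/-- Last passage times computed by the corner recursion; the site weights are indexed from `1`. -/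
def lpp (w : ℕ × ℕ → ℕ) : ℕ → ℕ → ℕ
  | 0, _ => 0
  | _ + 1, 0 => 0
  | m + 1, n + 1 => max (lpp w m (n + 1)) (lpp w (m + 1) n) + w (m + 1, n + 1)

@[simp] lemma lpp_zero_left (w : ℕ × ℕ → ℕ) (n : ℕ) : lpp w 0 n = 0 := by simp [lpp]

@[simp] lemma lpp_zero_right (w : ℕ × ℕ → ℕ) (m : ℕ) : lpp w m 0 = 0 := by
  cases m <;> simp [lpp]

lemma lpp_succ (w : ℕ × ℕ → ℕ) (m n : ℕ) :
    lpp w (m + 1) (n + 1) = max (lpp w m (n + 1)) (lpp w (m + 1) n) + w (m + 1, n + 1) := by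
  rw [lpp]

lemma sum_path_le_lpp (w : ℕ × ℕ → ℕ) (π : ℕ → ℕ × ℕ) (L : ℕ) (h0 : π 0 = (1, 1))
    (hs : ∀ k, k < L →
      π (k + 1) = ((π k).1 + 1, (π k).2) ∨ π (k + 1) = ((π k).1, (π k).2 + 1)) :
    ∀ k, k ≤ L → 1 ≤ (π k).1 ∧ 1 ≤ (π k).2 ∧
      ∑ j ∈ Finset.range (k + 1), w (π j) ≤ lpp w (π k).1 (π k).2 := by
  intro k
  induction k with
  | zero => intro _; simp [h0, lpp]
  | succ k ih =>
    intro hk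
    obtain ⟨h1, h2, h3⟩ := ih (by omega)
    obtain ⟨a, ha⟩ : ∃ a, (π k).1 = a + 1 := ⟨(π k).1 - 1, by omega⟩
    obtain ⟨b, hb⟩ : ∃ b, (π k).2 = b + 1 := ⟨(π k).2 - 1, by omega⟩
    rw [ha, hb] at h3
    rw [Finset.sum_range_succ]
    rcases hs k (by omega) with h | h
    · rw [h, ha, hb]
      refine ⟨by simp, by simp, ?_⟩
      rw [lpp_succ w (a + 1) b]
      exact Nat.add_le_add_right (h3.trans (le_max_left _ _)) _
    · rw [h, ha, hb]
      refine ⟨by simp, by simp, ?_⟩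
      rw [lpp_succ w a (b + 1)]
      exact Nat.add_le_add_right (h3.trans (le_max_right _ _)) _

lemma UpRightPath.extend {m n m' n' : ℕ} {π : ℕ → ℕ × ℕ} (w : ℕ × ℕ → ℕ)
    (h : UpRightPath (m + 1) (n + 1) π)
    (hs : (m', n') = (m + 2, n + 1) ∨ (m', n') = (m + 1, n + 2)) :
    ∃ π', UpRightPath m' n' π' ∧ ∑ k ∈ Finset.range (m' + n' - 1), w (π' k) =
      ∑ k ∈ Finset.range (m + 1 + (n + 1) - 1), w (π k) + w (m', n') := by
  obtain ⟨h0, h1, h2⟩ := h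
  have hl : m' + n' = m + n + 3 := by
    rcases hs with h | h <;> (simp only [Prod.mk.injEq] at h; omega)
  refine ⟨fun k => if k ≤ m + n then π k else (m', n'), ⟨by simpa using h0, ?_, ?_⟩, ?_⟩
  · rw [hl]; simp
  · intro k hk
    rw [hl] at hk
    rcases Nat.lt_or_ge k (m + n) with hkl | hkl
    · have := h2 k (by omega)
      simpa [show k ≤ m + n by omega, show k + 1 ≤ m + n by omega] using this
    · obtain rfl : k = m + n := by omega
      have e : m + 1 + (n + 1) - 2 = m + n := by omega
      rw [e] at h1
      simp only [le_refl, if_true, h1]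
      simpa using hs
  · rw [hl, show m + n + 3 - 1 = (m + n + 1) + 1 by omega, Finset.sum_range_succ,
      show m + 1 + (n + 1) - 1 = m + n + 1 by omega]
    congr 1
    · refine Finset.sum_congr rfl fun k hk => ?_
      rw [Finset.mem_range] at hk
      simp [show k ≤ m + n by omega]
    · simp

lemma exists_path_eq_lpp (w : ℕ × ℕ → ℕ) (m n : ℕ) :
    ∃ π, UpRightPath (m + 1) (n + 1) π ∧
      ∑ k ∈ Finset.range (m + 1 + (n + 1) - 1), w (π k) = lpp w (m + 1) (n + 1) := by
  induction m generalizing n with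
  | zero =>
    induction n with
    | zero => exact ⟨fun _ => (1, 1), ⟨rfl, rfl, by simp⟩, by simp [lpp]⟩
    | succ n ih =>
      obtain ⟨π, hπ, hs⟩ := ih
      obtain ⟨π', hπ', hs'⟩ := hπ.extend w (m' := 1) (n' := n + 2) (Or.inr rfl)
      refine ⟨π', hπ', hs'.trans ?_⟩
      rw [hs, lpp_succ w 0 (n + 1)]
      simp
  | succ m ihm =>
    induction n with
    | zero =>
      obtain ⟨π, hπ, hs⟩ := ihm 0
      obtain ⟨π', hπ', hs'⟩ := hπ.extend w (m' := m + 2) (n' := 1) (Or.inl rfl)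
      refine ⟨π', hπ', hs'.trans ?_⟩
      rw [hs, lpp_succ w (m + 1) 0]
      simp
    | succ n ihn =>
      rcases le_total (lpp w (m + 1) (n + 2)) (lpp w (m + 2) (n + 1)) with hle | hle
      · obtain ⟨π, hπ, hs⟩ := ihn
        obtain ⟨π', hπ', hs'⟩ := hπ.extend w (m' := m + 2) (n' := n + 2) (Or.inr rfl)
        refine ⟨π', hπ', hs'.trans ?_⟩
        rw [hs, lpp_succ w (m + 1) (n + 1), max_eq_right hle]
      · obtain ⟨π, hπ, hs⟩ := ihm (n + 1)
        obtain ⟨π', hπ', hs'⟩ := hπ.extend w (m' := m + 2) (n' := n + 2) (Or.inl rfl)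
        refine ⟨π', hπ', hs'.trans ?_⟩
        rw [hs, lpp_succ w (m + 1) (n + 1), max_eq_left hle]

lemma lppSup_eq_lpp (w : ℕ × ℕ → ℕ) {M N : ℕ} (hM : 1 ≤ M) (hN : 1 ≤ N) :
    lppSup w M N = lpp w M N := by
  obtain ⟨m, rfl⟩ : ∃ m, M = m + 1 := ⟨M - 1, by omega⟩
  obtain ⟨n, rfl⟩ : ∃ n, N = n + 1 := ⟨N - 1, by omega⟩
  refine IsGreatest.csSup_eq ⟨?_, ?_⟩
  · obtain ⟨π, hπ, hs⟩ := exists_path_eq_lpp w m n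
    exact ⟨π, hπ, hs.symm⟩
  · rintro s ⟨π, ⟨h0, h1, h2⟩, rfl⟩
    have := (sum_path_le_lpp w π _ h0 h2 _ le_rfl).2.2
    rwa [h1, show m + 1 + (n + 1) - 2 + 1 = m + 1 + (n + 1) - 1 by omega] at this

lemma lpp_le_succ_left (w : ℕ × ℕ → ℕ) (m n : ℕ) : lpp w m n ≤ lpp w (m + 1) n := by
  cases n with
  | zero => simp
  | succ n => rw [lpp_succ]; exact (le_max_left _ _).trans (Nat.le_add_right _ _)

lemma lpp_le_succ_right (w : ℕ × ℕ → ℕ) (m n : ℕ) : lpp w m n ≤ lpp w m (n + 1) := by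
  cases m with
  | zero => simp
  | succ m => rw [lpp_succ]; exact (le_max_right _ _).trans (Nat.le_add_right _ _)

lemma lpp_mono (w : ℕ × ℕ → ℕ) {m n m' n' : ℕ} (hm : m ≤ m') (hn : n ≤ n') :
    lpp w m n ≤ lpp w m' n' :=
  (monotone_nat_of_le_succ (f := fun i => lpp w i n) (fun i => lpp_le_succ_left w i n) hm).trans
    (monotone_nat_of_le_succ (f := fun j => lpp w m' j) (fun j => lpp_le_succ_right w m' j) hn)

lemma lpp_add_lpp_shift_le (w : ℕ × ℕ → ℕ) (m n a b : ℕ) :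
    lpp w m n + lpp (fun p => w (m + p.1, n + p.2)) a b ≤ lpp w (m + a) (n + b) := by
  induction a generalizing b with
  | zero => simpa using lpp_mono w le_rfl (Nat.le_add_right n b)
  | succ a iha =>
    induction b with
    | zero => simpa using lpp_mono w (Nat.le_add_right m (a + 1)) le_rfl
    | succ b ihb =>
      rw [lpp_succ, show m + (a + 1) = m + a + 1 by ring, show n + (b + 1) = n + b + 1 by ring,
        lpp_succ]
      have h1 := iha (b + 1)
      rw [show n + (b + 1) = n + b + 1 by ring] at h1
      rw [show m + (a + 1) = m + a + 1 by ring] at ihb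
      simp only [← add_assoc]
      omega

lemma lpp_congr {w w' : ℕ × ℕ → ℕ} {M N : ℕ}
    (h : ∀ i < M, ∀ j < N, w (i + 1, j + 1) = w' (i + 1, j + 1)) :
    ∀ m ≤ M, ∀ n ≤ N, lpp w m n = lpp w' m n := by
  intro m hm
  induction m with
  | zero => simp
  | succ m ihm =>
    intro n hn
    induction n with
    | zero => simp
    | succ n ihn =>
      rw [lpp_succ, lpp_succ, ihm (by omega) _ hn, ihn (by omega), h m (by omega) n (by omega)]

section GeometricFamilies

open ProbabilityTheory
open scoped ENNReal

/-- The expectation of `f` under the geometric distribution with parameter `u`. -/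
noncomputable def geomE (u : ℝ) (f : ℕ → ℝ≥0∞) : ℝ≥0∞ :=
  ∑' k, ENNReal.ofReal ((1 - u) * u ^ k) * f k

/-- The expectation of a function of a list of independent geometric variables with the
given parameters. -/
noncomputable def geomListE : List ℝ → (List ℕ → ℝ≥0∞) → ℝ≥0∞
  | [], f => f []
  | u :: us, f => geomE u fun k => geomListE us fun l => f (k :: l)

/-- Independent geometric random variables `w p` with parameters `par p`. -/
structure IsGeomFamily {Ω ι : Type*} [MeasurableSpace Ω] (μ : Measure Ω) (w : ι → Ω → ℕ)
    (par : ι → ℝ) : Prop where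
  measurable : ∀ p, Measurable (w p)
  indep : iIndepFun w μ
  law : ∀ p k, μ {ω | w p ω = k} = ENNReal.ofReal ((1 - par p) * par p ^ k)

variable {Ω ι α β : Type*} [MeasurableSpace Ω] {μ : Measure Ω} {w : ι → Ω → ℕ} {par : ι → ℝ}

lemma DependsOn.exists_factor {X : (ι → ℕ) → α} {S : Finset ι} (hX : DependsOn X (S : Set ι)) :
    ∃ φ : (S → ℕ) → α, ∀ W, X W = φ fun i => W i := by
  classical
  refine ⟨fun v => X fun p => if h : p ∈ S then v ⟨p, h⟩ else 0, fun W => hX fun p hp => ?_⟩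
  rw [Finset.mem_coe] at hp
  simp [hp]

lemma measurable_of_dependsOn {δ : Type*} [MeasurableSpace δ] (hw : ∀ p, Measurable (w p))
    {X : (ι → ℕ) → α} {S : Finset ι} (hX : DependsOn X (S : Set ι)) (g : α → δ) :
    Measurable fun ω => g (X fun p => w p ω) := by
  obtain ⟨φ, hφ⟩ := hX.exists_factor
  simp only [hφ]
  exact (Measurable.of_discrete (f := fun v : S → ℕ => g (φ v))).comp
    (measurable_pi_lambda _ fun i => hw i)

namespace IsGeomFamily

lemma lintegral_mul (h : IsGeomFamily μ w par) {X : (ι → ℕ) → α} {Y : (ι → ℕ) → β}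
    {S T : Finset ι} (hX : DependsOn X (S : Set ι)) (hY : DependsOn Y (T : Set ι))
    (hST : Disjoint S T) (f : α → ℝ≥0∞) (g : β → ℝ≥0∞) :
    ∫⁻ ω, f (X fun p => w p ω) * g (Y fun p => w p ω) ∂μ =
      (∫⁻ ω, f (X fun p => w p ω) ∂μ) * ∫⁻ ω, g (Y fun p => w p ω) ∂μ := by
  have hXm := measurable_of_dependsOn h.measurable hX f
  have hYm := measurable_of_dependsOn h.measurable hY g
  obtain ⟨φ, hφ⟩ := hX.exists_factor
  obtain ⟨ψ, hψ⟩ := hY.exists_factor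
  refine lintegral_mul_eq_lintegral_mul_lintegral_of_indepFun hXm hYm ?_
  simp only [hφ, hψ]
  exact (h.indep.indepFun_finset S T hST h.measurable).comp
    (φ := fun v : S → ℕ => f (φ v)) (ψ := fun v : T → ℕ => g (ψ v))
    Measurable.of_discrete Measurable.of_discrete

lemma lintegral_single (h : IsGeomFamily μ w par) {X : (ι → ℕ) → α} {S : Finset ι}
    (hX : DependsOn X (S : Set ι)) {p : ι} (hp : p ∉ S) (f : α → ℕ → ℝ≥0∞) :
    ∫⁻ ω, f (X fun p => w p ω) (w p ω) ∂μ =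
      ∫⁻ ω, geomE (par p) (f (X fun p => w p ω)) ∂μ := by
  have hY : DependsOn (fun W : ι → ℕ => W p) (({p} : Finset ι) : Set ι) := fun W W' hW =>
    hW p (by simp)
  have e1 : ∀ ω, f (X fun p => w p ω) (w p ω) =
      ∑' k, f (X fun p => w p ω) k * (if w p ω = k then 1 else 0) := by
    intro ω
    rw [tsum_eq_single (w p ω)]
    · simp
    · intro k hk; simp [hk.symm]
  simp only [e1]
  rw [lintegral_tsum]
  · simp only [geomE]
    rw [lintegral_tsum]
    · refine tsum_congr fun k => ?_
      rw [h.lintegral_mul hX hY (by simpa using hp) (fun a => f a k)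
        (fun n => if n = k then 1 else 0)]
      rw [lintegral_const_mul _ (measurable_of_dependsOn h.measurable hX fun a => f a k), mul_comm]
      congr 1
      have e2 : ∀ ω, (if w p ω = k then (1 : ℝ≥0∞) else 0) =
          Set.indicator {ω | w p ω = k} 1 ω := by
        intro ω; simp [Set.indicator]
      simp only [e2]
      have hm : MeasurableSet {ω | w p ω = k} := h.measurable p (measurableSet_singleton k)
      rw [lintegral_indicator_one hm, h.law]
    · intro k
      exact ((measurable_of_dependsOn h.measurable hX fun a => f a k).const_mul _).aemeasurable
  · intro k
    exact ((measurable_of_dependsOn h.measurable hX fun a => f a k).mul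
      (measurable_of_dependsOn h.measurable hY fun n => if n = k then 1 else 0)).aemeasurable

lemma lintegral_list (h : IsGeomFamily μ w par) (l : List ι) (hl : l.Nodup)
    {X : (ι → ℕ) → α} {S : Finset ι}
    (hX : DependsOn X (S : Set ι)) (hlS : ∀ p ∈ l, p ∉ S) (f : α → List ℕ → ℝ≥0∞) :
    ∫⁻ ω, f (X fun p => w p ω) (l.map fun p => w p ω) ∂μ =
      ∫⁻ ω, geomListE (l.map par) (f (X fun p => w p ω)) ∂μ := by
  classical
  induction l generalizing α S with
  | nil => simp [geomListE]
  | cons p l ih =>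
    have hX' : DependsOn (fun W : ι → ℕ => (X W, W p)) ((insert p S : Finset ι) : Set ι) := by
      intro W W' hW
      rw [Prod.mk.injEq]
      exact ⟨hX fun i hi => hW i (by simp [Finset.mem_coe.1 hi]), hW p (by simp)⟩
    rw [List.nodup_cons] at hl
    have := ih hl.2 hX' (fun i hi => by
      rw [Finset.mem_insert, not_or]
      exact ⟨fun e => hl.1 (e ▸ hi), hlS i (by simp [hi])⟩) fun a t => f a.1 (a.2 :: t)
    simp only [List.map_cons, geomListE]
    rw [this]
    exact h.lintegral_single hX (hlS p (by simp)) fun a k =>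
      geomListE (l.map par) fun t => f a (k :: t)

end IsGeomFamily

lemma geomE_one {u : ℝ} (h0 : 0 ≤ u) (h1 : u < 1) : geomE u (fun _ => 1) = 1 := by
  have hs : HasSum (fun k : ℕ => (1 - u) * u ^ k) 1 := by
    have := (hasSum_geometric_of_lt_one h0 h1).mul_left (1 - u)
    rwa [mul_inv_cancel₀ (by linarith)] at this
  simp only [geomE, mul_one]
  rw [← ENNReal.ofReal_tsum_of_nonneg (fun k => by
    have : 0 < 1 - u := by linarith
    positivity) hs.summable, hs.tsum_eq, ENNReal.ofReal_one]

end GeometricFamilies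

section RSK

open scoped ENNReal

/-- `κ ≺ μ`: the sequences interlace, `μ₀ ≥ κ₀ ≥ μ₁ ≥ κ₁ ≥ …`. -/
def Interlaces (κ μ : ℕ →₀ ℕ) : Prop := ∀ i, κ i ≤ μ i ∧ μ (i + 1) ≤ κ i

/-- The size `∑ λᵢ` of a finitely supported sequence. -/
def seqSize (l : ℕ →₀ ℕ) : ℕ := l.sum fun _ x => x

lemma seqSize_eq_sum_range (l : ℕ →₀ ℕ) {K : ℕ} (hK : ∀ i, K ≤ i → l i = 0) :
    seqSize l = ∑ i ∈ Finset.range K, l i := by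
  refine Finsupp.sum_of_support_subset _ (fun i hi => ?_) _ (by simp)
  rw [Finset.mem_range]
  by_contra hlt
  exact (Finsupp.mem_support_iff.1 hi) (hK i (not_lt.1 hlt))

lemma exists_support_bound (l : ℕ →₀ ℕ) : ∃ K, ∀ i, K ≤ i → l i = 0 := by
  refine ⟨l.support.sup id + 1, fun i hi => ?_⟩
  by_contra hne
  have : i ≤ l.support.sup id := Finset.le_sup (f := id) (Finsupp.mem_support_iff.2 hne)
  omega

lemma Interlaces.seqSize_le {κ μ : ℕ →₀ ℕ} (h : Interlaces κ μ) : seqSize κ ≤ seqSize μ := by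
  obtain ⟨K, hK⟩ := exists_support_bound μ
  rw [seqSize_eq_sum_range μ hK,
    seqSize_eq_sum_range κ fun i hi => Nat.le_zero.1 ((h i).1.trans (hK i hi).le)]
  exact Finset.sum_le_sum fun i _ => (h i).1

lemma interlaces_zero_iff {κ : ℕ →₀ ℕ} : Interlaces κ 0 ↔ κ = 0 := by
  refine ⟨fun h => Finsupp.ext fun i => by simpa using (h i).1, ?_⟩
  rintro rfl i
  simp

/-- The finitely supported sequence with values `f`, cut off beyond the supports of `μ` and `ν`. -/
noncomputable def cutSeq (μ ν : ℕ →₀ ℕ) (f : ℕ → ℕ) : ℕ →₀ ℕ :=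
  Finsupp.onFinset (Finset.range (max (exists_support_bound μ).choose
    (exists_support_bound ν).choose + 1)) (fun i => if i < max (exists_support_bound μ).choose
    (exists_support_bound ν).choose + 1 then f i else 0) fun i hi => by
      by_contra h
      exact hi (if_neg fun h' => h (Finset.mem_range.2 h'))

lemma cutSeq_apply (μ ν : ℕ →₀ ℕ) (f : ℕ → ℕ)
    (hf : ∀ i, 0 < i → (∀ j, i ≤ j + 1 → μ j = 0 ∧ ν j = 0) → f i = 0) (i : ℕ) :
    cutSeq μ ν f i = f i := by
  simp only [cutSeq, Finsupp.onFinset_apply]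
  split_ifs with h
  · rfl
  · refine (hf i (by omega) fun j hj => ⟨(exists_support_bound μ).choose_spec j (by omega),
      (exists_support_bound ν).choose_spec j (by omega)⟩).symm

/-- The local growth rule of the Robinson-Schensted-Knuth correspondence. -/
noncomputable def growUp (μ ν κ : ℕ →₀ ℕ) (w : ℕ) : ℕ →₀ ℕ :=
  cutSeq μ ν fun
    | 0 => max (μ 0) (ν 0) + w
    | i + 1 => max (μ (i + 1)) (ν (i + 1)) + (min (μ i) (ν i) - κ i)

/-- The inverse of the local growth rule. -/
noncomputable def growDown (μ ν l : ℕ →₀ ℕ) : ℕ →₀ ℕ :=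
  cutSeq μ ν fun i => max (μ (i + 1)) (ν (i + 1)) + min (μ i) (ν i) - l (i + 1)

lemma growUp_zero (μ ν κ : ℕ →₀ ℕ) (w : ℕ) : growUp μ ν κ w 0 = max (μ 0) (ν 0) + w := by
  refine cutSeq_apply _ _ _ ?_ 0
  rintro (_ | i) h0 h
  · omega
  · simp [h (i + 1) (by omega), h i le_rfl]

lemma growUp_succ (μ ν κ : ℕ →₀ ℕ) (w i : ℕ) :
    growUp μ ν κ w (i + 1) = max (μ (i + 1)) (ν (i + 1)) + (min (μ i) (ν i) - κ i) := by
  refine cutSeq_apply _ _ _ ?_ (i + 1)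
  rintro (_ | i) h0 h
  · omega
  · simp [h (i + 1) (by omega), h i le_rfl]

lemma growDown_apply (μ ν l : ℕ →₀ ℕ) (i : ℕ) :
    growDown μ ν l i = max (μ (i + 1)) (ν (i + 1)) + min (μ i) (ν i) - l (i + 1) := by
  refine cutSeq_apply _ _ _ ?_ i
  intro i h0 h
  simp [h (i + 1) (by omega), h i (by omega)]

/-- The local growth rule is a bijection. -/
noncomputable def growEquiv (μ ν : ℕ →₀ ℕ) :
    {p : (ℕ →₀ ℕ) × ℕ // Interlaces p.1 ν ∧ Interlaces p.1 μ} ≃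
      {l : ℕ →₀ ℕ // Interlaces ν l ∧ Interlaces μ l} where
  toFun p := ⟨growUp μ ν p.1.1 p.1.2, by
    obtain ⟨⟨κ, w⟩, h1, h2⟩ := p
    constructor
    · rintro (_ | i)
      · rw [growUp_zero, growUp_succ]
        have := h1 0; have := h2 0; simp only at *; omega
      · rw [growUp_succ, growUp_succ]
        have := h1 (i + 1); have := h2 (i + 1); simp only at *; omega
    · rintro (_ | i)
      · rw [growUp_zero, growUp_succ]
        have := h1 0; have := h2 0; simp only at *; omega
      · rw [growUp_succ, growUp_succ]
        have := h1 (i + 1); have := h2 (i + 1); simp only at *; omega⟩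
  invFun l := ⟨(growDown μ ν l.1, l.1 0 - max (μ 0) (ν 0)), by
    obtain ⟨l, h1, h2⟩ := l
    constructor <;> intro i <;> simp only [growDown_apply] <;>
      (have := h1 i; have := h2 i; have := h1 (i + 1); have := h2 (i + 1); omega)⟩
  left_inv := by
    rintro ⟨⟨κ, w⟩, h1, h2⟩
    simp only [Subtype.mk.injEq, Prod.mk.injEq, growUp_zero]
    refine ⟨Finsupp.ext fun i => ?_, by omega⟩
    rw [growDown_apply, growUp_succ]
    have := h1 i; have := h2 i; simp only at *; omega
  right_inv := by
    rintro ⟨l, h1, h2⟩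
    simp only [Subtype.mk.injEq]
    refine Finsupp.ext fun i => ?_
    rcases i with _ | i
    · rw [growUp_zero]; have := h1 0; have := h2 0; omega
    · rw [growUp_succ, growDown_apply]
      have := h1 i; have := h2 i; have := h1 (i + 1); have := h2 (i + 1); omega

lemma seqSize_growUp {μ ν κ : ℕ →₀ ℕ} (w : ℕ) (h1 : Interlaces κ ν) (h2 : Interlaces κ μ) :
    seqSize (growUp μ ν κ w) + seqSize κ = seqSize μ + seqSize ν + w := by
  obtain ⟨K₁, hK₁⟩ := exists_support_bound μ
  obtain ⟨K₂, hK₂⟩ := exists_support_bound ν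
  have hμ : ∀ i, K₁ + K₂ ≤ i → μ i = 0 := fun i hi => hK₁ i (by omega)
  have hν : ∀ i, K₁ + K₂ ≤ i → ν i = 0 := fun i hi => hK₂ i (by omega)
  have hκ : ∀ i, K₁ + K₂ ≤ i → κ i = 0 := fun i hi =>
    Nat.le_zero.1 ((h1 i).1.trans (hν i hi).le)
  have hl : ∀ i, K₁ + K₂ + 1 ≤ i → growUp μ ν κ w i = 0 := by
    rintro (_ | i) hi
    · omega
    · rw [growUp_succ, hμ i (by omega), hν i (by omega), hμ (i + 1) (by omega),
        hν (i + 1) (by omega)]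
      simp
  rw [seqSize_eq_sum_range _ hl, seqSize_eq_sum_range _ hμ, seqSize_eq_sum_range _ hν,
    seqSize_eq_sum_range _ hκ]
  have key : ∀ K, ∑ i ∈ Finset.range (K + 1), growUp μ ν κ w i + ∑ i ∈ Finset.range K, κ i =
      ∑ i ∈ Finset.range K, μ i + ∑ i ∈ Finset.range K, ν i + w + max (μ K) (ν K) := by
    intro K
    induction K with
    | zero => simp [growUp_zero]; omega
    | succ K ih =>
      rw [Finset.sum_range_succ, Finset.sum_range_succ κ, Finset.sum_range_succ μ,
        Finset.sum_range_succ ν, growUp_succ]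
      have := h1 K; have := h2 K
      omega
  rw [key, hμ _ le_rfl, hν _ le_rfl]
  simp

open Classical in
/-- The indicator of `κ ≺ μ`. -/
noncomputable def ilc (κ μ : ℕ →₀ ℕ) : ℝ≥0∞ := if Interlaces κ μ then 1 else 0

variable (Q : ℝ≥0∞)

/-- The indicator of `κ ≺ μ` weighted by `Q ^ (|μ| - |κ|)`. -/
noncomputable def wilc (κ μ : ℕ →₀ ℕ) : ℝ≥0∞ := ilc κ μ * Q ^ (seqSize μ - seqSize κ)

lemma tsum_growth (μ ν : ℕ →₀ ℕ) (H : (ℕ →₀ ℕ) → ℝ≥0∞) :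
    ∑' κ, wilc Q κ ν * ilc κ μ * ∑' w, Q ^ w * H (growUp μ ν κ w) =
      ∑' l, ilc ν l * wilc Q μ l * H l := by
  classical
  have e1 : ∑' κ, wilc Q κ ν * ilc κ μ * ∑' w, Q ^ w * H (growUp μ ν κ w) =
      ∑' p : (ℕ →₀ ℕ) × ℕ, wilc Q p.1 ν * ilc p.1 μ * (Q ^ p.2 * H (growUp μ ν p.1 p.2)) := by
    rw [ENNReal.tsum_prod (f := fun κ w => wilc Q κ ν * ilc κ μ * (Q ^ w * H (growUp μ ν κ w)))]
    simp only [ENNReal.tsum_mul_left]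
  rw [e1, ← tsum_subtype_eq_of_support_subset
    (s := {p : (ℕ →₀ ℕ) × ℕ | Interlaces p.1 ν ∧ Interlaces p.1 μ}),
    ← tsum_subtype_eq_of_support_subset
    (s := {l : ℕ →₀ ℕ | Interlaces ν l ∧ Interlaces μ l})]
  · refine Eq.trans ?_ ((growEquiv μ ν).tsum_eq fun l => ilc ν l.1 * wilc Q μ l.1 * H l.1)
    refine tsum_congr ?_
    rintro ⟨⟨κ, w⟩, h1, h2⟩
    have h3 := ((growEquiv μ ν) ⟨(κ, w), h1, h2⟩).2
    have h4 : (growEquiv μ ν ⟨(κ, w), h1, h2⟩).1 = growUp μ ν κ w := rfl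
    simp only [h4] at h3 ⊢
    simp only at h1 h2
    have e := seqSize_growUp w h1 h2
    have := h1.seqSize_le
    have := h3.2.seqSize_le
    simp only [wilc, ilc, h1, h2, h3.1, h3.2, if_true, one_mul, mul_one]
    rw [← mul_assoc, ← pow_add]
    congr 2
    omega
  · intro l hl
    simp only [Function.mem_support, ne_eq, mul_eq_zero, not_or, wilc, ilc] at hl
    simp only [Set.mem_ofPred_eq]
    refine ⟨?_, ?_⟩ <;> by_contra hn <;> simp [hn] at hl
  · intro l hl
    simp only [Function.mem_support, ne_eq, mul_eq_zero, not_or, wilc, ilc] at hl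
    simp only [Set.mem_ofPred_eq]
    refine ⟨?_, ?_⟩ <;> by_contra hn <;> simp [hn] at hl

/-- The sum of `f (first parts) top` over all chains `κ ≺ μ₁ ≺ ⋯ ≺ μₘ = top`. -/
noncomputable def chainSum : ℕ → (ℕ →₀ ℕ) → (List ℕ → (ℕ →₀ ℕ) → ℝ≥0∞) → ℝ≥0∞
  | 0, κ, f => f [] κ
  | m + 1, κ, f => ∑' μ, ilc κ μ * chainSum m μ fun l top => f (μ 0 :: l) top

/-- The row update of last passage times: given the previous row `gs`, the current value `a` and the
weights `ws`, the new row. -/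
def rowUpd : List ℕ → ℕ → List ℕ → List ℕ
  | g :: gs, a, w :: ws => (max g a + w) :: rowUpd gs (max g a + w) ws
  | _, _, _ => []

/-- The sum of `Q ^ (total weight) * f (new row)` over all choices of the weights in a row. -/
noncomputable def rowSum : List ℕ → ℕ → (List ℕ → ℝ≥0∞) → ℝ≥0∞
  | [], _, f => f []
  | g :: gs, a, f => ∑' w, Q ^ w * rowSum gs (max g a + w) fun l => f ((max g a + w) :: l)

lemma chainSum_tsum {β : Type*} (m : ℕ) (κ : ℕ →₀ ℕ) (F : β → List ℕ → (ℕ →₀ ℕ) → ℝ≥0∞) :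
    chainSum m κ (fun l top => ∑' b, F b l top) = ∑' b, chainSum m κ (F b) := by
  induction m generalizing κ F with
  | zero => rfl
  | succ m ih =>
    simp only [chainSum]
    rw [ENNReal.tsum_comm]
    refine tsum_congr fun μ => ?_
    rw [ih μ fun b l top => F b (μ 0 :: l) top, ENNReal.tsum_mul_left]

lemma chainSum_mul_left (m : ℕ) (κ : ℕ →₀ ℕ) (c : ℝ≥0∞) (F : List ℕ → (ℕ →₀ ℕ) → ℝ≥0∞) :
    chainSum m κ (fun l top => c * F l top) = c * chainSum m κ F := by
  induction m generalizing κ F with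
  | zero => rfl
  | succ m ih =>
    simp only [chainSum]
    rw [← ENNReal.tsum_mul_left]
    refine tsum_congr fun μ => ?_
    rw [ih μ fun l top => F (μ 0 :: l) top]
    ring

lemma chainSum_rowSum (m : ℕ) (ν : ℕ →₀ ℕ) (A : (ℕ →₀ ℕ) → ℝ≥0∞) (f : List ℕ → ℝ≥0∞) :
    ∑' κ, wilc Q κ ν * chainSum m κ (fun l top => A top * rowSum Q l (ν 0) f) =
      chainSum m ν fun l top => f l * ∑' μ, wilc Q μ top * A μ := by
  induction m generalizing ν f with
  | zero =>
    simp only [chainSum, rowSum]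
    rw [← ENNReal.tsum_mul_left]
    exact tsum_congr fun κ => by ring
  | succ m ih =>
    have step : ∀ μ : ℕ →₀ ℕ, chainSum m μ (fun l top => A top * rowSum Q (μ 0 :: l) (ν 0) f) =
        ∑' w, Q ^ w * chainSum m μ fun l top =>
          A top * rowSum Q l (max (μ 0) (ν 0) + w) fun t => f ((max (μ 0) (ν 0) + w) :: t) := by
      intro μ
      simp only [rowSum, ← chainSum_mul_left, ← chainSum_tsum, ← ENNReal.tsum_mul_left]
      congr 1
      funext l top
      exact tsum_congr fun w => by ring
    simp only [chainSum, step]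
    calc _ = ∑' μ, ∑' κ, wilc Q κ ν * ilc κ μ * ∑' w, Q ^ w * chainSum m μ fun l top =>
          A top * rowSum Q l (growUp μ ν κ w 0) fun t => f (growUp μ ν κ w 0 :: t) := by
            rw [ENNReal.tsum_comm]
            refine tsum_congr fun κ => ?_
            rw [← ENNReal.tsum_mul_left]
            refine tsum_congr fun μ => ?_
            simp only [growUp_zero, mul_assoc]
      _ = ∑' μ, ∑' l', ilc ν l' * wilc Q μ l' * chainSum m μ fun l top =>
          A top * rowSum Q l (l' 0) fun t => f (l' 0 :: t) := by
            refine tsum_congr fun μ => ?_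
            exact tsum_growth Q μ ν fun l' => chainSum m μ fun l top =>
              A top * rowSum Q l (l' 0) fun t => f (l' 0 :: t)
      _ = _ := by
            rw [ENNReal.tsum_comm]
            refine tsum_congr fun l' => ?_
            rw [← ih l' fun t => f (l' 0 :: t), ← ENNReal.tsum_mul_left]
            exact tsum_congr fun μ => by ring

/-- The number of chains `0 = λ₀ ≺ λ₁ ≺ ⋯ ≺ λₙ = λ`. -/
noncomputable def gtCount : ℕ → (ℕ →₀ ℕ) → ℝ≥0∞
  | 0, l => if l = 0 then 1 else 0
  | n + 1, l => ∑' μ, ilc μ l * gtCount n μ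

lemma chainSum_zero_top (m : ℕ) (κ : ℕ →₀ ℕ) (f : List ℕ → ℝ≥0∞) :
    chainSum m κ (fun l top => (if top = 0 then 1 else 0) * f l) =
      (if κ = 0 then 1 else 0) * f (List.replicate m 0) := by
  induction m generalizing κ f with
  | zero => rfl
  | succ m ih =>
    simp only [chainSum]
    simp only [ih _ fun l => f (_ :: l)]
    rw [tsum_eq_single 0]
    · simp [ilc, interlaces_zero_iff, List.replicate_succ]
    · intro μ hμ; simp [hμ]

lemma rowSum_iterate (M n : ℕ) (f : List ℕ → ℝ≥0∞) :
    (fun f l => rowSum Q l 0 f)^[n] f (List.replicate M 0) =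
      chainSum M 0 fun l top => gtCount n top * Q ^ seqSize top * f l := by
  induction n generalizing f with
  | zero =>
    have := chainSum_zero_top M 0 f
    simp only [if_true, one_mul] at this
    simp only [Function.iterate_zero, id_eq, gtCount]
    rw [← this]
    congr 1
    funext l top
    split_ifs with h
    · simp [h, seqSize]
    · simp
  | succ n ih =>
    rw [Function.iterate_succ_apply, ih]
    have := chainSum_rowSum Q M 0 (fun top => gtCount n top * Q ^ seqSize top) f
    rw [tsum_eq_single 0] at this
    · simp only [wilc, ilc, interlaces_zero_iff, if_true, one_mul, tsub_self, pow_zero,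
        Finsupp.coe_zero, Pi.zero_apply] at this
      rw [this]
      congr 1
      funext l top
      rw [mul_comm]
      congr 1
      simp only [gtCount]
      rw [← ENNReal.tsum_mul_right]
      refine tsum_congr fun μ => ?_
      by_cases h : Interlaces μ top
      · simp only [ilc, h, if_true, one_mul]
        rw [mul_left_comm, ← pow_add, Nat.sub_add_cancel h.seqSize_le]
      · simp [ilc, h]
    · intro κ hκ
      simp [wilc, ilc, interlaces_zero_iff, hκ]

lemma chainSum_getLastD (m : ℕ) (κ : ℕ →₀ ℕ) (f : ℕ → (ℕ →₀ ℕ) → ℝ≥0∞) :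
    chainSum m κ (fun l top => f (l.getLastD (κ 0)) top) =
      chainSum m κ fun _ top => f (top 0) top := by
  induction m generalizing κ with
  | zero => simp [chainSum]
  | succ m ih =>
    simp only [chainSum, List.getLastD_cons]
    exact tsum_congr fun μ => by rw [ih μ]

lemma chainSum_succ_top (m : ℕ) (κ : ℕ →₀ ℕ) (f : (ℕ →₀ ℕ) → ℝ≥0∞) :
    chainSum (m + 1) κ (fun _ top => f top) =
      chainSum m κ fun _ top => ∑' μ, ilc top μ * f μ := by
  induction m generalizing κ with
  | zero => rfl
  | succ m ih =>
    rw [chainSum]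
    simp only [ih]
    rfl

lemma chainSum_eq_tsum_gtCount (m : ℕ) (f : (ℕ →₀ ℕ) → ℝ≥0∞) :
    chainSum m 0 (fun _ top => f top) = ∑' l, gtCount m l * f l := by
  induction m generalizing f with
  | zero =>
    rw [tsum_eq_single 0]
    · simp [chainSum, gtCount]
    · intro l hl; simp [gtCount, hl]
  | succ m ih =>
    rw [chainSum_succ_top, ih]
    simp only [gtCount, ← ENNReal.tsum_mul_left, ← ENNReal.tsum_mul_right]
    rw [ENNReal.tsum_comm]
    exact tsum_congr fun μ => tsum_congr fun l => by ring

/-- The generating function of weight matrices with a bounded last passage time. -/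
theorem rowSum_iterate_le (M N t : ℕ) :
    (fun f l => rowSum Q l 0 f)^[N] (fun l => if l.getLastD 0 ≤ t then 1 else 0)
      (List.replicate M 0) =
      ∑' l, gtCount M l * (gtCount N l * Q ^ seqSize l * if l 0 ≤ t then 1 else 0) := by
  rw [rowSum_iterate, ← chainSum_eq_tsum_gtCount]
  exact chainSum_getLastD M 0 fun g top => gtCount N top * Q ^ seqSize top * if g ≤ t then 1 else 0

end RSK

section LastPassageLaw

open ProbabilityTheory
open scoped ENNReal

lemma dependsOn_lpp (m n : ℕ) : DependsOn (fun W : ℕ × ℕ → ℕ => lpp W m n)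
    ((Finset.Icc 1 m ×ˢ Finset.Icc 1 n : Finset (ℕ × ℕ)) : Set (ℕ × ℕ)) := by
  intro W W' h
  refine lpp_congr (M := m) (N := n) (fun i hi j hj => h _ ?_) m le_rfl n le_rfl
  simp only [Finset.coe_product, Finset.coe_Icc, Set.mem_prod, Set.mem_Icc]
  omega

lemma measurable_lpp {Ω : Type*} [MeasurableSpace Ω] {w : ℕ × ℕ → Ω → ℕ}
    (hw : ∀ p, Measurable (w p)) (m n : ℕ) : Measurable fun ω => lpp (fun p => w p ω) m n :=
  measurable_of_dependsOn hw (dependsOn_lpp m n) id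

/-- The last passage times in row `n`, at the first `M` columns. -/
def lppRow (W : ℕ × ℕ → ℕ) (M n : ℕ) : List ℕ := (List.range M).map fun i => lpp W (i + 1) n

lemma rowUpd_map_lpp (W : ℕ × ℕ → ℕ) (M n s : ℕ) :
    rowUpd ((List.range' s M).map fun i => lpp W (i + 1) n) (lpp W s (n + 1))
      ((List.range' s M).map fun i => W (i + 1, n + 1)) =
      (List.range' s M).map fun i => lpp W (i + 1) (n + 1) := by
  induction M generalizing s with
  | zero => rfl
  | succ M ih =>
    simp only [List.range'_succ, List.map_cons, rowUpd]
    rw [max_comm, ← lpp_succ, ih (s + 1)]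

lemma lppRow_succ (W : ℕ × ℕ → ℕ) (M n : ℕ) :
    lppRow W M (n + 1) = rowUpd (lppRow W M n) 0
      (((List.range M).map fun i => (i + 1, n + 1)).map W) := by
  have := rowUpd_map_lpp W M n 0
  simp only [lpp_zero_left, ← List.range_eq_range'] at this
  simp [lppRow, ← this, Function.comp_def]

lemma getLastD_lppRow (W : ℕ × ℕ → ℕ) (M n : ℕ) : (lppRow W M n).getLastD 0 = lpp W M n := by
  cases M with
  | zero => simp [lppRow]
  | succ M => simp [lppRow, List.range_succ]

lemma dependsOn_lppRow (M n : ℕ) : DependsOn (fun W : ℕ × ℕ → ℕ => lppRow W M n)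
    ((Finset.Icc 1 M ×ˢ Finset.Icc 1 n : Finset (ℕ × ℕ)) : Set (ℕ × ℕ)) := by
  intro W W' h
  refine List.map_congr_left fun i hi => ?_
  rw [List.mem_range] at hi
  refine dependsOn_lpp (i + 1) n fun p hp => h p ?_
  simp only [Finset.coe_product, Finset.coe_Icc, Set.mem_prod, Set.mem_Icc] at hp ⊢
  omega

lemma geomListE_rowUpd {q : ℝ} (hq0 : 0 ≤ q) (hq1 : q ≤ 1) (gs : List ℕ) (a : ℕ)
    (f : List ℕ → ℝ≥0∞) :
    geomListE (List.replicate gs.length q) (fun l => f (rowUpd gs a l)) =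
      ENNReal.ofReal (1 - q) ^ gs.length * rowSum (ENNReal.ofReal q) gs a f := by
  induction gs generalizing a f with
  | nil => simp [geomListE, rowUpd, rowSum]
  | cons g gs ih =>
    simp only [List.length_cons, List.replicate_succ, geomListE, geomE, rowUpd, rowSum]
    rw [← ENNReal.tsum_mul_left]
    refine tsum_congr fun k => ?_
    rw [ih (max g a + k) fun l => f ((max g a + k) :: l), ENNReal.ofReal_mul (by linarith),
      ENNReal.ofReal_pow hq0]
    ring

variable {Ω : Type*} [MeasurableSpace Ω] {μ : Measure Ω} [IsProbabilityMeasure μ]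
  {w : ℕ × ℕ → Ω → ℕ} {par : ℕ × ℕ → ℝ} {q : ℝ}

namespace IsGeomFamily

lemma lintegral_lppRow (h : IsGeomFamily μ w par) (hq0 : 0 ≤ q) (hq1 : q ≤ 1)
    (hpar : ∀ i j, par (i + 1, j + 1) = q) (M n : ℕ) (f : List ℕ → ℝ≥0∞) :
    ∫⁻ ω, f (lppRow (fun p => w p ω) M n) ∂μ = ENNReal.ofReal (1 - q) ^ (M * n) *
      (fun f l => rowSum (ENNReal.ofReal q) l 0 f)^[n] f (List.replicate M 0) := by
  induction n generalizing f with
  | zero => simp [lppRow]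
  | succ n ih =>
    simp only [lppRow_succ]
    have hl : ((List.range M).map fun i => (i + 1, n + 1)).Nodup := by
      refine List.nodup_range.map fun i j hij => ?_
      simpa using hij
    have key := h.lintegral_list _ hl (dependsOn_lppRow M n) (fun p hp => by
      obtain ⟨i, -, rfl⟩ := List.mem_map.1 hp
      simp) fun gs l => f (rowUpd gs 0 l)
    rw [key]
    have e1 : ((List.range M).map fun i => (i + 1, n + 1)).map par = List.replicate M q := by
      refine List.eq_replicate_iff.2 ⟨by simp, fun b hb => ?_⟩
      simp only [List.map_map, List.mem_map, Function.comp_apply, hpar] at hb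
      exact hb.choose_spec.2.symm
    have e2 : ∀ W, M = (lppRow W M n).length := fun W => by simp [lppRow]
    have e3 : ∀ ω, geomListE (List.replicate M q)
        (fun l => f (rowUpd (lppRow (fun p => w p ω) M n) 0 l)) = ENNReal.ofReal (1 - q) ^ M *
          rowSum (ENNReal.ofReal q) (lppRow (fun p => w p ω) M n) 0 f := by
      intro ω
      have := geomListE_rowUpd hq0 hq1 (lppRow (fun p => w p ω) M n) 0 f
      rwa [← e2] at this
    simp only [e1, e3]
    rw [lintegral_const_mul _ (measurable_of_dependsOn h.measurable (dependsOn_lppRow M n)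
      fun l => rowSum (ENNReal.ofReal q) l 0 f), ih fun l => rowSum (ENNReal.ofReal q) l 0 f,
      Function.iterate_succ_apply]
    ring

/-- The distribution of the last passage time as a sum over partitions. -/
theorem measure_lpp_le (h : IsGeomFamily μ w par) (hq0 : 0 ≤ q) (hq1 : q ≤ 1)
    (hpar : ∀ i j, par (i + 1, j + 1) = q) (M N t : ℕ) :
    μ {ω | lpp (fun p => w p ω) M N ≤ t} = ENNReal.ofReal (1 - q) ^ (M * N) *
      ∑' l : ℕ →₀ ℕ, gtCount M l *
        (gtCount N l * ENNReal.ofReal q ^ seqSize l * if l 0 ≤ t then 1 else 0) := by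
  rw [← rowSum_iterate_le, ← h.lintegral_lppRow hq0 hq1 hpar]
  simp only [getLastD_lppRow]
  have hm : MeasurableSet {ω | lpp (fun p => w p ω) M N ≤ t} :=
    measurable_lpp h.measurable M N measurableSet_Iic
  rw [← lintegral_indicator_one hm]
  refine lintegral_congr fun ω => ?_
  simp [Set.indicator]

end IsGeomFamily

end LastPassageLaw

section WeylDimension

open scoped ENNReal Nat

/-- The Weyl dimension formula `∏_{i<j<n} (λᵢ - λⱼ + j - i) / (j - i)`. -/
noncomputable def weylDim (n : ℕ) (l : ℕ → ℕ) : ℝ :=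
  ∏ j ∈ Finset.range n, ∏ i ∈ Finset.range j, (1 + ((l i : ℝ) - l j) / ((j : ℝ) - i))

/-- The determinant of binomial coefficients counting interlacing chains. -/
noncomputable def chooseDet (n : ℕ) (l : Fin n → ℕ) : ℤ :=
  (Matrix.of fun i j : Fin n => Ring.choose ((i : ℤ) - l i) (j : ℕ)).det

lemma prod_range_sub_eq_factorial (j : ℕ) :
    ∏ i ∈ Finset.range j, ((j : ℝ) - i) = (j ! : ℝ) := by
  rw [← Finset.prod_range_add_one_eq_factorial, ← Finset.prod_range_reflect]
  push_cast
  refine Finset.prod_congr rfl fun i hi => ?_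
  rw [Finset.mem_range] at hi
  rw [Nat.cast_sub (by omega), Nat.cast_sub (by omega)]
  push_cast
  ring

lemma Fin.prod_Ioi_eq_prod_range {M : Type*} [CommMonoid M] (n : ℕ) (F : ℕ → ℕ → M) :
    ∏ i : Fin n, ∏ j ∈ Finset.Ioi i, F i j = ∏ j ∈ Finset.range n, ∏ i ∈ Finset.range j, F i j := by
  rw [Finset.prod_comm' (s' := fun j => Finset.Iio j) (t' := Finset.univ) (by simp),
    ← Fin.prod_univ_eq_prod_range (fun j => ∏ i ∈ Finset.range j, F i j)]
  refine Finset.prod_congr rfl fun j _ => ?_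
  rw [← Nat.Iio_eq_range, ← Fin.map_valEmbedding_Iio, Finset.prod_map]
  rfl

lemma chooseDet_eq_weylDim (n : ℕ) (l : ℕ → ℕ) :
    (chooseDet n (fun i => l i) : ℝ) = weylDim n l := by
  have hF : (0 : ℝ) < ∏ j ∈ Finset.range n, (j ! : ℝ) :=
    Finset.prod_pos fun j _ => by positivity
  have e1 : (∏ j : Fin n, ((j : ℕ) ! : ℤ)) * chooseDet n (fun i => l i) =
      ∏ i : Fin n, ∏ j ∈ Finset.Ioi i, (((j : ℕ) - l j : ℤ) - ((i : ℕ) - l i)) := by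
    rw [← Matrix.det_vandermonde (fun i : Fin n => ((i : ℕ) - l i : ℤ)),
      Matrix.det_eval_matrixOfPolynomials_eq_det_vandermonde _ (fun i => descPochhammer ℤ i)
      (fun i => descPochhammer_natDegree ℤ i) (fun i => monic_descPochhammer ℤ i), chooseDet,
      ← Matrix.det_mul_row]
    congr 1
    ext i j
    simp only [Matrix.of_apply]
    have := Ring.descPochhammer_eq_factorial_smul_choose ((i : ℕ) - l i : ℤ) j
    rw [Polynomial.eval_eq_smeval, this, nsmul_eq_mul]
  have e2 : (∏ j ∈ Finset.range n, (j ! : ℝ)) * (chooseDet n (fun i => l i) : ℝ) =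
      ∏ j ∈ Finset.range n, ∏ i ∈ Finset.range j, (((j : ℝ) - l j) - (i - l i)) := by
    have := congrArg (Int.cast (R := ℝ)) e1
    push_cast at this
    rw [← Fin.prod_univ_eq_prod_range (fun j => (j ! : ℝ)), this,
      Fin.prod_Ioi_eq_prod_range n fun i j => (((j : ℝ) - l j) - (i - l i))]
  refine mul_left_cancel₀ hF.ne' (e2.trans ?_)
  rw [weylDim, ← Finset.prod_mul_distrib]
  refine Finset.prod_congr rfl fun j _ => ?_
  rw [← prod_range_sub_eq_factorial, ← Finset.prod_mul_distrib]
  refine Finset.prod_congr rfl fun i hi => ?_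
  rw [Finset.mem_range] at hi
  have : (0 : ℝ) < j - i := by
    rw [sub_pos]; exact_mod_cast hi
  field_simp
  ring

lemma sum_choose_Icc (i : ℤ) (k : ℕ) {a b : ℕ} (hab : a ≤ b) :
    ∑ m ∈ Finset.Icc a b, Ring.choose (i - m) k =
      Ring.choose (i + 1 - a) (k + 1) - Ring.choose (i - b) (k + 1) := by
  induction b, hab using Nat.le_induction with
  | base =>
    rw [Finset.Icc_self, Finset.sum_singleton, show i + 1 - (a : ℤ) = i - a + 1 by ring,
      Ring.choose_succ_succ]
    ring
  | succ b hab ih =>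
    rw [← Finset.insert_Icc_right_eq_Icc_add_one (by omega), Finset.sum_insert (by simp), ih]
    have := Ring.choose_succ_succ (i - (b + 1) : ℤ) k
    rw [show i - ((b : ℤ) + 1) + 1 = i - b by ring] at this
    push_cast
    rw [this]
    ring

lemma sum_chooseDet (n : ℕ) {l : ℕ → ℕ} (hl : Antitone l) :
    ∑ m ∈ Fintype.piFinset fun i : Fin n => Finset.Icc (l (i + 1)) (l i), chooseDet n m =
      chooseDet (n + 1) fun i => l i := by
  have e1 := (Matrix.detRowAlternating (n := Fin n) (R := ℤ)).toMultilinearMap.map_sum_finset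
    (fun i (m : ℕ) j => Ring.choose ((i : ℕ) - m : ℤ) (j : ℕ))
    fun i : Fin n => Finset.Icc (l (i + 1)) (l i)
  have e2 : ∑ m ∈ Fintype.piFinset fun i : Fin n => Finset.Icc (l (i + 1)) (l i), chooseDet n m =
      (Matrix.of fun i j : Fin n => ∑ m ∈ Finset.Icc (l (i + 1)) (l i),
        Ring.choose ((i : ℕ) - m : ℤ) (j : ℕ)).det := by
    refine e1.symm.trans ?_
    change Matrix.det _ = _
    congr 1
    ext i j
    simp [Finset.sum_apply]
  rw [e2]
  set B : Matrix (Fin (n + 1)) (Fin (n + 1)) ℤ := Matrix.of fun i j => Fin.cases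
    (Ring.choose ((0 : ℤ) - l 0) (j : ℕ))
    (fun i => Ring.choose ((i : ℕ) + 1 - l (i + 1) : ℤ) (j : ℕ)
      - Ring.choose ((i : ℕ) - l i : ℤ) (j : ℕ)) i with hB
  have e3 : chooseDet (n + 1) (fun i => l i) = B.det := by
    refine Matrix.det_eq_of_forall_row_eq_smul_add_pred (fun _ => 1) (fun j => ?_) fun i j => ?_
    · simp [hB]
    · simp [hB]
  rw [e3, Matrix.det_succ_column_zero, Finset.sum_eq_single 0]
  · simp only [hB, Fin.val_zero, pow_zero, one_mul, Matrix.of_apply, Fin.cases_zero,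
      Ring.choose_zero_right]
    congr 1
    ext i j
    simp only [Matrix.of_apply, Matrix.submatrix_apply, Fin.zero_succAbove, Fin.cases_succ,
      Fin.val_succ]
    exact sum_choose_Icc _ _ (hl (Nat.le_succ _))
  · intro i _ hi
    obtain ⟨i, rfl⟩ := Fin.exists_succ_eq.2 hi
    simp [hB]
  · simp

lemma one_le_weylDim {l : ℕ → ℕ} (hl : Antitone l) (n : ℕ) : 1 ≤ weylDim n l := by
  refine Finset.one_le_prod fun j _ => Finset.one_le_prod fun i hi => ?_
  rw [Finset.mem_range] at hi
  have h1 : (0 : ℝ) < j - i := by rw [sub_pos]; exact_mod_cast hi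
  have h2 : (0 : ℝ) ≤ l i - l j := by rw [sub_nonneg]; exact_mod_cast hl hi.le
  have := div_nonneg h2 h1.le
  linarith

/-- The partitions with at most `n` parts. -/
def IsPartition (n : ℕ) (l : ℕ → ℕ) : Prop := Antitone l ∧ ∀ i, n ≤ i → l i = 0

/-- The finitely supported sequence extending a tuple by zeros. -/
noncomputable def tupleSeq (n : ℕ) : (Fin n → ℕ) ↪ (ℕ →₀ ℕ) where
  toFun m := (Finsupp.equivFunOnFinite.symm m).embDomain Fin.valEmbedding
  inj' := (Finsupp.embDomain_injective _).comp Finsupp.equivFunOnFinite.symm.injective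

lemma tupleSeq_apply (n : ℕ) (m : Fin n → ℕ) (i : Fin n) : tupleSeq n m i = m i := by
  exact Finsupp.embDomain_apply_self Fin.valEmbedding _ i

lemma tupleSeq_eq_zero (n : ℕ) (m : Fin n → ℕ) (i : ℕ) (hi : n ≤ i) : tupleSeq n m i = 0 := by
  refine Finsupp.embDomain_of_notMem_range _ _ _ ?_
  rintro ⟨j, rfl⟩
  exact absurd j.2 (not_lt.2 hi)

lemma Interlaces.antitone_left {κ μ : ℕ →₀ ℕ} (h : Interlaces κ μ) : Antitone κ :=
  antitone_nat_of_succ_le fun i => (h (i + 1)).1.trans (h i).2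

lemma Interlaces.antitone_right {κ μ : ℕ →₀ ℕ} (h : Interlaces κ μ) : Antitone μ :=
  antitone_nat_of_succ_le fun i => (h i).2.trans (h i).1

lemma interlaces_tupleSeq {n : ℕ} {l : ℕ →₀ ℕ} (hl : IsPartition (n + 1) l) {m : Fin n → ℕ}
    (hm : m ∈ Fintype.piFinset fun i : Fin n => Finset.Icc (l (i + 1)) (l i)) :
    Interlaces (tupleSeq n m) l := by
  intro i
  rcases lt_or_ge i n with hi | hi
  · have := Finset.mem_Icc.1 (Fintype.mem_piFinset.1 hm ⟨i, hi⟩)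
    have e : tupleSeq n m i = m ⟨i, hi⟩ := tupleSeq_apply n m ⟨i, hi⟩
    rw [e]
    exact ⟨this.2, this.1⟩
  · rw [tupleSeq_eq_zero n m i hi, hl.2 (i + 1) (by omega)]
    simp

open Classical in
/-- The number of interlacing chains is given by the Weyl dimension formula. -/
theorem gtCount_eq_weylDim (n : ℕ) (l : ℕ →₀ ℕ) :
    gtCount n l = if IsPartition n l then ENNReal.ofReal (weylDim n l) else 0 := by
  induction n generalizing l with
  | zero =>
    have : l = 0 ↔ IsPartition 0 l :=
      ⟨fun h => by subst h; exact ⟨fun _ _ _ => le_rfl, fun _ _ => rfl⟩,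
        fun h => Finsupp.ext fun i => h.2 i (Nat.zero_le i)⟩
    simp [gtCount, this, weylDim]
  | succ n ih =>
    simp only [gtCount, ih]
    split_ifs with hl
    · have key : ∀ m ∈ Fintype.piFinset fun i : Fin n => Finset.Icc (l (i + 1)) (l i),
          IsPartition n (tupleSeq n m) ∧ weylDim n (tupleSeq n m) = (chooseDet n m : ℝ) := by
        intro m hm
        refine ⟨⟨(interlaces_tupleSeq hl hm).antitone_left, tupleSeq_eq_zero n m⟩, ?_⟩
        rw [← chooseDet_eq_weylDim]
        simp only [tupleSeq_apply]
      rw [tsum_eq_sum (s := (Fintype.piFinset fun i : Fin n =>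
        Finset.Icc (l (i + 1)) (l i)).map (tupleSeq n)), Finset.sum_map,
        ← chooseDet_eq_weylDim, ← sum_chooseDet n hl.1, Int.cast_sum, ENNReal.ofReal_sum_of_nonneg]
      · refine Finset.sum_congr rfl fun m hm => ?_
        rw [if_pos (key m hm).1, (key m hm).2, ilc, if_pos (interlaces_tupleSeq hl hm), one_mul]
      · intro m hm
        rw [← (key m hm).2]
        exact zero_le_one.trans (one_le_weylDim (key m hm).1.1 n)
      · intro μ hμ
        by_contra hne
        have h1 : Interlaces μ l := by
          by_contra hn; simp [ilc, hn] at hne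
        have h2 : IsPartition n μ := by
          by_contra hn; simp [hn] at hne
        refine hμ (Finset.mem_map.2 ⟨fun i => μ i, ?_, ?_⟩)
        · exact Fintype.mem_piFinset.2 fun i => Finset.mem_Icc.2 ⟨(h1 i).2, (h1 i).1⟩
        · ext i
          rcases lt_or_ge i n with hi | hi
          · exact tupleSeq_apply n (fun i => μ i) ⟨i, hi⟩
          · rw [tupleSeq_eq_zero _ _ i hi, h2.2 i hi]
    · rw [ENNReal.tsum_eq_zero]
      intro μ
      by_contra hne
      have h1 : Interlaces μ l := by
        by_contra hn; simp [ilc, hn] at hne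
      have h2 : IsPartition n μ := by
        by_contra hn; simp [hn] at hne
      refine hl ⟨h1.antitone_right, ?_⟩
      rintro (_ | i) hi
      · omega
      · exact Nat.le_zero.1 ((h1 i).2.trans (h2.2 i (by omega)).le)

end WeylDimension

section PartitionBounds

open scoped ENNReal

/-- The contribution of a partition to the distribution of the last passage time. -/
noncomputable def partWeight (q : ℝ) (M N : ℕ) (l : ℕ → ℕ) : ℝ :=
  (1 - q) ^ (M * N) * (weylDim M l * (weylDim N l * q ^ ∑ i ∈ Finset.range N, l i))

lemma partWeight_pos {q : ℝ} (hq0 : 0 < q) (hq1 : q < 1) (M N : ℕ) {l : ℕ → ℕ} (hl : Antitone l) :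
    0 < partWeight q M N l := by
  have h1 := one_le_weylDim hl M
  have h2 := one_le_weylDim hl N
  have h3 : 0 < 1 - q := by linarith
  unfold partWeight
  positivity

lemma IsPartition.mono {M N : ℕ} {l : ℕ → ℕ} (h : IsPartition N l) (hNM : N ≤ M) :
    IsPartition M l := ⟨h.1, fun i hi => h.2 i (hNM.trans hi)⟩

lemma IsPartition.exists_tupleSeq {N : ℕ} {l : ℕ → ℕ} (h : IsPartition N l) :
    ⇑(tupleSeq N fun i => l i) = l := by
  funext i
  rcases lt_or_ge i N with hi | hi
  · exact tupleSeq_apply N (fun i => l i) ⟨i, hi⟩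
  · rw [tupleSeq_eq_zero _ _ i hi, h.2 i hi]

variable {Ω : Type*} [MeasurableSpace Ω] {μ : Measure Ω} [IsProbabilityMeasure μ]
  {w : ℕ × ℕ → Ω → ℕ} {par : ℕ × ℕ → ℝ} {q : ℝ}

lemma ofReal_partWeight (hq0 : 0 < q) (hq1 : q < 1) {M N : ℕ} (hNM : N ≤ M) {t : ℕ}
    {l : ℕ →₀ ℕ} (hl : IsPartition N l) (ht : l 0 ≤ t) :
    ENNReal.ofReal (1 - q) ^ (M * N) * (gtCount M l *
      (gtCount N l * ENNReal.ofReal q ^ seqSize l * if l 0 ≤ t then 1 else 0)) =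
      ENNReal.ofReal (partWeight q M N l) := by
  have h1 := zero_le_one.trans (one_le_weylDim hl.1 M)
  have h2 := zero_le_one.trans (one_le_weylDim hl.1 N)
  have h3 : 0 < 1 - q := by linarith
  rw [gtCount_eq_weylDim, gtCount_eq_weylDim, if_pos hl, if_pos (hl.mono hNM), if_pos ht, mul_one,
    partWeight, ENNReal.ofReal_mul (by positivity), ENNReal.ofReal_mul h1, ENNReal.ofReal_mul h2,
    ENNReal.ofReal_pow h3.le, ENNReal.ofReal_pow hq0.le, seqSize_eq_sum_range l hl.2]

namespace IsGeomFamily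

lemma partWeight_le (h : IsGeomFamily μ w par) (hq0 : 0 < q) (hq1 : q < 1)
    (hpar : ∀ i j, par (i + 1, j + 1) = q) {M N : ℕ} (hNM : N ≤ M) {t : ℕ}
    {l : ℕ → ℕ} (hl : IsPartition N l) (ht : l 0 ≤ t) :
    partWeight q M N l ≤ (μ {ω | lpp (fun p => w p ω) M N ≤ t}).toReal := by
  obtain ⟨l, rfl⟩ : ∃ l' : ℕ →₀ ℕ, ⇑l' = l := ⟨_, hl.exists_tupleSeq⟩
  refine (ENNReal.ofReal_le_iff_le_toReal (measure_ne_top _ _)).1 ?_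
  rw [← ofReal_partWeight hq0 hq1 hNM hl ht, h.measure_lpp_le hq0.le hq1.le hpar]
  gcongr
  exact ENNReal.le_tsum (f := fun l : ℕ →₀ ℕ => gtCount M l *
      (gtCount N l * ENNReal.ofReal q ^ seqSize l * if l 0 ≤ t then 1 else 0)) l

lemma exists_le_partWeight (h : IsGeomFamily μ w par) (hq0 : 0 < q) (hq1 : q < 1)
    (hpar : ∀ i j, par (i + 1, j + 1) = q) {M N : ℕ} (hNM : N ≤ M) (t : ℕ) :
    ∃ l : ℕ → ℕ, IsPartition N l ∧ l 0 ≤ t ∧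
      (μ {ω | lpp (fun p => w p ω) M N ≤ t}).toReal ≤ (t + 1) ^ N * partWeight q M N l := by
  classical
  set F : Finset (ℕ →₀ ℕ) := ((Fintype.piFinset fun _ : Fin N => Finset.range (t + 1)).map
    (tupleSeq N)).filter fun l => IsPartition N l ∧ l 0 ≤ t with hF
  have hmem : ∀ l : ℕ →₀ ℕ, l ∈ F ↔ IsPartition N l ∧ l 0 ≤ t := by
    intro l
    rw [hF, Finset.mem_filter, and_iff_right_iff_imp]
    rintro ⟨h1, h2⟩
    refine Finset.mem_map.2 ⟨fun i => l i, Fintype.mem_piFinset.2 fun i => ?_, ?_⟩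
    · have := h1.1 (Nat.zero_le i)
      exact Finset.mem_range.2 (by omega)
    · exact DFunLike.coe_injective h1.exists_tupleSeq
  have hne : F.Nonempty := ⟨0, (hmem 0).2 ⟨⟨fun _ _ _ => le_rfl, fun _ _ => rfl⟩, Nat.zero_le _⟩⟩
  have hcard : F.card ≤ (t + 1) ^ N := by
    refine (Finset.card_filter_le _ _).trans ?_
    simp
  obtain ⟨l, hlF, hmax⟩ := F.exists_max_image (fun l => partWeight q M N l) hne
  obtain ⟨h1, h2⟩ := (hmem l).1 hlF
  have h0 := (partWeight_pos hq0 hq1 M N h1.1).le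
  refine ⟨l, h1, h2, ENNReal.toReal_le_of_le_ofReal (by positivity) ?_⟩
  rw [h.measure_lpp_le hq0.le hq1.le hpar, ← ENNReal.tsum_mul_left, tsum_eq_sum (s := F)]
  · calc _ ≤ ∑ l' ∈ F, ENNReal.ofReal (partWeight q M N l) := by
          refine Finset.sum_le_sum fun l' hl' => ?_
          obtain ⟨h1', h2'⟩ := (hmem l').1 hl'
          rw [ofReal_partWeight hq0 hq1 hNM h1' h2']
          exact ENNReal.ofReal_le_ofReal (hmax l' hl')
      _ ≤ _ := by
          rw [Finset.sum_const, nsmul_eq_mul, ENNReal.ofReal_mul (by positivity)]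
          gcongr
          rw [ENNReal.ofReal_pow (by positivity)]
          refine (Nat.cast_le.2 hcard).trans ?_
          rw [show ((t : ℝ) + 1) = ((t + 1 : ℕ) : ℝ) by push_cast; rfl, ENNReal.ofReal_natCast]
          push_cast
          rfl
  · intro l' hl'
    rw [hmem, not_and_or] at hl'
    rw [gtCount_eq_weylDim N]
    rcases hl' with hl' | hl' <;> simp [hl']

end IsGeomFamily

end PartitionBounds

section BlowUp

/-- The partition whose diagram is that of `l` scaled by `k` in both directions. -/
def blowUp (k : ℕ) (l : ℕ → ℕ) (i : ℕ) : ℕ := k * l (i / k)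

lemma blowUp_mul_add (k : ℕ) (l : ℕ → ℕ) (a : ℕ) {b : ℕ} (hb : b < k) :
    blowUp k l (k * a + b) = k * l a := by
  rw [blowUp, Nat.mul_add_div (by omega), Nat.div_eq_of_lt hb, add_zero]

lemma IsPartition.blowUp {N : ℕ} {l : ℕ → ℕ} (h : IsPartition N l) {k : ℕ} (hk : 0 < k) :
    IsPartition (k * N) (blowUp k l) := by
  refine ⟨fun i j hij => Nat.mul_le_mul_left _ (h.1 (Nat.div_le_div_right hij)), fun i hi => ?_⟩
  rw [_root_.blowUp, h.2 _ ((Nat.le_div_iff_mul_le hk).2 (by rwa [mul_comm])), mul_zero]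

@[to_additive]
lemma Finset.prod_range_blocks {M : Type*} [CommMonoid M] (k n : ℕ) (F : ℕ → M) :
    ∏ i ∈ Finset.range (k * n), F i =
      ∏ a ∈ Finset.range n, ∏ b ∈ Finset.range k, F (k * a + b) := by
  induction n with
  | zero => simp
  | succ n ih => rw [mul_add_one, Finset.prod_range_add, ih, Finset.prod_range_succ]

lemma sum_blowUp (k N : ℕ) (l : ℕ → ℕ) :
    ∑ i ∈ Finset.range (k * N), blowUp k l i = k ^ 2 * ∑ i ∈ Finset.range N, l i := by
  rw [Finset.sum_range_blocks, Finset.mul_sum]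
  refine Finset.sum_congr rfl fun a _ => ?_
  rw [Finset.sum_congr rfl fun b hb => blowUp_mul_add k l a (Finset.mem_range.1 hb)]
  rw [Finset.sum_const, Finset.card_range, smul_eq_mul]
  ring

lemma one_le_weylFactor {l : ℕ → ℕ} (hl : Antitone l) {i j : ℕ} (hij : i < j) :
    1 ≤ 1 + ((l i : ℝ) - l j) / ((j : ℝ) - i) := by
  have h1 : (0 : ℝ) < j - i := by rw [sub_pos]; exact_mod_cast hij
  have h2 : (0 : ℝ) ≤ l i - l j := by rw [sub_nonneg]; exact_mod_cast hl hij.le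
  have := div_nonneg h2 h1.le
  linarith

lemma weylDim_mono {l : ℕ → ℕ} (hl : Antitone l) {m n : ℕ} (hmn : m ≤ n) :
    weylDim m l ≤ weylDim n l := by
  induction n, hmn using Nat.le_induction with
  | base => rfl
  | succ n _ ih =>
    refine ih.trans ?_
    rw [weylDim, weylDim, Finset.prod_range_succ]
    refine le_mul_of_one_le_right (zero_le_one.trans (one_le_weylDim hl n)) ?_
    exact Finset.one_le_prod fun i hi => one_le_weylFactor hl (Finset.mem_range.1 hi)

lemma pow_le_prod_block {k : ℕ} {L Δ : ℝ} (hL : 0 ≤ L) (hΔ : 1 ≤ Δ) :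
    (1 + L / Δ) ^ k ^ 2 ≤ ∏ b ∈ Finset.range k, ∏ d ∈ Finset.range k,
      (1 + k * L / (k * Δ + (b - d))) := by
  have hpos : ∀ b ∈ Finset.range k, ∀ d ∈ Finset.range k, 0 < (k : ℝ) * Δ + (b - d) := by
    intro b _ d hd
    have h1 : (d : ℝ) < k := by exact_mod_cast Finset.mem_range.1 hd
    have h2 : (0 : ℝ) ≤ b := Nat.cast_nonneg b
    nlinarith
  have hf : ∀ b ∈ Finset.range k, ∀ d ∈ Finset.range k,
      0 < 1 + k * L / (k * Δ + (b - d)) := by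
    intro b hb d hd
    have := div_nonneg (mul_nonneg (Nat.cast_nonneg k) hL) (hpos b hb d hd).le
    linarith
  refine le_of_sq_le_sq ?_ (Finset.prod_nonneg fun b hb => Finset.prod_nonneg fun d hd =>
    (hf b hb d hd).le)
  have e : (∏ b ∈ Finset.range k, ∏ d ∈ Finset.range k,
      (1 + k * L / (k * Δ + ((b : ℝ) - d)))) ^ 2 = ∏ b ∈ Finset.range k, ∏ d ∈ Finset.range k,
      ((1 + k * L / (k * Δ + (b - d))) * (1 + k * L / (k * Δ + (d - b)))) := by
    rw [sq]
    conv_lhs => rhs; rw [Finset.prod_comm]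
    simp only [← Finset.prod_mul_distrib]
  rw [e]
  have e' : ((1 + L / Δ) ^ k ^ 2) ^ 2 =
      ∏ b ∈ Finset.range k, ∏ d ∈ Finset.range k, (1 + L / Δ) ^ 2 := by
    simp only [Finset.prod_const, Finset.card_range, ← pow_mul]
    congr 1
    ring
  rw [e']
  refine Finset.prod_le_prod (fun b _ => Finset.prod_nonneg fun d _ => by positivity)
    fun b hb => Finset.prod_le_prod (fun d _ => by positivity) fun d hd => ?_
  have h1 := hpos b hb d hd
  have h2 := hpos d hd b hb
  have hΔ0 : 0 < Δ := by linarith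
  have e1 : 1 + L / Δ = (Δ + L) / Δ := by field_simp
  have e2 : 1 + k * L / (k * Δ + ((b : ℝ) - d)) =
    (k * (Δ + L) + (b - d)) / (k * Δ + (b - d)) := by field_simp; ring
  have e3 : 1 + k * L / (k * Δ + ((d : ℝ) - b)) =
    (k * (Δ + L) + (d - b)) / (k * Δ + (d - b)) := by field_simp; ring
  rw [e1, e2, e3, div_mul_div_comm, div_pow, div_le_div_iff₀ (by positivity) (by positivity)]
  have : 0 ≤ ((b : ℝ) - d) ^ 2 * ((Δ + L) ^ 2 - Δ ^ 2) :=
    mul_nonneg (sq_nonneg _) (by nlinarith)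
  nlinarith

lemma weylDim_pow_le {l : ℕ → ℕ} (hl : Antitone l) (k n : ℕ) :
    weylDim n l ^ k ^ 2 ≤ weylDim (k * n) (blowUp k l) := by
  have hb : Antitone (blowUp k l) := fun i j hij =>
    Nat.mul_le_mul_left _ (hl (Nat.div_le_div_right hij))
  rw [weylDim, weylDim, Finset.prod_range_blocks, ← Finset.prod_pow]
  refine Finset.prod_le_prod (fun a ha => ?_) fun a ha => ?_
  · exact pow_nonneg (Finset.prod_nonneg fun c hc => zero_le_one.trans
      (one_le_weylFactor hl (Finset.mem_range.1 hc))) _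
  calc (∏ c ∈ Finset.range a, (1 + ((l c : ℝ) - l a) / ((a : ℝ) - c))) ^ k ^ 2
      ≤ ∏ c ∈ Finset.range a, ∏ b ∈ Finset.range k, ∏ d ∈ Finset.range k,
        (1 + k * ((l c : ℝ) - l a) / (k * (a - c) + (b - d))) := by
        rw [← Finset.prod_pow]
        refine Finset.prod_le_prod (fun c hc => pow_nonneg (zero_le_one.trans
          (one_le_weylFactor hl (Finset.mem_range.1 hc))) _) fun c hc => ?_
        rw [Finset.mem_range] at hc
        refine pow_le_prod_block ?_ ?_
        · rw [sub_nonneg]; exact_mod_cast hl hc.le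
        · rw [le_sub_iff_add_le]; exact_mod_cast (by omega : 1 + c ≤ a)
    _ = ∏ b ∈ Finset.range k, ∏ i ∈ Finset.range (k * a),
        (1 + ((blowUp k l i : ℝ) - blowUp k l (k * a + b)) / (((k * a + b : ℕ) : ℝ) - i)) := by
        rw [Finset.prod_comm]
        refine Finset.prod_congr rfl fun b hb => ?_
        rw [Finset.prod_range_blocks]
        refine Finset.prod_congr rfl fun c _ => Finset.prod_congr rfl fun d hd => ?_
        rw [blowUp_mul_add _ _ _ (Finset.mem_range.1 hb),
          blowUp_mul_add _ _ _ (Finset.mem_range.1 hd)]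
        push_cast
        congr 2 <;> ring
    _ ≤ _ := by
        refine Finset.prod_le_prod (fun b _ => Finset.prod_nonneg fun i hi => zero_le_one.trans
          (one_le_weylFactor hb ?_)) fun b _ => ?_
        · have := Finset.mem_range.1 hi; omega
        · rw [Finset.prod_range_add]
          refine le_mul_of_one_le_right (Finset.prod_nonneg fun i hi => zero_le_one.trans
            (one_le_weylFactor hb ?_)) (Finset.one_le_prod fun i hi => one_le_weylFactor hb ?_)
          · have := Finset.mem_range.1 hi; omega
          · have := Finset.mem_range.1 hi; omega

lemma log_partWeight {q : ℝ} (hq0 : 0 < q) (hq1 : q < 1) (M N : ℕ) {l : ℕ → ℕ} (hl : Antitone l) :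
    Real.log (partWeight q M N l) = M * N * Real.log (1 - q) + (Real.log (weylDim M l) +
      (Real.log (weylDim N l) + (∑ i ∈ Finset.range N, l i : ℕ) * Real.log q)) := by
  have h1 := one_le_weylDim hl M
  have h2 := one_le_weylDim hl N
  have h3 : 0 < 1 - q := by linarith
  rw [partWeight, Real.log_mul (by positivity) (by positivity), Real.log_mul (by positivity)
    (by positivity), Real.log_mul (by positivity) (by positivity), Real.log_pow, Real.log_pow]
  push_cast
  rfl

lemma log_partWeight_blowUp {q : ℝ} (hq0 : 0 < q) (hq1 : q < 1) {M N M' N' k : ℕ} (hk : 0 < k)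
    (hM : k * M ≤ M') (hN : k * N ≤ N') {l : ℕ → ℕ} (hl : IsPartition N l) :
    (k : ℝ) ^ 2 * Real.log (partWeight q M N l) +
      (M' * N' - k ^ 2 * (M * N)) * Real.log (1 - q) ≤
      Real.log (partWeight q M' N' (blowUp k l)) := by
  have hb := hl.blowUp hk
  have hlog : ∀ {m m' : ℕ}, k * m ≤ m' →
      (k : ℝ) ^ 2 * Real.log (weylDim m l) ≤ Real.log (weylDim m' (blowUp k l)) := by
    intro m m' hm
    have h1 := one_le_weylDim hl.1 m
    have := Real.log_le_log (by positivity) ((weylDim_pow_le hl.1 k m).trans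
      (weylDim_mono hb.1 hm))
    rw [Real.log_pow] at this
    exact_mod_cast this
  have h1 := hlog hM
  have h2 := hlog hN
  have hs : ∑ i ∈ Finset.range N', blowUp k l i = k ^ 2 * ∑ i ∈ Finset.range N, l i := by
    rw [← sum_blowUp]
    refine (Finset.sum_subset (Finset.range_mono hN) fun i _ hi => hb.2 i ?_).symm
    simpa using hi
  rw [log_partWeight hq0 hq1 _ _ hl.1, log_partWeight hq0 hq1 _ _ hb.1, hs]
  push_cast
  linarith

end BlowUp

section LimitExistence

lemma exists_tendsto_of_eventually_le {z err : ℕ → ℝ} (hz : ∀ n, 0 ≤ z n)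
    (herr : Tendsto err atTop (nhds 0))
    (h : ∀ n, 1 ≤ n → ∀ δ > 0, ∀ᶠ m in atTop, z m ≤ z n + err n + δ) :
    ∃ L, Tendsto z atTop (nhds L) := by
  have hb1 : IsBoundedUnder (· ≥ ·) atTop z := isBoundedUnder_of ⟨0, hz⟩
  have hb2 : IsBoundedUnder (· ≤ ·) atTop z := ⟨_, by
    simpa using h 1 le_rfl 1 one_pos⟩
  refine ⟨liminf z atTop, tendsto_order.2 ⟨fun a ha => eventually_lt_of_lt_liminf ha hb1,
    fun a ha => ?_⟩⟩
  set δ := (a - liminf z atTop) / 4 with hδ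
  have hδ0 : 0 < δ := by rw [hδ]; linarith
  have hf : ∃ᶠ n in atTop, z n < liminf z atTop + δ :=
    frequently_lt_of_liminf_lt hb2.isCoboundedUnder_ge (by linarith)
  obtain ⟨n, hn1, hn2, hn3⟩ := (hf.and_eventually
    ((herr.eventually_lt_const hδ0).and (eventually_ge_atTop 1))).exists
  filter_upwards [h n hn3 δ hδ0] with m hm
  linarith

lemma tendsto_log_floor_add_one_div {x : ℝ} (hx : 0 < x) :
    Tendsto (fun N : ℕ => Real.log (⌊(N : ℝ) * x⌋₊ + 1) / N) atTop (nhds 0) := by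
  have h1 : Tendsto (fun N : ℕ => (N : ℝ) * x + 1) atTop atTop :=
    tendsto_atTop_add_const_right _ _ (tendsto_natCast_atTop_atTop.atTop_mul_const hx)
  have h2 := (Real.tendsto_pow_log_div_mul_add_atTop (1 / x) (-1 / x) 1 (by positivity)).comp h1
  refine squeeze_zero (fun N => ?_) (fun N => ?_) h2
  · have : (0 : ℝ) ≤ (⌊(N : ℝ) * x⌋₊ : ℝ) := Nat.cast_nonneg _
    exact div_nonneg (Real.log_nonneg (by linarith)) (Nat.cast_nonneg _)
  · have hfl := Nat.floor_le (show 0 ≤ (N : ℝ) * x by positivity)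
    simp only [Function.comp_apply, pow_one]
    rw [show 1 / x * ((N : ℝ) * x + 1) + -1 / x = N by field_simp; ring]
    gcongr

variable {Ω : Type*} [MeasurableSpace Ω] {μ : Measure Ω} [IsProbabilityMeasure μ]
  {w : ℕ × ℕ → Ω → ℕ} {par : ℕ × ℕ → ℝ} {q : ℝ}

namespace IsGeomFamily

lemma measure_lpp_le_pos (h : IsGeomFamily μ w par) (hq0 : 0 < q) (hq1 : q < 1)
    (hpar : ∀ i j, par (i + 1, j + 1) = q) {M N : ℕ} (hNM : N ≤ M) (t : ℕ) :
    0 < (μ {ω | lpp (fun p => w p ω) M N ≤ t}).toReal :=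
  (partWeight_pos hq0 hq1 M N (l := 0) fun _ _ _ => le_rfl).trans_le
    (h.partWeight_le hq0 hq1 hpar hNM ⟨fun _ _ _ => le_rfl, fun _ _ => rfl⟩ (Nat.zero_le t))

/-- Approximate superadditivity of the logarithm of the distribution function. -/
lemma log_measure_lpp_le_scale (h : IsGeomFamily μ w par) (hq0 : 0 < q) (hq1 : q < 1)
    (hpar : ∀ i j, par (i + 1, j + 1) = q) {M N M' N' t t' k : ℕ} (hk : 0 < k)
    (hNM : N ≤ M) (hNM' : N' ≤ M') (hM : k * M ≤ M') (hN : k * N ≤ N') (ht : k * t ≤ t') :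
    (k : ℝ) ^ 2 * (Real.log (μ {ω | lpp (fun p => w p ω) M N ≤ t}).toReal
        - N * Real.log (t + 1)) + (M' * N' - k ^ 2 * (M * N)) * Real.log (1 - q) ≤
      Real.log (μ {ω | lpp (fun p => w p ω) M' N' ≤ t'}).toReal := by
  obtain ⟨l, hl, hlt, hle⟩ := h.exists_le_partWeight hq0 hq1 hpar hNM t
  have hw := partWeight_pos hq0 hq1 M N hl.1
  have hb := (hl.blowUp hk).mono hN
  have h1 : Real.log (partWeight q M' N' (blowUp k l)) ≤ _ :=
    Real.log_le_log (partWeight_pos hq0 hq1 M' N' hb.1)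
      (h.partWeight_le hq0 hq1 hpar hNM' hb (t := t')
        ((Nat.mul_le_mul_left k (by simpa using hlt)).trans ht))
  have h2 := log_partWeight_blowUp hq0 hq1 hk hM hN hl
  have h3 := Real.log_le_log (h.measure_lpp_le_pos hq0 hq1 hpar hNM t) hle
  rw [Real.log_mul (by positivity) hw.ne', Real.log_pow] at h3
  refine le_trans ?_ (h2.trans h1)
  gcongr
  linarith

theorem exists_tendsto_log_measure (h : IsGeomFamily μ w par) (hq0 : 0 < q) (hq1 : q < 1)
    (hpar : ∀ i j, par (i + 1, j + 1) = q) {γ x : ℝ} (hγ : 1 ≤ γ) (hx : 0 < x) :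
    ∃ L, Tendsto (fun N : ℕ => -Real.log (μ {ω | lpp (fun p => w p ω) ⌊γ * N⌋₊ N ≤
      ⌊(N : ℝ) * x⌋₊}).toReal / (N : ℝ) ^ 2) atTop (nhds L) := by
  set a : ℕ → ℝ := fun N => -Real.log (μ {ω | lpp (fun p => w p ω) ⌊γ * N⌋₊ N ≤
      ⌊(N : ℝ) * x⌋₊}).toReal with ha
  set c := -Real.log (1 - q) with hc
  have hc0 : 0 ≤ c := by
    rw [hc, neg_nonneg]; exact Real.log_nonpos (by linarith) (by linarith)
  have hNM : ∀ N : ℕ, N ≤ ⌊γ * N⌋₊ := fun N => Nat.le_floor (by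
    have : (0 : ℝ) ≤ N := Nat.cast_nonneg N
    nlinarith)
  have ha0 : ∀ N, 0 ≤ a N := fun N => by
    rw [ha, neg_nonneg]
    refine Real.log_nonpos ENNReal.toReal_nonneg ?_
    exact ENNReal.toReal_le_of_le_ofReal zero_le_one (by simpa using prob_le_one)
  refine exists_tendsto_of_eventually_le (z := fun N => a N / (N : ℝ) ^ 2)
    (err := fun N => Real.log (⌊(N : ℝ) * x⌋₊ + 1) / N + c * (1 / N))
    (fun N => div_nonneg (ha0 N) (by positivity)) ?_ ?_
  · have := (tendsto_log_floor_add_one_div hx).add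
      ((tendsto_one_div_atTop_nhds_zero_nat (𝕜 := ℝ)).const_mul c)
    simpa using this
  intro n hn δ hδ
  have hn0 : (0 : ℝ) < n := by exact_mod_cast hn
  set e : ℝ := n * Real.log (⌊(n : ℝ) * x⌋₊ + 1) with he
  have he0 : 0 ≤ e := by
    have : (0 : ℝ) ≤ (⌊(n : ℝ) * x⌋₊ : ℝ) := Nat.cast_nonneg _
    exact mul_nonneg hn0.le (Real.log_nonneg (by linarith))
  set m₀ : ℝ := (⌊γ * n⌋₊ : ℝ) with hm₀
  have hlim : Tendsto (fun m : ℕ => (a n + e) / (n : ℝ) ^ 2 +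
      c * (γ - (1 / n - 1 / m) ^ 2 * (m₀ * n))) atTop
      (nhds ((a n + e) / (n : ℝ) ^ 2 + c * (γ - (1 / n - 0) ^ 2 * (m₀ * n)))) :=
    tendsto_const_nhds.add (((((tendsto_const_nhds.sub
      (tendsto_one_div_atTop_nhds_zero_nat (𝕜 := ℝ))).pow 2).mul_const _).const_sub _).const_mul _)
  have hlt : (a n + e) / (n : ℝ) ^ 2 + c * (γ - (1 / n - 0) ^ 2 * (m₀ * n)) <
      a n / (n : ℝ) ^ 2 + (Real.log (⌊(n : ℝ) * x⌋₊ + 1) / n + c * (1 / n)) + δ := by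
    have h1 : (a n + e) / (n : ℝ) ^ 2 = a n / (n : ℝ) ^ 2 + Real.log (⌊(n : ℝ) * x⌋₊ + 1) / n := by
      rw [he]; field_simp
    have h2 : γ - (1 / n - 0) ^ 2 * (m₀ * n) ≤ 1 / n := by
      have : γ * n < m₀ + 1 := Nat.lt_floor_add_one _
      have e2 : γ - (1 / n - 0) ^ 2 * (m₀ * n) = (γ * n - m₀) / n := by field_simp; ring
      rw [e2]
      gcongr
      linarith
    have h3 := mul_le_mul_of_nonneg_left h2 hc0
    linarith
  filter_upwards [hlim.eventually_lt_const hlt, eventually_ge_atTop n] with m hm hmn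
  refine le_trans ?_ hm.le
  have hm0 : (0 : ℝ) < m := by exact_mod_cast (by omega : 0 < m)
  set k := m / n with hk
  have hk0 : 0 < k := Nat.div_pos hmn (by omega)
  have hkn : k * n ≤ m := Nat.div_mul_le_self m n
  have hkn' : (k : ℝ) * n ≤ m := by exact_mod_cast hkn
  have hmk : (m : ℝ) ≤ k * n + n := by
    have := Nat.lt_div_mul_add (a := m) (b := n) (by omega)
    exact_mod_cast this.le
  have hfloor : ∀ y : ℝ, 0 ≤ y → k * ⌊(n : ℝ) * y⌋₊ ≤ ⌊(m : ℝ) * y⌋₊ := by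
    intro y hy
    refine Nat.le_floor ?_
    push_cast
    have h1 := Nat.floor_le (show 0 ≤ (n : ℝ) * y by positivity)
    calc (k : ℝ) * ⌊(n : ℝ) * y⌋₊ ≤ k * (n * y) := by gcongr
      _ = k * n * y := by ring
      _ ≤ m * y := by gcongr
  have hM : k * ⌊γ * n⌋₊ ≤ ⌊γ * m⌋₊ := by
    rw [mul_comm γ, mul_comm γ]; exact hfloor γ (by linarith)
  have key := h.log_measure_lpp_le_scale hq0 hq1 hpar hk0 (hNM n) (hNM m) hM hkn (hfloor x hx.le)
  have key' : a m ≤ (k : ℝ) ^ 2 * (a n + e) + ((⌊γ * m⌋₊ : ℝ) * m - k ^ 2 * (m₀ * n)) * c := by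
    simp only [ha, he, hc, hm₀]
    linarith
  have hk1 : (k : ℝ) ^ 2 * (a n + e) ≤ (m / n) ^ 2 * (a n + e) := by
    have := ha0 n
    gcongr
    rwa [le_div_iff₀ hn0]
  have hk2 : (⌊γ * m⌋₊ : ℝ) * m - k ^ 2 * (m₀ * n) ≤
      γ * m * m - ((m : ℝ) / n - 1) ^ 2 * (m₀ * n) := by
    have h1 : (⌊γ * m⌋₊ : ℝ) ≤ γ * m := Nat.floor_le (by positivity)
    have h2 : (m : ℝ) / n - 1 ≤ k := by
      rw [sub_le_iff_le_add, div_le_iff₀ hn0]; linarith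
    have h3 : 0 ≤ (m : ℝ) / n - 1 := by
      rw [sub_nonneg, le_div_iff₀ hn0, one_mul]; exact_mod_cast hmn
    gcongr
  rw [div_le_iff₀ (by positivity)]
  have hk3 := mul_le_mul_of_nonneg_right hk2 hc0
  have e1 : ((a n + e) / (n : ℝ) ^ 2 + c * (γ - (1 / n - 1 / m) ^ 2 * (m₀ * n))) * (m : ℝ) ^ 2 =
      (m / n) ^ 2 * (a n + e) + (γ * m * m - ((m : ℝ) / n - 1) ^ 2 * (m₀ * n)) * c := by
    field_simp
  rw [e1]
  linarith

end IsGeomFamily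

end LimitExistence

section Burke

open scoped ENNReal

/-- Last passage times with boundary weights at `(i, 0)` and `(0, j)`. -/
def bdryLpp (W : ℕ × ℕ → ℕ) : ℕ → ℕ → ℕ
  | 0, 0 => 0
  | i + 1, 0 => bdryLpp W i 0 + W (i + 1, 0)
  | 0, j + 1 => bdryLpp W 0 j + W (0, j + 1)
  | i + 1, j + 1 => max (bdryLpp W i (j + 1)) (bdryLpp W (i + 1) j) + W (i + 1, j + 1)

lemma bdryLpp_zero_right (W : ℕ × ℕ → ℕ) (m : ℕ) :
    bdryLpp W m 0 = ∑ i ∈ Finset.range m, W (i + 1, 0) := by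
  induction m with
  | zero => rw [bdryLpp]; rfl
  | succ m ih => rw [bdryLpp, ih, Finset.sum_range_succ]

lemma bdryLpp_zero_left (W : ℕ × ℕ → ℕ) (n : ℕ) :
    bdryLpp W 0 n = ∑ j ∈ Finset.range n, W (0, j + 1) := by
  induction n with
  | zero => rw [bdryLpp]; rfl
  | succ n ih => rw [bdryLpp, ih, Finset.sum_range_succ]

lemma bdryLpp_le_succ_left (W : ℕ × ℕ → ℕ) (i j : ℕ) : bdryLpp W i j ≤ bdryLpp W (i + 1) j := by
  cases j with
  | zero => rw [bdryLpp.eq_2]; exact Nat.le_add_right _ _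
  | succ j => rw [bdryLpp.eq_4]; exact (le_max_left _ _).trans (Nat.le_add_right _ _)

lemma bdryLpp_le_succ_right (W : ℕ × ℕ → ℕ) (i j : ℕ) : bdryLpp W i j ≤ bdryLpp W i (j + 1) := by
  cases i with
  | zero => rw [bdryLpp.eq_3]; exact Nat.le_add_right _ _
  | succ i => rw [bdryLpp.eq_4]; exact (le_max_right _ _).trans (Nat.le_add_right _ _)

/-- Lowering the boundary weights: the optimal path leaves the axes either late, in which case the
last passage time drops accordingly, or early, in which case it is close to `lpp`. -/
lemma bdryLpp_coupling {W W' W'' : ℕ × ℕ → ℕ}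
    (hbulk' : ∀ i j, W' (i + 1, j + 1) = W (i + 1, j + 1))
    (hbulk'' : ∀ i j, W'' (i + 1, j + 1) = W (i + 1, j + 1))
    (hI : ∀ i, W (i + 1, 0) ≤ W' (i + 1, 0)) (hJ : ∀ j, W (0, j + 1) ≤ W'' (0, j + 1))
    (m₀ n₀ i j : ℕ) :
    bdryLpp W i j + bdryLpp W' m₀ 0 ≤ bdryLpp W' i j + bdryLpp W m₀ 0 ∨
    bdryLpp W i j + bdryLpp W'' 0 n₀ ≤ bdryLpp W'' i j + bdryLpp W 0 n₀ ∨
    bdryLpp W i j ≤ bdryLpp W m₀ 0 + bdryLpp W 0 n₀ + lpp W i j := by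
  induction i generalizing j with
  | zero =>
    rcases le_total j n₀ with h | h
    · have : bdryLpp W 0 j ≤ bdryLpp W 0 n₀ :=
        monotone_nat_of_le_succ (bdryLpp_le_succ_right W 0) h
      omega
    · refine Or.inr (Or.inl ?_)
      obtain ⟨k, rfl⟩ := Nat.exists_eq_add_of_le h
      simp only [bdryLpp_zero_left, Finset.sum_range_add]
      have := Finset.sum_le_sum fun x (_ : x ∈ Finset.range k) => hJ (n₀ + x)
      omega
  | succ i ihi =>
    induction j with
    | zero =>
      rcases le_total (i + 1) m₀ with h | h
      · have : bdryLpp W (i + 1) 0 ≤ bdryLpp W m₀ 0 :=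
          monotone_nat_of_le_succ (f := fun i => bdryLpp W i 0)
            (fun i => bdryLpp_le_succ_left W i 0) h
        omega
      · refine Or.inl ?_
        obtain ⟨k, hk⟩ := Nat.exists_eq_add_of_le h
        simp only [hk, bdryLpp_zero_right, Finset.sum_range_add]
        have := Finset.sum_le_sum fun x (_ : x ∈ Finset.range k) => hI (m₀ + x)
        omega
    | succ j ihj =>
      have hi := ihi (j + 1)
      simp only [bdryLpp.eq_4, lpp_succ, hbulk', hbulk'']
      omega

/-- The vertical increments in column `i`. -/
def colIncr (W : ℕ × ℕ → ℕ) (N i : ℕ) : List ℕ :=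
  (List.range N).map fun j => bdryLpp W i (j + 1) - bdryLpp W i j

/-- The update of the vertical increments from one column to the next. -/
def colUpd : ℕ → List ℕ → List ℕ → List ℕ
  | I, J :: Js, w :: ws => (w + (J - I)) :: colUpd (w + (I - J)) Js ws
  | _, _, _ => []

lemma colUpd_map_bdryLpp (W : ℕ × ℕ → ℕ) (i N s : ℕ) :
    colUpd (bdryLpp W (i + 1) s - bdryLpp W i s)
      ((List.range' s N).map fun j => bdryLpp W i (j + 1) - bdryLpp W i j)
      ((List.range' s N).map fun j => W (i + 1, j + 1)) =
      (List.range' s N).map fun j => bdryLpp W (i + 1) (j + 1) - bdryLpp W (i + 1) j := by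
  induction N generalizing s with
  | zero => rfl
  | succ N ih =>
    simp only [List.range'_succ, List.map_cons, colUpd]
    have h1 := bdryLpp_le_succ_left W i s
    have h2 := bdryLpp_le_succ_right W i s
    have h3 : bdryLpp W (i + 1) (s + 1) =
      max (bdryLpp W i (s + 1)) (bdryLpp W (i + 1) s) + W (i + 1, s + 1) := by rw [bdryLpp]
    have hJ : W (i + 1, s + 1) + ((bdryLpp W i (s + 1) - bdryLpp W i s) -
      (bdryLpp W (i + 1) s - bdryLpp W i s)) =
        bdryLpp W (i + 1) (s + 1) - bdryLpp W (i + 1) s := by omega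
    have hI : W (i + 1, s + 1) + ((bdryLpp W (i + 1) s - bdryLpp W i s) -
      (bdryLpp W i (s + 1) - bdryLpp W i s)) =
        bdryLpp W (i + 1) (s + 1) - bdryLpp W i (s + 1) := by omega
    rw [hJ, hI, ih (s + 1)]

lemma colIncr_succ (W : ℕ × ℕ → ℕ) (N i : ℕ) :
    colIncr W N (i + 1) = colUpd (W (i + 1, 0)) (colIncr W N i)
      (((List.range N).map fun j => (i + 1, j + 1)).map W) := by
  have := colUpd_map_bdryLpp W i N 0
  have h2 := bdryLpp.eq_2 W i
  rw [h2, Nat.add_sub_cancel_left, ← List.range_eq_range'] at this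
  simp [colIncr, ← this, Function.comp_def]

lemma bdryLpp_eq_add_sum_colIncr (W : ℕ × ℕ → ℕ) (m n : ℕ) :
    bdryLpp W m n = bdryLpp W m 0 + (colIncr W n m).sum := by
  induction n with
  | zero => simp [colIncr]
  | succ n ih =>
    have h2 := bdryLpp_le_succ_right W m n
    simp only [colIncr, List.range_succ, List.map_append, List.sum_append] at ih ⊢
    simp only [List.map_cons, List.map_nil, List.sum_cons, List.sum_nil]
    omega

lemma bdryLpp_congr {W W' : ℕ × ℕ → ℕ} {m n : ℕ} (h : ∀ i ≤ m, ∀ j ≤ n, W (i, j) = W' (i, j)) :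
    ∀ i ≤ m, ∀ j ≤ n, bdryLpp W i j = bdryLpp W' i j := by
  intro i
  induction i with
  | zero =>
    intro _ j hj
    rw [bdryLpp_zero_left, bdryLpp_zero_left]
    refine Finset.sum_congr rfl fun x hx => h _ (Nat.zero_le _) _ ?_
    have := Finset.mem_range.1 hx
    omega
  | succ i ihi =>
    intro hi j
    induction j with
    | zero =>
      intro _
      rw [bdryLpp.eq_2, bdryLpp.eq_2, ihi (by omega) 0 (by omega), h _ hi _ (by omega)]
    | succ j ihj =>
      intro hj
      rw [bdryLpp.eq_4, bdryLpp.eq_4, ihi (by omega) _ hj, ihj (by omega), h _ hi _ hj]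

lemma dependsOn_colIncr (N m : ℕ) : DependsOn (fun W : ℕ × ℕ → ℕ => colIncr W N m)
    ((Finset.Iic m ×ˢ Finset.Iic N : Finset (ℕ × ℕ)) : Set (ℕ × ℕ)) := by
  intro W W' h
  refine List.map_congr_left fun j hj => ?_
  rw [List.mem_range] at hj
  have : ∀ j' ≤ N, bdryLpp W m j' = bdryLpp W' m j' := fun j' hj' =>
    bdryLpp_congr (m := m) (n := N) (fun i hi j hj => h _ (by simp [hi, hj])) m le_rfl j' hj'
  rw [this _ hj, this _ hj.le]

lemma geomE_comm (u v : ℝ) (F : ℕ → ℕ → ℝ≥0∞) :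
    geomE u (fun i => geomE v fun j => F i j) = geomE v fun j => geomE u fun i => F i j := by
  simp only [geomE, ← ENNReal.tsum_mul_left]
  rw [ENNReal.tsum_comm]
  exact tsum_congr fun j => tsum_congr fun i => by ring

lemma geomE_geomListE_comm (u : ℝ) (vs : List ℝ) (F : ℕ → List ℕ → ℝ≥0∞) :
    geomE u (fun i => geomListE vs fun l => F i l) =
      geomListE vs fun l => geomE u fun i => F i l := by
  induction vs generalizing F with
  | nil => rfl
  | cons v vs ih =>
    simp only [geomListE]
    rw [geomE_comm]
    simp only [ih]

/-- The involution behind the Burke property. -/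
def burkeMap (p : ℕ × ℕ × ℕ) : ℕ × ℕ × ℕ :=
  (p.2.2 + (p.1 - p.2.1), p.2.2 + (p.2.1 - p.1), min p.1 p.2.1)

lemma burkeMap_involutive : Function.Involutive burkeMap := by
  rintro ⟨i, j, w⟩
  simp only [burkeMap, Prod.mk.injEq]
  omega

/-- The local Burke property: the outgoing increments have the law of the incoming ones. -/
lemma geomE_burke {u v q : ℝ} (hu0 : 0 ≤ u) (hu1 : u ≤ 1) (hv0 : 0 ≤ v) (hv1 : v ≤ 1)
    (huv : u * v = q) (hq1 : q < 1) (F : ℕ → ℕ → ℝ≥0∞) :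
    geomE u (fun i => geomE v fun j => geomE q fun w => F (w + (i - j)) (w + (j - i))) =
      geomE u fun i => geomE v fun j => F i j := by
  have hq0 : 0 ≤ q := huv ▸ mul_nonneg hu0 hv0
  have h1 : ∀ G : ℕ × ℕ × ℕ → ℝ≥0∞, geomE u (fun i => geomE v fun j => geomE q fun w => G (i, j, w))
      = ∑' p : ℕ × ℕ × ℕ, ENNReal.ofReal ((1 - u) * (1 - v) * (1 - q) *
        (u ^ p.1 * v ^ p.2.1 * q ^ p.2.2)) * G p := by
    intro G
    rw [ENNReal.tsum_prod' (f := fun p : ℕ × ℕ × ℕ => ENNReal.ofReal ((1 - u) * (1 - v) * (1 - q) *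
        (u ^ p.1 * v ^ p.2.1 * q ^ p.2.2)) * G p)]
    simp only [ENNReal.tsum_prod', geomE, ← ENNReal.tsum_mul_left]
    refine tsum_congr fun i => tsum_congr fun j => tsum_congr fun w => ?_
    have h1 : 0 ≤ 1 - u := by linarith
    have h2 : 0 ≤ 1 - v := by linarith
    have h3 : 0 ≤ 1 - q := by linarith
    rw [← mul_assoc, ← mul_assoc, ← ENNReal.ofReal_mul (by positivity),
      ← ENNReal.ofReal_mul (by positivity)]
    congr 2
    ring
  have h2 : (geomE u fun i => geomE v fun j => F i j) =
      geomE u fun i => geomE v fun j => geomE q fun _ => F i j := by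
    have : ∀ c : ℝ≥0∞, geomE q (fun _ => c) = c := fun c => by
      have h := geomE_one hq0 hq1
      simp only [geomE, mul_one] at h ⊢
      rw [ENNReal.tsum_mul_right, h, one_mul]
    simp only [this]
  rw [h2, h1 fun p => F (p.2.2 + (p.1 - p.2.1)) (p.2.2 + (p.2.1 - p.1)), h1 fun p => F p.1 p.2.1,
    ← burkeMap_involutive.toPerm.tsum_eq]
  refine tsum_congr fun p => ?_
  obtain ⟨i, j, w⟩ := p
  have e := burkeMap_involutive (i, j, w)
  simp only [burkeMap, Prod.mk.injEq] at e
  simp only [Function.Involutive.coe_toPerm, burkeMap]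
  rw [e.1, e.2.1, ← huv]
  congr 3
  simp only [mul_pow]
  rcases le_total i j with h | h
  · obtain ⟨k, rfl⟩ := Nat.exists_eq_add_of_le h
    simp
    ring
  · obtain ⟨k, rfl⟩ := Nat.exists_eq_add_of_le h
    simp
    ring

/-- The Burke property for a column. -/
lemma geomListE_colUpd {u v q : ℝ} (hu0 : 0 ≤ u) (hu1 : u < 1) (hv0 : 0 ≤ v) (hv1 : v ≤ 1)
    (huv : u * v = q) (hq1 : q < 1) (N : ℕ) (f : List ℕ → ℝ≥0∞) :
    geomE u (fun I => geomListE (List.replicate N v) fun Js =>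
      geomListE (List.replicate N q) fun ws => f (colUpd I Js ws)) =
      geomListE (List.replicate N v) f := by
  induction N generalizing f with
  | zero =>
    simp only [List.replicate_zero, geomListE, colUpd]
    have h := geomE_one hu0 hu1
    simp only [geomE, mul_one] at h ⊢
    rw [ENNReal.tsum_mul_right, h, one_mul]
  | succ N ih =>
    simp only [List.replicate_succ, geomListE, colUpd]
    simp only [← geomE_geomListE_comm]
    rw [geomE_burke hu0 hu1.le hv0 hv1 huv hq1 fun I' J' => geomListE (List.replicate N v) fun Js =>
      geomListE (List.replicate N q) fun ws => f (J' :: colUpd I' Js ws), geomE_comm]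
    exact congrArg (geomE v) (funext fun J' => ih fun l => f (J' :: l))

variable {Ω : Type*} [MeasurableSpace Ω] {μ : Measure Ω} [IsProbabilityMeasure μ]
  {w : ℕ × ℕ → Ω → ℕ} {par : ℕ × ℕ → ℝ} {u v q : ℝ}

/-- The vertical increments in any column are independent geometric variables. -/
theorem IsGeomFamily.lintegral_colIncr (h : IsGeomFamily μ w par)
    (hu0 : 0 ≤ u) (hu1 : u < 1) (hv0 : 0 ≤ v) (hv1 : v ≤ 1)
    (huv : u * v = q) (hq1 : q < 1) (hparu : ∀ i, par (i + 1, 0) = u)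
    (hparv : ∀ j, par (0, j + 1) = v) (hparq : ∀ i j, par (i + 1, j + 1) = q)
    (N m : ℕ) (f : List ℕ → ℝ≥0∞) :
    ∫⁻ ω, f (colIncr (fun p => w p ω) N m) ∂μ = geomListE (List.replicate N v) f := by
  have hrep : ∀ {x : ℝ} (i : ℕ), (∀ j, par (i, j + 1) = x) →
      ((List.range N).map fun j => (i, j + 1)).map par = List.replicate N x := by
    intro x i hx
    refine List.eq_replicate_iff.2 ⟨by simp, fun b hb => ?_⟩
    simp only [List.map_map, List.mem_map, Function.comp_apply, hx] at hb
    exact hb.choose_spec.2.symm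
  have hnodup : ∀ i : ℕ, ((List.range N).map fun j => (i, j + 1)).Nodup := fun i =>
    List.nodup_range.map fun j j' hj => by simpa using hj
  induction m generalizing f with
  | zero =>
    have key := h.lintegral_list _ (hnodup 0) (X := fun _ => ()) (S := ∅) (fun _ _ _ => rfl)
      (by simp) fun _ l => f l
    simp only [hrep 0 hparv, lintegral_const, measure_univ, mul_one] at key
    rw [← key]
    refine lintegral_congr fun ω => ?_
    congr 1
    simp only [colIncr, List.map_map, Function.comp_def]
    refine List.map_congr_left fun j _ => ?_
    rw [bdryLpp.eq_3, Nat.add_sub_cancel_left]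
  | succ m ih =>
    simp only [colIncr_succ]
    have key := h.lintegral_list ((m + 1, 0) :: (List.range N).map fun j => (m + 1, j + 1))
      (List.nodup_cons.2 ⟨by simp, hnodup (m + 1)⟩) (dependsOn_colIncr N m) (fun p hp => by
        have : p.1 = m + 1 := by
          rcases List.mem_cons.1 hp with rfl | hp
          · rfl
          · obtain ⟨j, -, rfl⟩ := List.mem_map.1 hp; rfl
        simp [Finset.mem_product, this]) fun Js l => f (colUpd (l.headD 0) Js l.tail)
    simp only [List.map_cons, List.headD_cons, List.tail_cons, hrep (m + 1) (hparq m), hparu,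
      geomListE] at key
    rw [key, ih fun Js => geomE u fun I => geomListE (List.replicate N q) fun ws =>
      f (colUpd I Js ws), ← geomE_geomListE_comm, geomListE_colUpd hu0 hu1 hv0 hv1 huv hq1]

end Burke

section LawOfLargeNumbers

open ProbabilityTheory Topology
open scoped ENNReal

lemma geomE_natCast {u : ℝ} (h0 : 0 ≤ u) (h1 : u < 1) :
    geomE u (fun k => (k : ℝ≥0∞)) = ENNReal.ofReal (u / (1 - u)) := by
  have h2 : 0 < 1 - u := by linarith
  have hs : HasSum (fun k : ℕ => (1 - u) * u ^ k * (k : ℝ)) (u / (1 - u)) := by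
    have := (hasSum_coe_mul_geometric_of_norm_lt_one (r := u)
      (by rwa [Real.norm_of_nonneg h0])).mul_left (1 - u)
    rw [show (1 - u) * (u / (1 - u) ^ 2) = u / (1 - u) by field_simp] at this
    refine Eq.mp (congrArg (HasSum · _) (funext fun k => ?_)) this
    ring
  rw [← hs.tsum_eq, ENNReal.ofReal_tsum_of_nonneg (fun k => by positivity) hs.summable]
  refine tsum_congr fun k => ?_
  simp only [ENNReal.ofReal_mul (show 0 ≤ (1 - u) * u ^ k by positivity), ENNReal.ofReal_natCast]

lemma MeasureTheory.TendstoInMeasure.add_const {Ω : Type*} [MeasurableSpace Ω] {μ : Measure Ω}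
    {f g : ℕ → Ω → ℝ} {a b : ℝ} (hf : TendstoInMeasure μ f atTop fun _ => a)
    (hg : TendstoInMeasure μ g atTop fun _ => b) :
    TendstoInMeasure μ (fun N ω => f N ω + g N ω) atTop fun _ => a + b := by
  intro δ hδ
  have hδ2 : 0 < δ / 2 := ENNReal.half_pos hδ.ne'
  have := (hf _ hδ2).add (hg _ hδ2)
  rw [add_zero] at this
  refine tendsto_of_tendsto_of_tendsto_of_le_of_le tendsto_const_nhds this
    (fun _ => zero_le) fun N => (measure_mono fun ω hω => ?_).trans (measure_union_le _ _)
  by_contra hc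
  simp only [Set.mem_union, Set.mem_ofPred_eq, not_or, not_le] at hc hω
  have := (hω.trans (edist_add_add_le _ _ _ _)).trans_lt (ENNReal.add_lt_add hc.1 hc.2)
  rw [ENNReal.add_halves] at this
  exact this.false

namespace IsGeomFamily

variable {Ω ι : Type*} [MeasurableSpace Ω] {μ : Measure Ω} {w : ι → Ω → ℕ} {par : ι → ℝ} {u : ℝ}

lemma measurable_natCast (h : IsGeomFamily μ w par) (p : ι) :
    Measurable fun ω => (w p ω : ℝ) :=
  (Measurable.of_discrete (f := fun n : ℕ => (n : ℝ))).comp (h.measurable p)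

lemma identDistrib (h : IsGeomFamily μ w par) {p p' : ι} (hp : par p = par p') :
    IdentDistrib (fun ω => (w p ω : ℝ)) (fun ω => (w p' ω : ℝ)) μ μ := by
  refine IdentDistrib.comp (u := fun n : ℕ => (n : ℝ)) ⟨(h.measurable p).aemeasurable,
    (h.measurable p').aemeasurable, ?_⟩ Measurable.of_discrete
  refine Measure.ext_of_singleton fun k => ?_
  rw [Measure.map_apply (h.measurable p) (measurableSet_singleton k),
    Measure.map_apply (h.measurable p') (measurableSet_singleton k)]
  exact ((h.law p k).trans (by rw [hp])).trans (h.law p' k).symm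

variable [IsProbabilityMeasure μ]

lemma lintegral_natCast (h : IsGeomFamily μ w par) {p : ι} (h0 : 0 ≤ par p) (h1 : par p < 1) :
    ∫⁻ ω, (w p ω : ℝ≥0∞) ∂μ = ENNReal.ofReal (par p / (1 - par p)) := by
  have := h.lintegral_single (X := fun _ => ()) (S := ∅) (fun _ _ _ => rfl)
    (Finset.notMem_empty p) fun _ k => (k : ℝ≥0∞)
  simpa [geomE_natCast h0 h1] using this

lemma integrable_natCast (h : IsGeomFamily μ w par) {p : ι} (h0 : 0 ≤ par p) (h1 : par p < 1) :
    Integrable (fun ω => (w p ω : ℝ)) μ := by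
  refine ⟨(h.measurable_natCast p).aestronglyMeasurable, ?_⟩
  rw [hasFiniteIntegral_iff_ofReal (Eventually.of_forall fun ω => Nat.cast_nonneg _)]
  simp only [ENNReal.ofReal_natCast]
  rw [h.lintegral_natCast h0 h1]
  exact ENNReal.ofReal_lt_top

lemma integral_natCast (h : IsGeomFamily μ w par) {p : ι} (h0 : 0 ≤ par p) (h1 : par p < 1) :
    ∫ ω, (w p ω : ℝ) ∂μ = par p / (1 - par p) := by
  rw [integral_eq_lintegral_of_nonneg_ae (Eventually.of_forall fun ω => Nat.cast_nonneg _)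
    (h.measurable_natCast p).aestronglyMeasurable]
  simp only [ENNReal.ofReal_natCast]
  rw [h.lintegral_natCast h0 h1, ENNReal.toReal_ofReal]
  have : 0 < 1 - par p := by linarith
  positivity

/-- The law of large numbers for `⌊κN⌋` of the variables. -/
lemma tendstoInMeasure_sum (h : IsGeomFamily μ w par) {p : ℕ → ι} (hp : p.Injective)
    (hpar : ∀ i, par (p i) = u) (h0 : 0 ≤ u) (h1 : u < 1) {κ : ℝ} (hκ : 0 < κ) :
    TendstoInMeasure μ
      (fun (N : ℕ) ω => ((∑ i ∈ Finset.range ⌊κ * N⌋₊, w (p i) ω : ℕ) : ℝ) / N) atTop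
      (fun _ => κ * (u / (1 - u))) := by
  have hlln := strong_law_ae_real (fun i ω => (w (p i) ω : ℝ))
    (h.integrable_natCast (by rwa [hpar]) (by rwa [hpar]))
    (fun i j hij => ((h.indep.indepFun (hp.ne hij)).comp (φ := fun n : ℕ => (n : ℝ))
      (ψ := fun n : ℕ => (n : ℝ)) Measurable.of_discrete Measurable.of_discrete))
    fun i => h.identDistrib ((hpar i).trans (hpar 0).symm)
  rw [h.integral_natCast (by rwa [hpar]) (by rwa [hpar]), hpar] at hlln
  refine tendstoInMeasure_of_tendsto_ae (fun N => ?_) ?_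
  · refine (Measurable.div_const ?_ _).aestronglyMeasurable
    simp only [Nat.cast_sum]
    exact Finset.measurable_sum _ fun i _ => h.measurable_natCast _
  · filter_upwards [hlln] with ω hω
    have hfl : Tendsto (fun N : ℕ => ((⌊κ * N⌋₊ : ℕ) : ℝ) / N) atTop (𝓝 κ) :=
      (tendsto_nat_floor_mul_div_atTop hκ.le).comp tendsto_natCast_atTop_atTop
    have hfl' : Tendsto (fun N : ℕ => ⌊κ * N⌋₊) atTop atTop :=
      tendsto_nat_floor_atTop.comp (tendsto_natCast_atTop_atTop.const_mul_atTop hκ)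
    refine (hfl.mul (hω.comp hfl')).congr fun N => ?_
    simp only [Function.comp_apply, Nat.cast_sum]
    rcases eq_or_ne (⌊κ * N⌋₊) 0 with h | h
    · simp [h]
    · have : ((⌊κ * N⌋₊ : ℕ) : ℝ) ≠ 0 := Nat.cast_ne_zero.2 h
      field_simp

end IsGeomFamily

variable {Ω : Type*} [MeasurableSpace Ω] {μ : Measure Ω} [IsProbabilityMeasure μ]
  {w : ℕ × ℕ → Ω → ℕ} {par : ℕ × ℕ → ℝ} {u v q : ℝ}

/-- The law of large numbers for last passage times with stationary boundary weights. -/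
lemma IsGeomFamily.tendstoInMeasure_bdryLpp (h : IsGeomFamily μ w par)
    (hu0 : 0 ≤ u) (hu1 : u < 1) (hv0 : 0 ≤ v) (hv1 : v < 1)
    (huv : u * v = q) (hq1 : q < 1) (hparu : ∀ i, par (i + 1, 0) = u)
    (hparv : ∀ j, par (0, j + 1) = v) (hparq : ∀ i j, par (i + 1, j + 1) = q)
    {γ : ℝ} (hγ : 0 < γ) :
    TendstoInMeasure μ (fun (N : ℕ) ω => (bdryLpp (fun p => w p ω) ⌊γ * N⌋₊ N : ℝ) / N) atTop
      (fun _ => γ * (u / (1 - u)) + v / (1 - v)) := by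
  have hB := h.tendstoInMeasure_sum (p := fun i => (i + 1, 0)) (fun i j hij => by simpa using hij)
    hparu hu0 hu1 hγ
  have hC := h.tendstoInMeasure_sum (p := fun j => (0, j + 1)) (fun i j hij => by simpa using hij)
    hparv hv0 hv1 one_pos
  simp only [one_mul, Nat.floor_natCast] at hC
  have hC' : TendstoInMeasure μ (fun (N : ℕ) ω =>
      ((colIncr (fun p => w p ω) N ⌊γ * N⌋₊).sum : ℝ) / N) atTop (fun _ => v / (1 - v)) := by
    intro δ hδ
    refine (hC δ hδ).congr fun N => ?_
    set f : List ℕ → ℝ≥0∞ := Set.indicator {l | δ ≤ edist ((l.sum : ℝ) / N) (v / (1 - v))} 1 with hf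
    have hm : ∀ m, ∫⁻ ω, f (colIncr (fun p => w p ω) N m) ∂μ =
        μ {ω | δ ≤ edist (((colIncr (fun p => w p ω) N m).sum : ℝ) / N) (v / (1 - v))} := by
      intro m
      rw [← lintegral_indicator_one]
      · rfl
      · exact measurable_of_dependsOn h.measurable (dependsOn_colIncr N m)
          (fun l => δ ≤ edist ((l.sum : ℝ) / N) (v / (1 - v))) |>.setOf
    have e : ∀ ω, (colIncr (fun p => w p ω) N 0).sum = ∑ j ∈ Finset.range N, w (0, j + 1) ω := by
      intro ω
      have := bdryLpp_eq_add_sum_colIncr (fun p => w p ω) 0 N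
      rw [bdryLpp_zero_left, bdryLpp_zero_left] at this
      simpa using this.symm
    have e2 := (h.lintegral_colIncr hu0 hu1 hv0 hv1.le huv hq1 hparu hparv hparq N 0 f).trans
      (h.lintegral_colIncr hu0 hu1 hv0 hv1.le huv hq1 hparu hparv hparq N ⌊γ * N⌋₊ f).symm
    rw [hm, hm] at e2
    simpa only [e] using e2
  refine (hB.add_const hC').congr_left fun N => Eventually.of_forall fun ω => ?_
  beta_reduce
  rw [bdryLpp_eq_add_sum_colIncr, bdryLpp_zero_right, ← add_div, ← Nat.cast_add]

end LawOfLargeNumbers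

section Coupling

open ProbabilityTheory Topology
open scoped ENNReal

/-- The quantile coupling of all geometric distributions on `(0, 1]`. -/
noncomputable def geomQuantile (u x : ℝ) : ℕ := ⌊Real.log x / Real.log u⌋₊

lemma geomQuantile_mono {u u' : ℝ} (h0 : 0 < u) (huu' : u ≤ u') (h1 : u' < 1) (x : ℝ) :
    geomQuantile u x ≤ geomQuantile u' x := by
  have hu' : Real.log u' < 0 := Real.log_neg (h0.trans_le huu') h1
  have hu : Real.log u ≤ Real.log u' := Real.log_le_log h0 huu'
  rcases le_total (Real.log x) 0 with hx | hx
  · refine Nat.floor_mono ?_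
    rw [← neg_div_neg_eq, ← neg_div_neg_eq (Real.log x)]
    gcongr <;> linarith
  · have : geomQuantile u x = 0 :=
      Nat.floor_of_nonpos (div_nonpos_of_nonneg_of_nonpos hx (hu.trans hu'.le))
    omega

lemma measurable_geomQuantile (u : ℝ) : Measurable (geomQuantile u) :=
  (Real.measurable_log.div_const _).nat_floor

lemma geomQuantile_eq_iff {u x : ℝ} (h0 : 0 < u) (h1 : u < 1) (hx0 : 0 < x) (hx1 : x ≤ 1) (k : ℕ) :
    geomQuantile u x = k ↔ u ^ (k + 1) < x ∧ x ≤ u ^ k := by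
  have hu : Real.log u < 0 := Real.log_neg h0 h1
  have hx : Real.log x ≤ 0 := Real.log_nonpos hx0.le hx1
  rw [geomQuantile, Nat.floor_eq_iff (div_nonneg_of_nonpos hx hu.le), le_div_iff_of_neg hu,
    div_lt_iff_of_neg hu, ← Real.log_lt_log_iff (by positivity) hx0,
    ← Real.log_le_log_iff hx0 (by positivity), Real.log_pow, Real.log_pow, and_comm]
  push_cast
  rfl

lemma volume_geomQuantile {u : ℝ} (h0 : 0 < u) (h1 : u < 1) (k : ℕ) :
    volume.restrict (Set.Ioc (0 : ℝ) 1) {x | geomQuantile u x = k} =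
      ENNReal.ofReal ((1 - u) * u ^ k) := by
  have hm : MeasurableSet {x | geomQuantile u x = k} :=
    measurable_geomQuantile u (measurableSet_singleton k)
  have he : {x | geomQuantile u x = k} ∩ Set.Ioc (0 : ℝ) 1 = Set.Ioc (u ^ (k + 1)) (u ^ k) := by
    ext x
    simp only [Set.mem_inter_iff, Set.mem_ofPred_eq, Set.mem_Ioc]
    constructor
    · rintro ⟨h, hx0, hx1⟩
      exact (geomQuantile_eq_iff h0 h1 hx0 hx1 k).1 h
    · rintro ⟨h, h'⟩
      have hx0 : 0 < x := lt_trans (by positivity) h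
      have hx1 : x ≤ 1 := h'.trans (pow_le_one₀ h0.le h1.le)
      exact ⟨(geomQuantile_eq_iff h0 h1 hx0 hx1 k).2 ⟨h, h'⟩, hx0, hx1⟩
  rw [Measure.restrict_apply hm, he, Real.volume_Ioc]
  congr 1
  ring

instance isProbabilityMeasure_restrict_Ioc :
    IsProbabilityMeasure (volume.restrict (Set.Ioc (0 : ℝ) 1)) := ⟨by simp⟩

lemma isGeomFamily_geomQuantile {ι : Type*} {par : ι → ℝ} (h0 : ∀ p, 0 < par p)
    (h1 : ∀ p, par p < 1) :
    IsGeomFamily (Measure.infinitePi fun _ : ι => volume.restrict (Set.Ioc (0 : ℝ) 1))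
      (fun p x => geomQuantile (par p) (x p)) par where
  measurable p := (measurable_geomQuantile _).comp (measurable_pi_apply p)
  indep := iIndepFun_infinitePi (X := fun p => geomQuantile (par p)) fun p =>
    measurable_geomQuantile _
  law p k := by
    rw [← volume_geomQuantile (h0 p) (h1 p) k]
    exact (measurePreserving_eval_infinitePi
      (fun _ : ι => volume.restrict (Set.Ioc (0 : ℝ) 1)) p).measure_preimage
      (measurable_geomQuantile _ (measurableSet_singleton k)).nullMeasurableSet

/-- The parameters of the stationary boundary weights. -/
noncomputable def bdryPar (q u : ℝ) : ℕ × ℕ → ℝ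
  | (0, 0) => q
  | (_ + 1, 0) => u
  | (0, _ + 1) => q / u
  | (_ + 1, _ + 1) => q

lemma bdryPar_mem {q u : ℝ} (hq : 0 < q) (hqu : q < u) (hu : u < 1) (p : ℕ × ℕ) :
    0 < bdryPar q u p ∧ bdryPar q u p < 1 := by
  have hu0 := hq.trans hqu
  obtain ⟨_ | i, _ | j⟩ := p
  · exact ⟨hq, hqu.trans hu⟩
  · exact ⟨div_pos hq hu0, (div_lt_one hu0).2 hqu⟩
  · exact ⟨hu0, hu⟩
  · exact ⟨hq, hqu.trans hu⟩

lemma exists_gt_lt_of_hasDerivAt {f : ℝ → ℝ} {f' x y : ℝ} (hf : HasDerivAt f f' x) (hf' : f' < 0)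
    (hxy : x < y) : ∃ z, x < z ∧ z < y ∧ f z < f x := by
  have h := (hasDerivWithinAt_iff_tendsto_slope' (s := Set.Ioi x) (by simp)).1
    hf.hasDerivWithinAt
  obtain ⟨z, h1, h2⟩ := ((h.eventually_lt_const hf').and (Ioo_mem_nhdsGT hxy)).exists
  refine ⟨z, h2.1, h2.2, ?_⟩
  rw [slope_def_field, div_neg_iff] at h1
  rcases h1 with h1 | h1
  · linarith [h2.1]
  · linarith [h1.1]

lemma exists_lt_lt_of_hasDerivAt {f : ℝ → ℝ} {f' x y : ℝ} (hf : HasDerivAt f f' x) (hf' : 0 < f')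
    (hxy : y < x) : ∃ z, y < z ∧ z < x ∧ f z < f x := by
  have h := (hasDerivWithinAt_iff_tendsto_slope' (s := Set.Iio x) (by simp)).1
    hf.hasDerivWithinAt
  obtain ⟨z, h1, h2⟩ := ((h.eventually_const_lt hf').and (Ioo_mem_nhdsLT hxy)).exists
  refine ⟨z, h2.1, h2.2, ?_⟩
  rw [slope_def_field, div_pos_iff] at h1
  rcases h1 with h1 | h1
  · linarith [h2.2]
  · linarith [h1.1]

lemma hasDerivAt_div_one_sub {u : ℝ} (hu : u < 1) :
    HasDerivAt (fun u : ℝ => u / (1 - u)) (1 / (1 - u) ^ 2) u := by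
  have h : 1 - u ≠ 0 := by linarith
  refine ((hasDerivAt_id u).div ((hasDerivAt_const u 1).sub (hasDerivAt_id u)) h).congr_deriv ?_
  simp

lemma hasDerivAt_div_div_one_sub {q u : ℝ} (hq : 0 < q) (hqu : q < u) :
    HasDerivAt (fun u : ℝ => q / u / (1 - q / u)) (-(q / (u - q) ^ 2)) u := by
  have hu : 0 < u := hq.trans hqu
  have h : u - q ≠ 0 := by linarith
  have := (hasDerivAt_div_one_sub ((div_lt_one hu).2 hqu)).comp u
    ((hasDerivAt_const u q).div (hasDerivAt_id u) hu.ne')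
  refine this.congr_deriv ?_
  have h2 : 1 - q / u ≠ 0 := by
    rw [one_sub_div hu.ne']; positivity
  field_simp
  ring

/-- The mean of the stationary last passage time is minimal at a parameter where it equals the
limit shape; perturbing the parameter changes the boundary to first order only. -/
lemma exists_stationary_parameters {q γ : ℝ} (hq0 : 0 < q) (hq1 : q < 1) (hγ : 0 < γ) :
    ∃ u, q < u ∧ u < 1 ∧
      γ * (u / (1 - u)) + q / u / (1 - q / u) = (1 + √(q * γ)) ^ 2 / (1 - q) - 1 ∧
      ∀ η > 0,
        (∃ u', u < u' ∧ u' < 1 ∧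
          γ * (u' / (1 - u')) + q / u' / (1 - q / u') + η * (u / (1 - u)) <
            γ * (u / (1 - u)) + q / u / (1 - q / u) + η * (u' / (1 - u'))) ∧
        ∃ u', q < u' ∧ u' < u ∧
          γ * (u' / (1 - u')) + q / u' / (1 - q / u') + η * (q / u / (1 - q / u)) <
            γ * (u / (1 - u)) + q / u / (1 - q / u) + η * (q / u' / (1 - q / u')) := by
  obtain ⟨s, hs, rfl⟩ : ∃ s : ℝ, 0 < s ∧ q = s ^ 2 :=
    ⟨√q, Real.sqrt_pos.2 hq0, (Real.sq_sqrt hq0.le).symm⟩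
  obtain ⟨g, hg, rfl⟩ : ∃ g : ℝ, 0 < g ∧ γ = g ^ 2 :=
    ⟨√γ, Real.sqrt_pos.2 hγ, (Real.sq_sqrt hγ.le).symm⟩
  have hsq : √(s ^ 2 * g ^ 2) = s * g := by
    rw [← mul_pow, Real.sqrt_sq (by positivity)]
  have hgs : 0 < g + s := by positivity
  have h1q : 0 < 1 - s ^ 2 := by linarith
  set u := s * (1 + s * g) / (g + s) with hu
  have hB : u - s ^ 2 = s * (1 - s ^ 2) / (g + s) := by rw [hu]; field_simp; ring
  have hA : 1 - u = g * (1 - s ^ 2) / (g + s) := by rw [hu]; field_simp; ring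
  have hqu : s ^ 2 < u := by
    have : 0 < u - s ^ 2 := by rw [hB]; positivity
    linarith
  have hu1 : u < 1 := by
    have : 0 < 1 - u := by rw [hA]; positivity
    linarith
  have hu0 : 0 < u := hq0.trans hqu
  have hd : HasDerivAt (fun u : ℝ => g ^ 2 * (u / (1 - u)) + s ^ 2 / u / (1 - s ^ 2 / u)) 0 u := by
    refine (((hasDerivAt_div_one_sub hu1).const_mul (g ^ 2)).add
      (hasDerivAt_div_div_one_sub hq0 hqu)).congr_deriv ?_
    rw [hA, hB]
    field_simp
    ring
  refine ⟨u, hqu, hu1, ?_, fun η hη => ⟨?_, ?_⟩⟩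
  · have hb : s ^ 2 / u / (1 - s ^ 2 / u) = s ^ 2 / (u - s ^ 2) := by
      rw [one_sub_div hu0.ne', div_div_div_cancel_right₀ hu0.ne']
    rw [hb, hsq, hA, hB, hu]
    field_simp
    ring
  · obtain ⟨z, h1, h2, h3⟩ := exists_gt_lt_of_hasDerivAt
      (hd.sub ((hasDerivAt_div_one_sub hu1).const_mul η))
      (by have : 0 < 1 - u := by linarith
          rw [zero_sub, neg_lt_zero]; positivity) hu1
    refine ⟨z, h1, h2, ?_⟩
    simp only [Pi.sub_apply] at h3
    linarith
  · obtain ⟨z, h1, h2, h3⟩ := exists_lt_lt_of_hasDerivAt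
      (hd.sub ((hasDerivAt_div_div_one_sub hq0 hqu).const_mul η))
      (by have : 0 < u - s ^ 2 := by linarith
          rw [zero_sub, mul_neg, neg_neg]; positivity) hqu
    refine ⟨z, h1, h2, ?_⟩
    simp only [Pi.sub_apply] at h3
    linarith

end Coupling

section LowerBound

open ProbabilityTheory Topology
open scoped ENNReal

lemma tendsto_measure_union {Ω : Type*} [MeasurableSpace Ω] {μ : Measure Ω} {A B : ℕ → Set Ω}
    (hA : Tendsto (fun N => μ (A N)) atTop (𝓝 0)) (hB : Tendsto (fun N => μ (B N)) atTop (𝓝 0)) :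
    Tendsto (fun N => μ (A N ∪ B N)) atTop (𝓝 0) :=
  tendsto_of_tendsto_of_tendsto_of_le_of_le tendsto_const_nhds (by simpa using hA.add hB)
    (fun _ => zero_le) fun _ => measure_union_le _ _

/-- A quantitative form of `bdryLpp_coupling`. -/
lemma lt_lpp_of_bdryLpp_near {W W' W'' : ℕ × ℕ → ℕ}
    (hbulk' : ∀ i j, W' (i + 1, j + 1) = W (i + 1, j + 1))
    (hbulk'' : ∀ i j, W'' (i + 1, j + 1) = W (i + 1, j + 1))
    (hI : ∀ i, W (i + 1, 0) ≤ W' (i + 1, 0)) (hJ : ∀ j, W (0, j + 1) ≤ W'' (0, j + 1))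
    {m₀ n₀ M N : ℕ} (hN : 0 < N) {δ x s s' s'' b b' c c'' : ℝ}
    (hs : |(bdryLpp W M N : ℝ) / N - s| < δ) (hs' : |(bdryLpp W' M N : ℝ) / N - s'| < δ)
    (hs'' : |(bdryLpp W'' M N : ℝ) / N - s''| < δ) (hb : |(bdryLpp W m₀ 0 : ℝ) / N - b| < δ)
    (hb' : |(bdryLpp W' m₀ 0 : ℝ) / N - b'| < δ) (hc : |(bdryLpp W 0 n₀ : ℝ) / N - c| < δ)
    (hc'' : |(bdryLpp W'' 0 n₀ : ℝ) / N - c''| < δ) (h1 : 4 * δ < s + b' - (s' + b))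
    (h2 : 4 * δ < s + c'' - (s'' + c)) (h3 : 4 * δ < s - b - c - x) :
    N * x < lpp W M N := by
  have hN' : (0 : ℝ) < N := Nat.cast_pos.2 hN
  rw [abs_lt] at *
  rcases bdryLpp_coupling hbulk' hbulk'' hI hJ m₀ n₀ M N with h | h | h
  · have h : (bdryLpp W M N : ℝ) + bdryLpp W' m₀ 0 ≤ bdryLpp W' M N + bdryLpp W m₀ 0 :=
      mod_cast h
    have := div_le_div_of_nonneg_right h hN'.le
    rw [add_div, add_div] at this
    linarith
  · have h : (bdryLpp W M N : ℝ) + bdryLpp W'' 0 n₀ ≤ bdryLpp W'' M N + bdryLpp W 0 n₀ :=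
      mod_cast h
    have := div_le_div_of_nonneg_right h hN'.le
    rw [add_div, add_div] at this
    linarith
  · have h : (bdryLpp W M N : ℝ) ≤ bdryLpp W m₀ 0 + bdryLpp W 0 n₀ + lpp W M N := mod_cast h
    have := div_le_div_of_nonneg_right h hN'.le
    rw [add_div, add_div] at this
    rw [mul_comm, ← lt_div_iff₀ hN']
    linarith

lemma tendsto_measure_lpp_geomQuantile {q γ x : ℝ} (hq0 : 0 < q) (hq1 : q < 1) (hγ : 0 < γ)
    (hx : x < (1 + √(q * γ)) ^ 2 / (1 - q) - 1) :
    ∃ u, q < u ∧ u < 1 ∧ Tendsto (fun N : ℕ =>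
      Measure.infinitePi (fun _ : ℕ × ℕ => volume.restrict (Set.Ioc (0 : ℝ) 1))
        {y | (lpp (fun p => geomQuantile (bdryPar q u p) (y p)) ⌊γ * N⌋₊ N : ℝ) ≤ N * x})
      atTop (𝓝 0) := by
  obtain ⟨u, hqu, hu1, hval, hpert⟩ := exists_stationary_parameters hq0 hq1 hγ
  have hu0 : 0 < u := hq0.trans hqu
  have hpos : ∀ {z : ℝ}, q < z → z < 1 → 0 < z / (1 - z) ∧ 0 < q / z / (1 - q / z) := by
    intro z h1 h2
    have h3 := hq0.trans h1
    have : 0 < 1 - z := by linarith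
    have : 0 < 1 - q / z := by linarith [(div_lt_one h3).2 h1]
    constructor <;> positivity
  obtain ⟨ha, hb⟩ := hpos hqu hu1
  rw [← hval] at hx
  set s₀ := γ * (u / (1 - u)) + q / u / (1 - q / u)
  obtain ⟨η, hη, hηs⟩ : ∃ η > 0, x < s₀ - η * (u / (1 - u)) - η * (q / u / (1 - q / u)) := by
    refine ⟨(s₀ - x) / 2 / (u / (1 - u) + q / u / (1 - q / u)), div_pos (by linarith) (by linarith),
      ?_⟩
    have : (s₀ - x) / 2 / (u / (1 - u) + q / u / (1 - q / u)) *
        (u / (1 - u) + q / u / (1 - q / u)) = (s₀ - x) / 2 := div_mul_cancel₀ _ (by linarith)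
    linarith
  obtain ⟨⟨u', hu', hu'1, hgap'⟩, u'', hu'', hu''u, hgap''⟩ := hpert η hη
  refine ⟨u, hqu, hu1, ?_⟩
  have hqu' := hqu.trans hu'
  have hu''1 := hu''u.trans hu1
  obtain ⟨δ, hδ, h1, h2, h3⟩ : ∃ δ > 0,
      4 * δ < (s₀ + η * (u' / (1 - u'))) -
        (γ * (u' / (1 - u')) + q / u' / (1 - q / u') + η * (u / (1 - u))) ∧
      4 * δ < (s₀ + η * (q / u'' / (1 - q / u''))) -
        (γ * (u'' / (1 - u'')) + q / u'' / (1 - q / u'') + η * (q / u / (1 - q / u))) ∧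
      4 * δ < s₀ - η * (u / (1 - u)) - η * (q / u / (1 - q / u)) - x := by
    obtain ⟨δ, hδ, h⟩ := exists_between (lt_min (sub_pos.2 hgap')
      (lt_min (sub_pos.2 hgap'') (sub_pos.2 hηs)))
    rw [lt_min_iff, lt_min_iff] at h
    exact ⟨δ / 4, by positivity, by linarith [h.1], by linarith [h.2.1], by linarith [h.2.2]⟩
  have hfam : ∀ {z : ℝ}, q < z → z < 1 → IsGeomFamily
      (Measure.infinitePi fun _ : ℕ × ℕ => volume.restrict (Set.Ioc (0 : ℝ) 1))
      (fun p y => geomQuantile (bdryPar q z p) (y p)) (bdryPar q z) := fun h1 h2 =>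
    isGeomFamily_geomQuantile (fun p => (bdryPar_mem hq0 h1 h2 p).1)
      fun p => (bdryPar_mem hq0 h1 h2 p).2
  have hS : ∀ {z : ℝ}, q < z → z < 1 → Tendsto (fun N : ℕ =>
      Measure.infinitePi (fun _ : ℕ × ℕ => volume.restrict (Set.Ioc (0 : ℝ) 1))
        {y | δ ≤ |(bdryLpp (fun p => geomQuantile (bdryPar q z p) (y p)) ⌊γ * N⌋₊ N : ℝ) / N -
          (γ * (z / (1 - z)) + q / z / (1 - q / z))|}) atTop (𝓝 0) := fun {z} h1 h2 =>
    tendstoInMeasure_iff_norm.1 ((hfam h1 h2).tendstoInMeasure_bdryLpp (u := z) (v := q / z)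
      (q := q) (hq0.trans h1).le h2 (div_pos hq0 (hq0.trans h1)).le
      ((div_lt_one (hq0.trans h1)).2 h1) (mul_div_cancel₀ _ (hq0.trans h1).ne') hq1
      (fun _ => rfl) (fun _ => rfl) (fun _ _ => rfl) hγ) δ hδ
  have hB : ∀ {z : ℝ}, q < z → z < 1 → Tendsto (fun N : ℕ =>
      Measure.infinitePi (fun _ : ℕ × ℕ => volume.restrict (Set.Ioc (0 : ℝ) 1))
        {y | δ ≤ |(bdryLpp (fun p => geomQuantile (bdryPar q z p) (y p)) ⌊η * N⌋₊ 0 : ℝ) / N -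
          η * (z / (1 - z))|}) atTop (𝓝 0) := fun {z} h1 h2 => by
    simp only [bdryLpp_zero_right]
    exact tendstoInMeasure_iff_norm.1 ((hfam h1 h2).tendstoInMeasure_sum
      (p := fun i => (i + 1, 0)) (fun i j hij => by simpa using hij)
      (u := z) (fun _ => rfl) (hq0.trans h1).le h2 hη) δ hδ
  have hC : ∀ {z : ℝ}, q < z → z < 1 → Tendsto (fun N : ℕ =>
      Measure.infinitePi (fun _ : ℕ × ℕ => volume.restrict (Set.Ioc (0 : ℝ) 1))
        {y | δ ≤ |(bdryLpp (fun p => geomQuantile (bdryPar q z p) (y p)) 0 ⌊η * N⌋₊ : ℝ) / N -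
          η * (q / z / (1 - q / z))|}) atTop (𝓝 0) := fun {z} h1 h2 => by
    simp only [bdryLpp_zero_left]
    exact tendstoInMeasure_iff_norm.1 ((hfam h1 h2).tendstoInMeasure_sum
      (p := fun i => (0, i + 1)) (fun i j hij => by simpa using hij)
      (u := q / z) (fun _ => rfl) (div_pos hq0 (hq0.trans h1)).le
      ((div_lt_one (hq0.trans h1)).2 h1) hη) δ hδ
  have hbad := tendsto_measure_union (hS hqu hu1) <| tendsto_measure_union (hS hqu' hu'1) <|
    tendsto_measure_union (hS hu'' hu''1) <| tendsto_measure_union (hB hqu hu1) <|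
    tendsto_measure_union (hB hqu' hu'1) <| tendsto_measure_union (hC hqu hu1) (hC hu'' hu''1)
  refine tendsto_of_tendsto_of_tendsto_of_le_of_le' tendsto_const_nhds hbad
    (Eventually.of_forall fun _ => zero_le) ?_
  filter_upwards [eventually_gt_atTop 0] with N hN
  refine measure_mono fun y hy => ?_
  by_contra hgood
  simp only [Set.mem_union, Set.mem_ofPred_eq, not_or, not_le] at hgood hy
  obtain ⟨g1, g2, g3, g4, g5, g6, g7⟩ := hgood
  refine hy.not_gt (lt_lpp_of_bdryLpp_near
    (W' := fun p => geomQuantile (bdryPar q u' p) (y p))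
    (W'' := fun p => geomQuantile (bdryPar q u'' p) (y p)) (fun _ _ => rfl) (fun _ _ => rfl)
    (fun i => ?_) (fun j => ?_) hN g1 g2 g3 g4 g5 g6 g7 h1 h2 h3)
  · exact geomQuantile_mono hu0 hu'.le hu'1 _
  · exact geomQuantile_mono (div_pos hq0 hu0)
      (div_le_div_of_nonneg_left hq0.le (hq0.trans hu'') hu''u.le)
      ((div_lt_one (hq0.trans hu'')).2 hu'') _

/-- The lower bound in the law of large numbers for last passage times. -/
theorem IsGeomFamily.tendsto_measure_lpp_le {Ω : Type*} [MeasurableSpace Ω] {μ : Measure Ω}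
    [IsProbabilityMeasure μ] {w : ℕ × ℕ → Ω → ℕ} {par : ℕ × ℕ → ℝ} (h : IsGeomFamily μ w par)
    {q γ x : ℝ} (hq0 : 0 < q) (hq1 : q < 1) (hpar : ∀ i j, par (i + 1, j + 1) = q) (hγ : 0 < γ)
    (hx0 : 0 ≤ x) (hx : x < (1 + √(q * γ)) ^ 2 / (1 - q) - 1) :
    Tendsto (fun N : ℕ => μ {ω | lpp (fun p => w p ω) ⌊γ * N⌋₊ N ≤ ⌊N * x⌋₊}) atTop (𝓝 0) := by
  obtain ⟨u, hqu, hu1, hlim⟩ := tendsto_measure_lpp_geomQuantile hq0 hq1 hγ hx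
  refine hlim.congr fun N => ?_
  have hfam := isGeomFamily_geomQuantile (fun p => (bdryPar_mem hq0 hqu hu1 p).1)
    fun p => (bdryPar_mem hq0 hqu hu1 p).2
  rw [h.measure_lpp_le hq0.le hq1.le hpar, ← hfam.measure_lpp_le hq0.le hq1.le fun _ _ => rfl]
  simp only [Nat.le_floor_iff (show 0 ≤ N * x by positivity)]

end LowerBound

section Speed

open ProbabilityTheory Topology
open scoped ENNReal

lemma dependsOn_lpp_shift (m n a b : ℕ) :
    DependsOn (fun W : ℕ × ℕ → ℕ => lpp (fun p => W (m + p.1, n + p.2)) a b)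
      ((Finset.Icc (m + 1) (m + a) ×ˢ Finset.Icc (n + 1) (n + b) : Finset (ℕ × ℕ)) :
        Set (ℕ × ℕ)) := by
  intro W W' h
  refine dependsOn_lpp a b fun p hp => h _ ?_
  simp only [Finset.coe_product, Finset.coe_Icc, Set.mem_prod, Set.mem_Icc] at hp ⊢
  omega

/-- The passage time across the block with corner `(a * b, k * (b + r))`. -/
def blockLpp (a k : ℕ) (W : ℕ × ℕ → ℕ) (p : ℕ × ℕ) : ℕ :=
  lpp (fun x => W (a * p.1 + x.1, k * (p.1 + p.2) + x.2)) a k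

/-- The sites of a block. -/
def block (a k : ℕ) (p : ℕ × ℕ) : Finset (ℕ × ℕ) :=
  Finset.Icc (a * p.1 + 1) (a * p.1 + a) ×ˢ
    Finset.Icc (k * (p.1 + p.2) + 1) (k * (p.1 + p.2) + k)

lemma pairwise_disjoint_block (a k : ℕ) : Pairwise (Function.onFun Disjoint (block a k)) := by
  have key : ∀ {c i j x : ℕ}, x ∈ Finset.Icc (c * i + 1) (c * i + c) →
      x ∈ Finset.Icc (c * j + 1) (c * j + c) → i = j := by
    intro c i j x hi hj
    rw [Finset.mem_Icc] at hi hj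
    by_contra hne
    rcases lt_or_gt_of_ne hne with h | h
    · have := Nat.mul_le_mul_left c (Nat.succ_le_of_lt h)
      rw [Nat.mul_succ] at this
      omega
    · have := Nat.mul_le_mul_left c (Nat.succ_le_of_lt h)
      rw [Nat.mul_succ] at this
      omega
  rintro ⟨b, r⟩ ⟨b', r'⟩ hne
  refine Finset.disjoint_left.2 fun x hx hx' => hne ?_
  simp only [block, Finset.mem_product] at hx hx'
  have h1 := key hx.1 hx'.1
  have h2 := key hx.2 hx'.2
  rw [Prod.mk.injEq]
  omega

lemma sum_blockLpp_le (a k : ℕ) (W : ℕ × ℕ → ℕ) (B r : ℕ) :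
    ∑ b ∈ Finset.range B, blockLpp a k W (b, r) ≤ lpp W (a * B) (k * (B + r)) := by
  induction B with
  | zero => simp
  | succ B ih =>
    rw [Finset.sum_range_succ]
    have := lpp_add_lpp_shift_le W (a * B) (k * (B + r)) a k
    rw [show a * (B + 1) = a * B + a by ring, show k * (B + 1 + r) = k * (B + r) + k by ring]
    exact (Nat.add_le_add_right ih _).trans this

namespace IsGeomFamily

lemma shift {Ω : Type*} [MeasurableSpace Ω] {μ : Measure Ω} {w : ℕ × ℕ → Ω → ℕ}
    {par : ℕ × ℕ → ℝ} (h : IsGeomFamily μ w par) (m n : ℕ) :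
    IsGeomFamily μ (fun p : ℕ × ℕ => w (m + p.1, n + p.2)) fun p => par (m + p.1, n + p.2) where
  measurable p := h.measurable _
  indep := h.indep.precomp (g := fun p : ℕ × ℕ => (m + p.1, n + p.2)) fun p p' hp => by
    simpa [Prod.ext_iff] using hp
  law p k := h.law _ k

lemma lintegral_finset_prod {Ω ι κ : Type*} [MeasurableSpace Ω] {μ : Measure Ω}
    [IsProbabilityMeasure μ] {w : ι → Ω → ℕ} {par : ι → ℝ} (h : IsGeomFamily μ w par)
    {X : κ → (ι → ℕ) → ℝ≥0∞} {S : κ → Finset ι} (hX : ∀ k, DependsOn (X k) (S k : Set ι))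
    (hS : Pairwise (Function.onFun Disjoint S)) (s : Finset κ) :
    ∫⁻ ω, ∏ k ∈ s, X k (fun p => w p ω) ∂μ = ∏ k ∈ s, ∫⁻ ω, X k (fun p => w p ω) ∂μ := by
  classical
  induction s using Finset.induction_on with
  | empty => simp
  | insert k s hk ih =>
    have hY : DependsOn (fun W => ∏ k ∈ s, X k W) ((s.biUnion S : Finset ι) : Set ι) :=
      fun W W' hW => Finset.prod_congr rfl fun k hk => hX k fun p hp =>
        hW p (Finset.mem_coe.2 (Finset.mem_biUnion.2 ⟨k, hk, hp⟩))
    simp only [Finset.prod_insert hk]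
    rw [← ih]
    refine h.lintegral_mul (hX k) hY ?_ id id
    rw [Finset.disjoint_biUnion_right]
    exact fun j hj => hS fun e => hk (e ▸ hj)

variable {Ω : Type*} [MeasurableSpace Ω] {μ : Measure Ω} [IsProbabilityMeasure μ]
  {w : ℕ × ℕ → Ω → ℕ} {par : ℕ × ℕ → ℝ} {q : ℝ}

lemma lintegral_exp_blockLpp_le (h : IsGeomFamily μ w par) (hq0 : 0 ≤ q) (hq1 : q ≤ 1)
    (hpar : ∀ i j, par (i + 1, j + 1) = q) (a : ℕ) {k : ℕ} (hk : 0 < k) (p : ℕ × ℕ) (x : ℝ) :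
    ∫⁻ ω, ENNReal.ofReal (Real.exp (-(blockLpp a k (fun p => w p ω) p / k))) ∂μ ≤
      μ {ω | lpp (fun p => w p ω) a k ≤ ⌊k * x⌋₊} + ENNReal.ofReal (Real.exp (-x)) := by
  set A := {ω | blockLpp a k (fun p => w p ω) p ≤ ⌊k * x⌋₊} with hA'
  have hA : MeasurableSet A :=
    (measurable_lpp (h.shift (a * p.1) (k * (p.1 + p.2))).measurable a k) measurableSet_Iic
  have hlaw : μ A = μ {ω | lpp (fun p => w p ω) a k ≤ ⌊k * x⌋₊} := by
    rw [h.measure_lpp_le hq0 hq1 hpar]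
    exact (h.shift (a * p.1) (k * (p.1 + p.2))).measure_lpp_le hq0 hq1
      (fun i j => hpar (a * p.1 + i) (k * (p.1 + p.2) + j)) a k _
  have hk' : (0 : ℝ) < k := Nat.cast_pos.2 hk
  calc _ ≤ ∫⁻ ω, (A.indicator 1 ω + ENNReal.ofReal (Real.exp (-x))) ∂μ := by
        refine lintegral_mono fun ω => ?_
        by_cases hω : ω ∈ A
        · rw [Set.indicator_of_mem hω]
          refine le_add_right (ENNReal.ofReal_le_one.2 (Real.exp_le_one_iff.2 ?_))
          rw [neg_nonpos]
          positivity
        · rw [Set.indicator_of_notMem hω, zero_add]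
          refine ENNReal.ofReal_le_ofReal (Real.exp_le_exp.2 (neg_le_neg ?_))
          rw [le_div_iff₀' hk']
          rw [hA', Set.mem_ofPred_eq, not_le] at hω
          exact (Nat.lt_of_floor_lt hω).le
    _ = _ := by
        rw [lintegral_add_left (measurable_one.indicator hA), lintegral_indicator_one hA, hlaw]
        simp

/-- A Chernoff bound from `B * s` disjoint blocks. -/
lemma measure_lpp_le_of_blocks (h : IsGeomFamily μ w par) {a k B s M N : ℕ} (hk : 0 < k)
    (hM : a * B ≤ M) (hN : k * (B + s) ≤ N) {t x : ℝ} (ht : 0 ≤ t)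
    (hx : ∀ p, ∫⁻ ω, ENNReal.ofReal (Real.exp (-(blockLpp a k (fun p => w p ω) p / k))) ∂μ ≤
      ENNReal.ofReal (Real.exp (-x))) :
    (μ {ω | lpp (fun p => w p ω) M N ≤ ⌊t⌋₊}).toReal ≤ Real.exp (s * (t / k) - B * s * x) := by
  have hk' : (0 : ℝ) < k := Nat.cast_pos.2 hk
  set I := Finset.range B ×ˢ Finset.range s
  set A := {ω | lpp (fun p => w p ω) M N ≤ ⌊t⌋₊} with hA'
  have hA : MeasurableSet A := measurable_lpp h.measurable M N measurableSet_Iic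
  have key : ENNReal.ofReal (Real.exp (-(s * (t / k)))) * μ A ≤
      ENNReal.ofReal (Real.exp (-(B * s * x))) := by
    calc _ = ∫⁻ ω, A.indicator (fun _ => ENNReal.ofReal (Real.exp (-(s * (t / k))))) ω ∂μ := by
          rw [lintegral_indicator_const hA]
      _ ≤ ∫⁻ ω, ∏ p ∈ I,
          ENNReal.ofReal (Real.exp (-(blockLpp a k (fun p => w p ω) p / k))) ∂μ := by
          refine lintegral_mono fun ω => ?_
          refine Set.indicator_apply_le (g := fun _ => _) fun hω => ?_
          rw [← ENNReal.ofReal_prod_of_nonneg fun p _ => (Real.exp_pos _).le, ← Real.exp_sum]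
          refine ENNReal.ofReal_le_ofReal (Real.exp_le_exp.2 ?_)
          rw [Finset.sum_neg_distrib, neg_le_neg_iff, ← Finset.sum_div, ← Nat.cast_sum,
            ← mul_div_assoc]
          refine div_le_div_of_nonneg_right ?_ hk'.le
          have h1 : ∑ p ∈ I, blockLpp a k (fun p => w p ω) p ≤ s * ⌊t⌋₊ := by
            rw [Finset.sum_product_right]
            refine (Finset.sum_le_card_nsmul _ _ ⌊t⌋₊ fun r hr => ?_).trans (by simp)
            have hr' := Finset.mem_range.1 hr
            exact (sum_blockLpp_le a k _ B r).trans <| (lpp_mono _ hM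
              ((Nat.mul_le_mul_left k (by omega)).trans hN)).trans hω
          calc _ ≤ ((s * ⌊t⌋₊ : ℕ) : ℝ) := Nat.cast_le.2 h1
            _ = s * (⌊t⌋₊ : ℝ) := Nat.cast_mul _ _
            _ ≤ s * t := by gcongr; exact Nat.floor_le ht
      _ = ∏ p ∈ I, ∫⁻ ω,
          ENNReal.ofReal (Real.exp (-(blockLpp a k (fun p => w p ω) p / k))) ∂μ :=
          h.lintegral_finset_prod
            (X := fun p W => ENNReal.ofReal (Real.exp (-(blockLpp a k W p / k)))) (S := block a k)
            (fun p W W' hW => by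
              have := dependsOn_lpp_shift (a * p.1) (k * (p.1 + p.2)) a k hW
              exact congrArg (fun n : ℕ => ENNReal.ofReal (Real.exp (-(n / k)))) this)
            (pairwise_disjoint_block a k) I
      _ ≤ ∏ _p ∈ I, ENNReal.ofReal (Real.exp (-x)) := Finset.prod_le_prod' fun p _ => hx p
      _ = _ := by
          rw [Finset.prod_const, Finset.card_product, Finset.card_range, Finset.card_range,
            ← ENNReal.ofReal_pow (Real.exp_pos _).le, ← Real.exp_nat_mul]
          push_cast
          rw [mul_neg]
  have := ENNReal.toReal_mono ENNReal.ofReal_ne_top key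
  rw [ENNReal.toReal_mul, ENNReal.toReal_ofReal (Real.exp_pos _).le,
    ENNReal.toReal_ofReal (Real.exp_pos _).le, Real.exp_neg, inv_mul_le_iff₀ (Real.exp_pos _),
    ← Real.exp_add] at this
  exact this

/-- The probability of a lower tail event decays at speed `N ^ 2`. -/
theorem tendsto_log_measure_pos (h : IsGeomFamily μ w par) (hq0 : 0 < q) (hq1 : q < 1)
    (hpar : ∀ i j, par (i + 1, j + 1) = q) {γ x L : ℝ} (hγ : 1 ≤ γ) (hx0 : 0 < x)
    (hx : x < (1 + √(q * γ)) ^ 2 / (1 - q) - 1)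
    (hL : Tendsto (fun N : ℕ => -Real.log (μ {ω | lpp (fun p => w p ω) ⌊γ * N⌋₊ N ≤
      ⌊(N : ℝ) * x⌋₊}).toReal / (N : ℝ) ^ 2) atTop (𝓝 L)) : 0 < L := by
  have hγ0 : 0 < γ := by linarith
  obtain ⟨y, hxy, hy⟩ := exists_between hx
  obtain ⟨z, hxz, hzy⟩ := exists_between hxy
  have hz0 : 0 < z := hx0.trans hxz
  obtain ⟨J, hJ⟩ := exists_nat_gt (z / (z - x))
  rw [div_lt_iff₀ (sub_pos.2 hxz)] at hJ
  have hJ0 : 0 < J := Nat.pos_of_ne_zero fun h0 => by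
    rw [h0, Nat.cast_zero, zero_mul] at hJ
    exact hJ.not_gt hz0
  have hexp : Real.exp (-y) < Real.exp (-z) := Real.exp_lt_exp.2 (neg_lt_neg hzy)
  obtain ⟨k, hk, hblock⟩ : ∃ k : ℕ, 0 < k ∧ ∀ p, ∫⁻ ω, ENNReal.ofReal
      (Real.exp (-(blockLpp ⌊γ * k⌋₊ k (fun p => w p ω) p / k))) ∂μ ≤
        ENNReal.ofReal (Real.exp (-z)) := by
    have hlim := h.tendsto_measure_lpp_le hq0 hq1 hpar hγ0 (hx0.trans hxy).le hy
    obtain ⟨k, h1, h2⟩ := ((hlim.eventually_lt_const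
      (ENNReal.ofReal_pos.2 (sub_pos.2 hexp))).and (eventually_gt_atTop 0)).exists
    refine ⟨k, h2, fun p =>
      (h.lintegral_exp_blockLpp_le hq0.le hq1.le hpar ⌊γ * k⌋₊ h2 p y).trans ?_⟩
    refine (add_le_add_left h1.le _).trans_eq ?_
    rw [← ENNReal.ofReal_add (sub_pos.2 hexp).le (Real.exp_pos _).le, sub_add_cancel]
  have hk' : (0 : ℝ) < k := Nat.cast_pos.2 hk
  have hJ' : (0 : ℝ) < J := Nat.cast_pos.2 hJ0
  have hc : 0 < (J - 1) * z - J * x := by linarith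
  have hsub : Tendsto (fun s : ℕ => k * J * s) atTop atTop :=
    tendsto_id.const_mul_atTop' (Nat.mul_pos hk hJ0)
  refine lt_of_lt_of_le (b := ((J - 1) * z - J * x) / (k * J) ^ 2) (by positivity)
    (ge_of_tendsto (hL.comp hsub) ?_)
  filter_upwards [eventually_gt_atTop 0] with s hs
  have hs' : (0 : ℝ) < s := Nat.cast_pos.2 hs
  set N := k * J * s with hN
  have hNr : (N : ℝ) = k * J * s := by rw [hN]; push_cast; rfl
  have hB : (((J - 1) * s : ℕ) : ℝ) = (J - 1) * s := by
    rw [Nat.cast_mul, Nat.cast_sub hJ0, Nat.cast_one]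
  have hbound := h.measure_lpp_le_of_blocks (a := ⌊γ * k⌋₊) (B := (J - 1) * s) (s := s)
    (M := ⌊γ * N⌋₊) (N := N) (t := N * x) hk
    (Nat.le_floor (by
      have h1 := Nat.floor_le (show 0 ≤ γ * k by positivity)
      rw [Nat.cast_mul, hB, hNr]
      calc _ ≤ γ * k * (J * s) := mul_le_mul h1 (by gcongr; linarith)
            (hB ▸ Nat.cast_nonneg _) (by positivity)
        _ = _ := by ring))
    (by
      rw [hN, ← Nat.succ_mul, Nat.succ_eq_add_one, Nat.sub_add_cancel hJ0, mul_assoc])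
    (by positivity) hblock
  have hpos := h.measure_lpp_le_pos hq0 hq1 hpar (M := ⌊γ * N⌋₊) (N := N)
    (Nat.le_floor (by nlinarith [Nat.cast_nonneg (α := ℝ) N])) ⌊(N : ℝ) * x⌋₊
  have hlog := Real.log_le_log hpos hbound
  rw [Real.log_exp, hB, hNr] at hlog
  simp only [Function.comp_apply]
  rw [div_le_div_iff₀ (by positivity) (by positivity), ← hN, hNr]
  have : (s : ℝ) * (k * J * s * x / k) = J * x * s ^ 2 := by field_simp
  rw [this] at hlog
  nlinarith [mul_le_mul_of_nonneg_right hlog (sq_nonneg ((k : ℝ) * J))]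

end IsGeomFamily

end Speed

/-- Lower-tail large deviations for `G(⌊γN⌋,N)`: for `0 < ε < ω(γ,q)` there is `ℓ(ε) > 0` with
`lim_{N→∞} N⁻² log ℙ[G(⌊γN⌋,N) ≤ N(ω(γ,q)−ε)] = −ℓ(ε)`. -/
theorem stmt1
    {Ω : Type*} [MeasurableSpace Ω] (ℙ : Measure Ω) [IsProbabilityMeasure ℙ]
    (q : ℝ) (hq0 : 0 < q) (hq1 : q < 1)
    (w : ℕ × ℕ → Ω → ℕ)
    (hmeas : ∀ p, Measurable (w p))
    (hindep : ProbabilityTheory.iIndepFun w ℙ)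
    (hgeom : ∀ p k, ℙ {ω | w p ω = k} = ENNReal.ofReal ((1 - q) * q ^ k))
    (γ : ℝ) (hγ : 1 ≤ γ)
    (ε : ℝ) (hε0 : 0 < ε)
    (hεω : ε < (1 + Real.sqrt (q * γ)) ^ 2 / (1 - q) - 1) :
    ∃ ℓ : ℝ, 0 < ℓ ∧
      Tendsto
        (fun N : ℕ => (1 / (N : ℝ) ^ 2) *
          Real.log (ℙ {ω | (lppSup (fun p => w p ω) ⌊γ * N⌋₊ N : ℝ) ≤
            N * ((1 + Real.sqrt (q * γ)) ^ 2 / (1 - q) - 1 - ε)}).toReal)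
        atTop (nhds (-ℓ)) := by
  set x := (1 + Real.sqrt (q * γ)) ^ 2 / (1 - q) - 1 - ε with hx
  have hx0 : 0 < x := by linarith
  have h : IsGeomFamily ℙ w fun _ => q := ⟨hmeas, hindep, hgeom⟩
  obtain ⟨L, hL⟩ := h.exists_tendsto_log_measure hq0 hq1 (fun _ _ => rfl) hγ hx0
  refine ⟨L, h.tendsto_log_measure_pos hq0 hq1 (fun _ _ => rfl) hγ hx0 (by linarith) hL,
    hL.neg.congr' ?_⟩
  filter_upwards [eventually_ge_atTop 1] with N hN
  have hM : 1 ≤ ⌊γ * N⌋₊ := Nat.le_floor (by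
    have : (1 : ℝ) ≤ N := Nat.one_le_cast.2 hN
    push_cast
    nlinarith)
  simp only [lppSup_eq_lpp _ hM hN, Nat.le_floor_iff (show 0 ≤ (N : ℝ) * x by positivity)]
  ring
end

section
/- For each q ∈ (0,1), γ ≥ 1 and each ε > 0, there exists i(ε) > 0 such that lim_{N→∞} (1/N) log ℙ[G(⌊γN⌋, N) ≥ N(ω(γ,q) + ε)] = −i(ε). -/
open MeasureTheory Filter

section LastPassage

/-! ### Up/right paths and deterministic properties of the last-passage time -/

lemma UpRightPath.coord_sum {M N : ℕ} {π : ℕ → ℕ × ℕ} (h : UpRightPath M N π) {k : ℕ}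
    (hk : k ≤ M + N - 2) : 1 ≤ (π k).1 ∧ 1 ≤ (π k).2 ∧ (π k).1 + (π k).2 = k + 2 := by
  induction k with
  | zero => simp [h.1]
  | succ k ih =>
    have := ih (by omega)
    rcases h.2.2 k (by omega) with h' | h' <;> rw [h'] <;> dsimp only <;> omega

lemma UpRightPath.coord_le {M N : ℕ} {π : ℕ → ℕ × ℕ} (h : UpRightPath M N π) {k : ℕ}
    (hk : k ≤ M + N - 2) : (π k).1 ≤ M ∧ (π k).2 ≤ N := by
  induction hk using Nat.decreasingInduction with
  | self => simp [h.2.1]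
  | of_succ k hk ih =>
    rcases h.2.2 k hk with h' | h' <;> rw [h'] at ih <;> dsimp only at ih <;> omega

/-- The up/right path that first runs along the bottom row and then up the last column. -/
def cornerPath (M : ℕ) (k : ℕ) : ℕ × ℕ := if k < M then (k + 1, 1) else (M, k + 2 - M)

lemma upRightPath_cornerPath {M N : ℕ} (hM : 1 ≤ M) (hN : 1 ≤ N) :
    UpRightPath M N (cornerPath M) := by
  refine ⟨?_, ?_, fun k hk => ?_⟩ <;> simp only [cornerPath]
  · rw [if_pos (by omega)]
  · split_ifs <;> ext <;> dsimp only <;> omega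
  · split_ifs <;> simp only [Prod.mk.injEq, true_and, true_or] <;> omega

lemma bddAbove_pathSums (w : ℕ × ℕ → ℕ) (M N : ℕ) :
    BddAbove {s | ∃ π : ℕ → ℕ × ℕ, UpRightPath M N π ∧
      s = ∑ k ∈ Finset.range (M + N - 1), w (π k)} := by
  refine ⟨∑ k ∈ Finset.range (M + N - 1),
    ∑ p ∈ Finset.range (k + 3) ×ˢ Finset.range (k + 3), w p, ?_⟩
  rintro s ⟨π, hπ, rfl⟩
  refine Finset.sum_le_sum fun k hk => ?_
  have hk' := Finset.mem_range.1 hk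
  have := hπ.coord_sum (k := k) (by omega)
  exact Finset.single_le_sum (f := w) (fun _ _ => Nat.zero_le _) (by
    simp only [Finset.mem_product, Finset.mem_range]; omega)

lemma UpRightPath.sum_le_lppSup {M N : ℕ} {π : ℕ → ℕ × ℕ} (h : UpRightPath M N π)
    (w : ℕ × ℕ → ℕ) : ∑ k ∈ Finset.range (M + N - 1), w (π k) ≤ lppSup w M N :=
  le_csSup (bddAbove_pathSums w M N) ⟨π, h, rfl⟩

lemma exists_upRightPath_eq_lppSup (w : ℕ × ℕ → ℕ) {M N : ℕ} (hM : 1 ≤ M) (hN : 1 ≤ N) :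
    ∃ π, UpRightPath M N π ∧ lppSup w M N = ∑ k ∈ Finset.range (M + N - 1), w (π k) :=
  Nat.sSup_mem (s := {s | ∃ π : ℕ → ℕ × ℕ, UpRightPath M N π ∧
    s = ∑ k ∈ Finset.range (M + N - 1), w (π k)})
    ⟨_, _, upRightPath_cornerPath hM hN, rfl⟩ (bddAbove_pathSums w M N)

lemma lppSup_congr {w w' : ℕ × ℕ → ℕ} {M N : ℕ}
    (h : ∀ p : ℕ × ℕ, 1 ≤ p.1 → p.1 ≤ M → 1 ≤ p.2 → p.2 ≤ N → w p = w' p) :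
    lppSup w M N = lppSup w' M N := by
  have key : ∀ π, UpRightPath M N π → ∑ k ∈ Finset.range (M + N - 1), w (π k)
      = ∑ k ∈ Finset.range (M + N - 1), w' (π k) := fun π hπ =>
    Finset.sum_congr rfl fun k hk => by
      have hk' := Finset.mem_range.1 hk
      have h1 := hπ.coord_sum (k := k) (by omega)
      have h2 := hπ.coord_le (k := k) (by omega)
      exact h _ h1.1 h2.1 h1.2.1 h2.2
  unfold lppSup
  congr 1
  ext s
  constructor <;> rintro ⟨π, hπ, rfl⟩
  · exact ⟨π, hπ, key π hπ⟩
  · exact ⟨π, hπ, (key π hπ).symm⟩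

lemma UpRightPath.extend_s2 {M N M' N' : ℕ} {π : ℕ → ℕ × ℕ} (h : UpRightPath M N π)
    (hM : 1 ≤ M) (hN : 1 ≤ N)
    (hstep : (M', N') = (M + 1, N) ∨ (M', N') = (M, N + 1)) :
    UpRightPath M' N' (fun k => if k ≤ M + N - 2 then π k else (M', N')) := by
  have hs : M' + N' = M + N + 1 := by
    rcases hstep with h | h <;> simp only [Prod.mk.injEq] at h <;> omega
  refine ⟨by simp [h.1], if_neg (by omega), fun k hk => ?_⟩
  dsimp only
  rw [if_pos (by omega : k ≤ M + N - 2)]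
  rcases Nat.lt_or_ge k (M + N - 2) with hk' | hk'
  · rw [if_pos (by omega)]
    exact h.2.2 k hk'
  · obtain rfl : k = M + N - 2 := by omega
    rw [if_neg (by omega), h.2.1]
    exact hstep

lemma lppSup_add_le (w : ℕ × ℕ → ℕ) {M N M' N' : ℕ} (hM : 1 ≤ M) (hN : 1 ≤ N)
    (hstep : (M', N') = (M + 1, N) ∨ (M', N') = (M, N + 1)) :
    lppSup w M N + w (M', N') ≤ lppSup w M' N' := by
  obtain ⟨π, hπ, hs⟩ := exists_upRightPath_eq_lppSup w hM hN
  have h := (hπ.extend_s2 hM hN hstep).sum_le_lppSup w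
  have hs' : M' + N' - 1 = M + N - 1 + 1 := by
    rcases hstep with h | h <;> simp only [Prod.mk.injEq] at h <;> omega
  rw [hs', Finset.sum_range_succ, if_neg (by omega)] at h
  refine le_trans (le_of_eq ?_) h
  rw [hs]
  congr 1
  refine Finset.sum_congr rfl fun k hk => ?_
  have := Finset.mem_range.1 hk
  rw [if_pos (by omega)]

lemma lppSup_mono_left (w : ℕ × ℕ → ℕ) {M M' N : ℕ} (hM : 1 ≤ M) (hN : 1 ≤ N) (h : M ≤ M') :
    lppSup w M N ≤ lppSup w M' N := by
  induction h with
  | refl => exact le_rfl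
  | step h ih =>
    exact ih.trans ((Nat.le_add_right _ _).trans (lppSup_add_le w (hM.trans h) hN (Or.inl rfl)))

lemma weight_one_le_lppSup (w : ℕ × ℕ → ℕ) {M N : ℕ} (hM : 1 ≤ M) (hN : 1 ≤ N) :
    w (1, 1) ≤ lppSup w M N := by
  have h := upRightPath_cornerPath hM hN
  refine le_trans ?_ (h.sum_le_lppSup w)
  refine le_trans (le_of_eq ?_) (Finset.single_le_sum (f := fun k => w (cornerPath M k))
    (fun _ _ => Nat.zero_le _) (Finset.mem_range.2 (by omega : 0 < M + N - 1)))
  simp [h.1]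

/-- Superadditivity of the last-passage time: concatenate maximising paths. -/
lemma lppSup_superadditive (w : ℕ × ℕ → ℕ) {M N M' N' : ℕ} (hM : 1 ≤ M) (hN : 1 ≤ N)
    (hM' : 1 ≤ M') (hN' : 1 ≤ N') :
    lppSup w M N + lppSup (fun p => w (M + p.1, N + p.2)) M' N' ≤ lppSup w (M + M') (N + N') := by
  obtain ⟨π, hπ, hs⟩ :=
    exists_upRightPath_eq_lppSup (fun p => w (M + p.1, N + p.2)) hM' hN'
  have key : ∀ k ≤ M' + N' - 2, lppSup w M N +
      ∑ k ∈ Finset.range (k + 1), w (M + (π k).1, N + (π k).2) ≤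
      lppSup w (M + (π k).1) (N + (π k).2) := by
    intro k hk
    induction k with
    | zero =>
      have h1 := lppSup_add_le w hM hN (Or.inl rfl)
      have h2 := lppSup_add_le w (by omega : 1 ≤ M + 1) hN (Or.inr rfl)
      simp only [zero_add, Finset.sum_range_one, hπ.1]
      omega
    | succ k ih =>
      rw [Finset.sum_range_succ, ← add_assoc]
      refine (Nat.add_le_add_right (ih (by omega)) _).trans
        (lppSup_add_le w (by omega) (by omega) ?_)
      rcases hπ.2.2 k (by omega) with h | h <;> simp [h, add_assoc]
  have h := key (M' + N' - 2) le_rfl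
  rw [show M' + N' - 2 + 1 = M' + N' - 1 by omega, ← hs, hπ.2.1] at h
  exact h

end LastPassage

section StationaryModel

/-! ### The stationary last-passage model -/

/-- Last-passage times with weights `I` and `J` on the two axes and `w` in the bulk. -/
def stationaryLpp (I J : ℕ → ℕ) (w : ℕ × ℕ → ℕ) : ℕ → ℕ → ℕ
  | 0, 0 => 0
  | i + 1, 0 => stationaryLpp I J w i 0 + I i
  | 0, j + 1 => stationaryLpp I J w 0 j + J j
  | i + 1, j + 1 =>
    w (i + 1, j + 1) + max (stationaryLpp I J w i (j + 1)) (stationaryLpp I J w (i + 1) j)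

lemma lppSup_le_stationaryLpp (I J : ℕ → ℕ) (w : ℕ × ℕ → ℕ) {M N : ℕ} (hM : 1 ≤ M)
    (hN : 1 ≤ N) : lppSup w M N ≤ stationaryLpp I J w M N := by
  obtain ⟨π, hπ, hs⟩ := exists_upRightPath_eq_lppSup w hM hN
  have key : ∀ k ≤ M + N - 2,
      ∑ k ∈ Finset.range (k + 1), w (π k) ≤ stationaryLpp I J w (π k).1 (π k).2 := by
    intro k hk
    induction k with
    | zero =>
      simp only [zero_add, Finset.sum_range_one, hπ.1]
      rw [stationaryLpp]
      exact Nat.le_add_right _ _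
    | succ k ih =>
      have ih := ih (by omega)
      have hc := hπ.coord_sum (k := k) (by omega)
      rw [Finset.sum_range_succ]
      obtain ⟨i, hi⟩ : ∃ i, (π k).1 = i + 1 := ⟨(π k).1 - 1, by omega⟩
      obtain ⟨j, hj⟩ : ∃ j, (π k).2 = j + 1 := ⟨(π k).2 - 1, by omega⟩
      rcases hπ.2.2 k (by omega) with h | h <;> rw [h] <;> dsimp only <;>
        rw [hi, hj] at ih ⊢ <;> rw [stationaryLpp] <;> omega
  have h := key (M + N - 2) le_rfl
  rw [show M + N - 2 + 1 = M + N - 1 by omega, ← hs, hπ.2.1] at h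
  exact h

/-- Index set of the weights of the stationary model: horizontal boundary, vertical boundary,
bulk. -/
abbrev StatIdx : Type := ℕ ⊕ ℕ ⊕ ℕ × ℕ

/-- The local involution `(I, J, w) ↦ (w + (I - J)⁺, w + (J - I)⁺, min I J)` acting on the
coordinates `x, y, z`. -/
def burke {ι : Type*} [DecidableEq ι] (x y z : ι) (s : ι → ℕ) : ι → ℕ := fun t =>
  if t = x then s z + (s x - s y) else if t = y then s z + (s y - s x)
  else if t = z then min (s x) (s y) else s t

/-- Apply the local involution at the first `n` sites of row `j`. -/
def rowMap (j : ℕ) : ℕ → (StatIdx → ℕ) → StatIdx → ℕ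
  | 0 => id
  | n + 1 =>
    burke (Sum.inl n) (Sum.inr (Sum.inl j)) (Sum.inr (Sum.inr (n + 1, j + 1))) ∘ rowMap j n

/-- Apply the local involution at the first `M` sites of each of the first `j` rows. -/
def sweepMap (M : ℕ) : ℕ → (StatIdx → ℕ) → StatIdx → ℕ
  | 0 => id
  | j + 1 => rowMap j M ∘ sweepMap M j

lemma rowMap_spec {I J : ℕ → ℕ} {w : ℕ × ℕ → ℕ} {M j : ℕ} {u : StatIdx → ℕ}
    (hI : ∀ i < M, u (Sum.inl i) + stationaryLpp I J w i j = stationaryLpp I J w (i + 1) j)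
    (hJ : ∀ k ≥ j, u (Sum.inr (Sum.inl k)) = J k)
    (hw : ∀ p : ℕ × ℕ, j < p.2 → u (Sum.inr (Sum.inr p)) = w p) {n : ℕ} (hn : n ≤ M) :
    (∀ i < n, rowMap j n u (Sum.inl i) + stationaryLpp I J w i (j + 1) =
        stationaryLpp I J w (i + 1) (j + 1)) ∧
    (∀ i ≥ n, rowMap j n u (Sum.inl i) = u (Sum.inl i)) ∧
    (rowMap j n u (Sum.inr (Sum.inl j)) + stationaryLpp I J w n j =
        stationaryLpp I J w n (j + 1)) ∧
    (∀ k > j, rowMap j n u (Sum.inr (Sum.inl k)) = J k) ∧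
    (∀ p : ℕ × ℕ, j < p.2 → n < p.1 → rowMap j n u (Sum.inr (Sum.inr p)) = w p) ∧
    (∀ p : ℕ × ℕ, j + 1 < p.2 → rowMap j n u (Sum.inr (Sum.inr p)) = w p) := by
  induction n with
  | zero =>
    refine ⟨by simp, by simp [rowMap], ?_, fun k hk => hJ k hk.le, fun p hp _ => hw p hp,
      fun p hp => hw p (by omega)⟩
    have h0 := hJ j le_rfl
    rw [stationaryLpp]
    simp only [rowMap, id]
    omega
  | succ n ih =>
    obtain ⟨h1, h2, h3, h4, h5, h6⟩ := ih (by omega)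
    have a1 := h2 n le_rfl
    have a2 := hI n (by omega)
    have a3 := h5 (n + 1, j + 1) (by simp) (by simp)
    have a4 : stationaryLpp I J w (n + 1) (j + 1) = w (n + 1, j + 1) +
      max (stationaryLpp I J w n (j + 1)) (stationaryLpp I J w (n + 1) j) := by
      rw [stationaryLpp]
    refine ⟨fun i hi => ?_, fun i hi => ?_, ?_, fun k hk => ?_, fun p hp hp' => ?_,
      fun p hp => ?_⟩
    · rcases Nat.lt_succ_iff_lt_or_eq.1 hi with hi | rfl
      · rw [← h1 i hi]
        simp [rowMap, burke, hi.ne]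
      · simp only [rowMap, burke, Function.comp, if_true]
        omega
    · rw [← h2 i (by omega)]
      simp [rowMap, burke, show i ≠ n by omega]
    · simp only [rowMap, burke, Function.comp, reduceCtorEq, if_true, if_false]
      omega
    · rw [← h4 k hk]
      simp [rowMap, burke, show k ≠ j by omega]
    · rw [← h5 p hp (by omega)]
      have : p ≠ (n + 1, j + 1) := by rintro rfl; simp at hp'
      simp [rowMap, burke, this]
    · rw [← h6 p hp]
      have : p ≠ (n + 1, j + 1) := by rintro rfl; simp at hp
      simp [rowMap, burke, this]

lemma sweepMap_spec (s : StatIdx → ℕ) (M j : ℕ) :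
    let G := stationaryLpp (fun i => s (Sum.inl i)) (fun i => s (Sum.inr (Sum.inl i)))
      (fun p => s (Sum.inr (Sum.inr p)))
    (∀ i < M, sweepMap M j s (Sum.inl i) + G i j = G (i + 1) j) ∧
    (∀ k ≥ j, sweepMap M j s (Sum.inr (Sum.inl k)) = s (Sum.inr (Sum.inl k))) ∧
    (∀ p : ℕ × ℕ, j < p.2 → sweepMap M j s (Sum.inr (Sum.inr p)) = s (Sum.inr (Sum.inr p))) := by
  intro G
  induction j with
  | zero =>
    refine ⟨fun i _ => ?_, fun _ _ => rfl, fun _ _ => rfl⟩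
    simp only [G, sweepMap, id]
    rw [stationaryLpp, add_comm]
  | succ j ih =>
    obtain ⟨h1, _, _, h4, _, h6⟩ := rowMap_spec ih.1 ih.2.1 ih.2.2 (le_refl M)
    exact ⟨h1, fun k hk => h4 k hk, h6⟩

lemma lppSup_le_boundary_sum (s : StatIdx → ℕ) {M N : ℕ} (hM : 1 ≤ M) (hN : 1 ≤ N) :
    lppSup (fun p => s (Sum.inr (Sum.inr p))) M N ≤
      ∑ j ∈ Finset.range N, s (Sum.inr (Sum.inl j)) +
        ∑ i ∈ Finset.range M, sweepMap M N s (Sum.inl i) := by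
  refine (lppSup_le_stationaryLpp (fun i => s (Sum.inl i)) (fun i => s (Sum.inr (Sum.inl i))) _
    hM hN).trans (le_of_eq ?_)
  set G := stationaryLpp (fun i => s (Sum.inl i)) (fun i => s (Sum.inr (Sum.inl i)))
    (fun p => s (Sum.inr (Sum.inr p))) with hG
  have h0 : ∀ n, G 0 n = ∑ j ∈ Finset.range n, s (Sum.inr (Sum.inl j)) := by
    intro n
    induction n with
    | zero => rw [hG, stationaryLpp]; simp
    | succ n ih => rw [Finset.sum_range_succ, ← ih, hG, stationaryLpp]
  have h1 : ∀ n ≤ M, G n N = G 0 N + ∑ i ∈ Finset.range n, sweepMap M N s (Sum.inl i) := by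
    intro n hn
    induction n with
    | zero => simp
    | succ n ih =>
      have := (sweepMap_spec s M N).1 n hn
      rw [← hG, ih (by omega)] at this
      rw [Finset.sum_range_succ, ← this]
      ring
  rw [h1 M le_rfl, h0]

end StationaryModel

section Measures

open Measure ProbabilityTheory

/-! ### Geometric weights and invariance of their product law -/

/-- The geometric law `k ↦ (1 - a) a ^ k` on `ℕ`. -/
noncomputable def geomLaw (a : Set.Ioo (0 : ℝ) 1) : Measure ℕ :=
  geometricMeasure ⟨1 - a, by linarith [a.2.2], by linarith [a.2.1]⟩

instance (a : Set.Ioo (0 : ℝ) 1) : IsProbabilityMeasure (geomLaw a) := by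
  unfold geomLaw; infer_instance

lemma geomLaw_param_ne_zero (a : Set.Ioo (0 : ℝ) 1) :
    (⟨1 - a, by linarith [a.2.2], by linarith [a.2.1]⟩ : unitInterval) ≠ 0 := by
  intro h
  have := congrArg Subtype.val h
  have h2 := a.2.2
  simp only [Set.Icc.coe_zero] at this
  linarith

lemma geomLaw_singleton (a : Set.Ioo (0 : ℝ) 1) (n : ℕ) :
    geomLaw a {n} = ENNReal.ofReal ((1 - a) * (a : ℝ) ^ n) := by
  rw [geomLaw, geometricMeasure_singleton (geomLaw_param_ne_zero a)]
  congr 1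
  simp only [sub_sub_cancel]
  ring

lemma hasSum_geomLaw_exp (a : Set.Ioo (0 : ℝ) 1) {t : ℝ} (ht : a * Real.exp t < 1) :
    HasSum (fun n : ℕ => (1 - (1 - a : ℝ)) ^ n * (1 - a) * Real.exp (t * n))
      ((1 - a) / (1 - a * Real.exp t)) := by
  have h := (hasSum_geometric_of_lt_one (mul_nonneg a.2.1.le (Real.exp_pos t).le) ht).mul_left
    (1 - a : ℝ)
  rw [← div_eq_mul_inv] at h
  refine h.congr_fun fun n => ?_
  rw [mul_pow, ← Real.exp_nat_mul, sub_sub_cancel, mul_comm t]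
  ring

lemma integrable_exp_geomLaw (a : Set.Ioo (0 : ℝ) 1) {t : ℝ} (ht : a * Real.exp t < 1) :
    Integrable (fun n : ℕ => Real.exp (t * n)) (geomLaw a) := by
  rw [geomLaw, integrable_geometricMeasure_iff (geomLaw_param_ne_zero a)]
  simpa [Real.norm_eq_abs, abs_of_pos (Real.exp_pos _)] using (hasSum_geomLaw_exp a ht).summable

lemma mgf_geomLaw (a : Set.Ioo (0 : ℝ) 1) {t : ℝ} (ht : a * Real.exp t < 1) :
    mgf (fun n : ℕ => (n : ℝ)) (geomLaw a) t = (1 - a) / (1 - a * Real.exp t) := by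
  rw [mgf, geomLaw, integral_geometricMeasure (geomLaw_param_ne_zero a)]
  exact (hasSum_geomLaw_exp a ht).tsum_eq

lemma geomLaw_burke {a b q : Set.Ioo (0 : ℝ) 1} (h : (q : ℝ) = a * b) (i j k : ℕ) :
    geomLaw a {k + (i - j)} * geomLaw b {k + (j - i)} * geomLaw q {min i j} =
      geomLaw a {i} * geomLaw b {j} * geomLaw q {k} := by
  have ha : (0 : ℝ) ≤ 1 - a := by linarith [a.2.2]
  have hb : (0 : ℝ) ≤ 1 - b := by linarith [b.2.2]
  have hq : (0 : ℝ) ≤ 1 - q := by linarith [q.2.2]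
  have ha0 := a.2.1.le
  have hb0 := b.2.1.le
  have hq0 := q.2.1.le
  simp only [geomLaw_singleton]
  rw [← ENNReal.ofReal_mul (by positivity), ← ENNReal.ofReal_mul (by positivity),
    ← ENNReal.ofReal_mul (by positivity), ← ENNReal.ofReal_mul (by positivity)]
  congr 1
  have e1 : ((a : ℝ) ^ (k + (i - j)) * (b : ℝ) ^ (k + (j - i))) * (q : ℝ) ^ min i j =
      (a : ℝ) ^ i * (b : ℝ) ^ j * (q : ℝ) ^ k := by
    rw [h, mul_pow, mul_pow]
    have e2 : (a : ℝ) ^ (k + (i - j)) * (a : ℝ) ^ min i j = (a : ℝ) ^ i * (a : ℝ) ^ k := by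
      rw [← pow_add, ← pow_add]; congr 1; omega
    have e3 : (b : ℝ) ^ (k + (j - i)) * (b : ℝ) ^ min i j = (b : ℝ) ^ j * (b : ℝ) ^ k := by
      rw [← pow_add, ← pow_add]; congr 1; omega
    linear_combination ((b : ℝ) ^ (k + (j - i)) * (b : ℝ) ^ min i j) * e2 +
      ((a : ℝ) ^ i * (a : ℝ) ^ k) * e3
  linear_combination ((1 - a) * (1 - b) * (1 - q) : ℝ) * e1

section Burke

variable {ι : Type*} [DecidableEq ι] {x y z : ι}

lemma burke_involutive (hxy : x ≠ y) (hxz : x ≠ z) (hyz : y ≠ z) :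
    Function.Involutive (burke x y z) := by
  intro s
  ext t
  simp only [burke, if_true, hxy.symm, hxz.symm, hyz.symm, if_false]
  split_ifs with h1 h2 h3
  · subst h1; omega
  · subst h2; omega
  · subst h3; omega
  · rfl

lemma measurable_burke (x y z : ι) : Measurable (burke x y z) := by
  refine measurable_pi_iff.2 fun t => ?_
  unfold burke
  split_ifs <;> fun_prop

lemma map_burke_pi [Fintype ι] (μ : ι → Measure ℕ) [∀ i, IsProbabilityMeasure (μ i)]
    (hxy : x ≠ y) (hxz : x ≠ z) (hyz : y ≠ z)
    (h : ∀ i j k, μ x {k + (i - j)} * μ y {k + (j - i)} * μ z {min i j} =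
      μ x {i} * μ y {j} * μ z {k}) :
    (Measure.pi μ).map (burke x y z) = Measure.pi μ := by
  refine Measure.ext_of_singleton fun s => ?_
  rw [map_apply (measurable_burke x y z) (measurableSet_singleton s)]
  have hpre : burke x y z ⁻¹' {s} = {burke x y z s} := by
    ext u
    simp only [Set.mem_preimage, Set.mem_singleton_iff]
    exact (burke_involutive hxy hxz hyz).eq_iff
  rw [hpre, pi_singleton, pi_singleton, ← Finset.prod_mul_prod_compl {x, y, z},
    ← Finset.prod_mul_prod_compl {x, y, z} (fun i => μ i {s i})]
  congr 1
  · rw [Finset.prod_insert (by simp [hxy, hxz]), Finset.prod_insert (by simp [hyz]),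
      Finset.prod_singleton, Finset.prod_insert (by simp [hxy, hxz]),
      Finset.prod_insert (by simp [hyz]), Finset.prod_singleton, ← mul_assoc, ← mul_assoc,
      ← h (s x) (s y) (s z)]
    simp [burke, hxy.symm, hxz.symm, hyz.symm]
  · refine Finset.prod_congr rfl fun i hi => ?_
    simp only [Finset.mem_compl, Finset.mem_insert, Finset.mem_singleton, not_or] at hi
    simp [burke, hi.1, hi.2.1, hi.2.2]

lemma measurePreserving_burke (μ : ι → Measure ℕ) [∀ i, IsProbabilityMeasure (μ i)]
    (hxy : x ≠ y) (hxz : x ≠ z) (hyz : y ≠ z)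
    (h : ∀ i j k, μ x {k + (i - j)} * μ y {k + (j - i)} * μ z {min i j} =
      μ x {i} * μ y {j} * μ z {k}) :
    MeasurePreserving (burke x y z) (infinitePi μ) (infinitePi μ) := by
  refine ⟨measurable_burke x y z, ?_⟩
  refine IsProjectiveLimit.unique (P := fun I : Finset ι => Measure.pi fun i : I => μ i) ?_
    (isProjectiveLimit_infinitePi μ)
  intro S
  let T : Finset ι := insert x (insert y (insert z S))
  have hST : S ⊆ T := fun i hi => by simp [T, hi]
  have hx : x ∈ T := by simp [T]
  have hy : y ∈ T := by simp [T]
  have hz : z ∈ T := by simp [T]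
  have hcomm : T.restrict ∘ burke x y z =
      burke (⟨x, hx⟩ : T) ⟨y, hy⟩ ⟨z, hz⟩ ∘ T.restrict (π := fun _ => ℕ) := by
    ext s t
    simp [burke, Subtype.ext_iff]
  have hT : ((infinitePi μ).map (burke x y z)).map T.restrict =
      Measure.pi fun i : T => μ i := by
    rw [map_map (Finset.measurable_restrict T) (measurable_burke x y z), hcomm,
      ← map_map (measurable_burke _ _ _) (Finset.measurable_restrict T),
      infinitePi_map_restrict, map_burke_pi]
    · simpa [Subtype.ext_iff] using hxy
    · simpa [Subtype.ext_iff] using hxz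
    · simpa [Subtype.ext_iff] using hyz
    · exact h
  have hres : S.restrict (π := fun _ : ι => ℕ) = Finset.restrict₂ hST ∘ T.restrict := rfl
  rw [hres, ← map_map (Finset.measurable_restrict₂ hST) (Finset.measurable_restrict T), hT,
    ← infinitePi_map_restrict (μ := μ) (I := T), map_map (Finset.measurable_restrict₂ hST)
    (Finset.measurable_restrict T), ← hres, infinitePi_map_restrict]

end Burke

/-- Marginal laws of the stationary model. -/
noncomputable def statMarginal (a b q : Set.Ioo (0 : ℝ) 1) : StatIdx → Measure ℕ
  | Sum.inl _ => geomLaw a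
  | Sum.inr (Sum.inl _) => geomLaw b
  | Sum.inr (Sum.inr _) => geomLaw q

instance (a b q : Set.Ioo (0 : ℝ) 1) (i : StatIdx) :
    IsProbabilityMeasure (statMarginal a b q i) := by
  rcases i with i | i | i <;> simp only [statMarginal] <;> infer_instance

lemma measurePreserving_sweepMap {a b q : Set.Ioo (0 : ℝ) 1} (h : (q : ℝ) = a * b) (M N : ℕ) :
    MeasurePreserving (sweepMap M N) (infinitePi (statMarginal a b q))
      (infinitePi (statMarginal a b q)) := by
  have hrow : ∀ j n, MeasurePreserving (rowMap j n) (infinitePi (statMarginal a b q))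
      (infinitePi (statMarginal a b q)) := by
    intro j n
    induction n with
    | zero => exact .id _
    | succ n ih =>
      exact (measurePreserving_burke (x := Sum.inl n) (y := Sum.inr (Sum.inl j))
        (z := Sum.inr (Sum.inr (n + 1, j + 1))) (statMarginal a b q) (by simp) (by simp) (by simp)
        (fun i j k => geomLaw_burke h i j k)).comp ih
  induction N with
  | zero => exact .id _
  | succ N ih => exact (hrow N M).comp ih

/-! ### Exponential tail bounds for sums of geometric variables -/

lemma exists_exp_rate (a : Set.Ioo (0 : ℝ) 1) {δ : ℝ} (hδ : 0 < δ) :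
    ∃ t > 0, a * Real.exp t < 1 ∧
      Real.log ((1 - a) / (1 - a * Real.exp t)) - t * (a / (1 - a) + δ) < 0 := by
  have ha : (0 : ℝ) < 1 - a := by linarith [a.2.2]
  set f : ℝ → ℝ := fun t =>
    Real.log (1 - a) - Real.log (1 - a * Real.exp t) - t * (a / (1 - a) + δ) with hf
  have hd : HasDerivAt f (-δ) 0 := by
    have h1 : HasDerivAt (fun t => 1 - (a : ℝ) * Real.exp t) (-(a * Real.exp 0)) 0 := by
      simpa using ((Real.hasDerivAt_exp 0).const_mul (a : ℝ)).const_sub 1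
    have h2 := h1.log (by simpa using ha.ne')
    have h3 := (h2.const_sub (Real.log (1 - a))).sub
      ((hasDerivAt_id (0 : ℝ)).mul_const ((a : ℝ) / (1 - a) + δ))
    refine h3.congr_deriv ?_
    simp only [Real.exp_zero, mul_one, one_mul]
    ring
  have hf0 : f 0 = 0 := by simp [hf]
  have h1 : ∀ᶠ t in nhdsWithin (0 : ℝ) (Set.Ioi 0), slope f 0 t < 0 :=
    (((hasDerivAt_iff_tendsto_slope.1 hd).mono_left
      (nhdsWithin_mono 0 fun t ht => ne_of_gt ht)).eventually_lt_const (by linarith))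
  have h2 : ∀ᶠ t in nhdsWithin (0 : ℝ) (Set.Ioi 0), (a : ℝ) * Real.exp t < 1 := by
    have : ContinuousAt (fun t => (a : ℝ) * Real.exp t) 0 := by fun_prop
    exact (this.eventually_lt_const (by simpa using a.2.2)).filter_mono nhdsWithin_le_nhds
  obtain ⟨t, ⟨ht1, ht2⟩, ht0⟩ := ((h1.and h2).and self_mem_nhdsWithin).exists
  have ht0 : 0 < t := ht0
  refine ⟨t, ht0, ht2, ?_⟩
  rw [slope_def_field, hf0, sub_zero, sub_zero, div_lt_iff₀ ht0, zero_mul] at ht1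
  rw [Real.log_div ha.ne' (by linarith)]
  exact ht1

lemma exists_geom_sum_tail (a : Set.Ioo (0 : ℝ) 1) {κ δ : ℝ} (hκ : 0 < κ) (hδ : 0 < δ) :
    ∃ c > 0, ∀ {Ω : Type} [MeasurableSpace Ω] (P : Measure Ω) [IsProbabilityMeasure P]
      (X : ℕ → Ω → ℕ), (∀ i, Measurable (X i)) → iIndepFun X P →
      (∀ i, P.map (X i) = geomLaw a) → ∀ N n : ℕ, (n : ℝ) ≤ κ * N →
      P.real {ω | N * (κ * (a / (1 - a)) + δ) ≤ ∑ i ∈ Finset.range n, (X i ω : ℝ)} ≤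
        Real.exp (-c * N) := by
  obtain ⟨t, ht0, ht1, ht⟩ := exists_exp_rate a (div_pos hδ hκ)
  have ha : (0 : ℝ) < 1 - a := by linarith [a.2.2]
  set m := (1 - a : ℝ) / (1 - a * Real.exp t) with hm
  refine ⟨-(κ * (Real.log m - t * (a / (1 - a) + δ / κ))), by nlinarith, ?_⟩
  intro Ω _ P _ X hX hind hlaw N n hn
  have hm1 : 1 ≤ m := by
    rw [hm, le_div_iff₀ (by linarith)]
    have := mul_le_mul_of_nonneg_left (Real.one_le_exp ht0.le) a.2.1.le
    linarith
  have hYm : ∀ i, Measurable fun ω => (X i ω : ℝ) := fun i =>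
    (measurable_of_countable (fun n : ℕ => (n : ℝ))).comp (hX i)
  have hYind : iIndepFun (fun i ω => (X i ω : ℝ)) P :=
    hind.comp (fun _ (n : ℕ) => (n : ℝ)) fun _ => measurable_of_countable _
  have hYint : ∀ i, Integrable (fun ω => Real.exp (t * (X i ω : ℝ))) P := fun i => by
    have h := integrable_exp_geomLaw a ht1
    rw [← hlaw i] at h
    exact h.comp_measurable (hX i)
  have hYmgf : ∀ i, mgf (fun ω => (X i ω : ℝ)) P t = m := fun i => by
    rw [hm, ← mgf_geomLaw a ht1, ← hlaw i,
      mgf_map (hX i).aemeasurable (measurable_of_countable _).aestronglyMeasurable]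
    rfl
  have key := measure_ge_le_exp_mul_mgf (μ := P)
    (X := ∑ i ∈ Finset.range n, fun ω => (X i ω : ℝ)) (N * (κ * (a / (1 - a)) + δ)) ht0.le
    (hYind.integrable_exp_mul_sum hYm fun i _ => hYint i)
  rw [hYind.mgf_sum hYm, Finset.prod_congr rfl fun i _ => hYmgf i, Finset.prod_const,
    Finset.card_range] at key
  simp only [Finset.sum_apply] at key
  refine key.trans ?_
  have hpow : m ^ n ≤ Real.exp (κ * N * Real.log m) := by
    rw [← Real.rpow_natCast, Real.rpow_def_of_pos (by linarith), mul_comm (Real.log m)]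
    exact Real.exp_le_exp.2 (mul_le_mul_of_nonneg_right hn (Real.log_nonneg hm1))
  refine (mul_le_mul_of_nonneg_left hpow (Real.exp_pos _).le).trans (le_of_eq ?_)
  rw [← Real.exp_add]
  congr 1
  field_simp
  ring

end Measures

section LargeDeviations

open Measure ProbabilityTheory

/-! ### Probabilistic estimates for the last-passage time -/

/-- Extend an array indexed by a finite set of sites by zero. -/
def extendByZero (S : Finset (ℕ × ℕ)) (v : S → ℕ) (p : ℕ × ℕ) : ℕ :=
  if h : p ∈ S then v ⟨p, h⟩ else 0

lemma extendByZero_restrict {S : Finset (ℕ × ℕ)} {p : ℕ × ℕ} (hp : p ∈ S) (w : ℕ × ℕ → ℕ) :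
    extendByZero S (fun i : S => w i) p = w p := by
  simp [extendByZero, hp]

lemma lppSup_eq_extendByZero (w : ℕ × ℕ → ℕ) (M N : ℕ) :
    lppSup w M N =
      lppSup (extendByZero (Finset.Icc 1 M ×ˢ Finset.Icc 1 N) (fun i => w i)) M N :=
  lppSup_congr fun p h1 h2 h3 h4 =>
    (extendByZero_restrict (by simp [h1, h2, h3, h4]) w).symm

lemma lppSup_shift_eq_extendByZero (w : ℕ × ℕ → ℕ) (M N M' N' : ℕ) :
    lppSup (fun p => w (M + p.1, N + p.2)) M' N' =
      lppSup (fun p => extendByZero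
        (Finset.Icc (M + 1) (M + M') ×ˢ Finset.Icc (N + 1) (N + N')) (fun i => w i)
        (M + p.1, N + p.2)) M' N' :=
  lppSup_congr fun p h1 h2 h3 h4 => (extendByZero_restrict (by
    simp only [Finset.mem_product, Finset.mem_Icc]; omega) w).symm

lemma measurable_lppSup (M N : ℕ) : Measurable fun w : ℕ × ℕ → ℕ => lppSup w M N := by
  have h : (fun w : ℕ × ℕ → ℕ => lppSup w M N) =
      (fun v => lppSup (extendByZero (Finset.Icc 1 M ×ˢ Finset.Icc 1 N) v) M N) ∘
        Finset.restrict _ := by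
    ext w
    exact lppSup_eq_extendByZero w M N
  rw [h]
  exact (measurable_of_countable _).comp (Finset.measurable_restrict _)

lemma measurableSet_lppTail (x : ℝ) (M N : ℕ) :
    MeasurableSet {w : ℕ × ℕ → ℕ | x ≤ (lppSup w M N : ℝ)} :=
  measurableSet_le measurable_const ((measurable_of_countable _).comp (measurable_lppSup M N))

/-- The law of an array of independent geometric weights. -/
noncomputable abbrev weightLaw (q : Set.Ioo (0 : ℝ) 1) : Measure (ℕ × ℕ → ℕ) :=
  infinitePi fun _ => geomLaw q

lemma lppTail_superadditive (q : Set.Ioo (0 : ℝ) 1) (x y : ℝ) {M N M' N' : ℕ} (hM : 1 ≤ M)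
    (hN : 1 ≤ N) (hM' : 1 ≤ M') (hN' : 1 ≤ N') :
    (weightLaw q).real {w | x ≤ (lppSup w M N : ℝ)} *
      (weightLaw q).real {w | y ≤ (lppSup w M' N' : ℝ)} ≤
      (weightLaw q).real {w | x + y ≤ (lppSup w (M + M') (N + N') : ℝ)} := by
  set S := Finset.Icc 1 M ×ˢ Finset.Icc 1 N with hS
  set T := Finset.Icc (M + 1) (M + M') ×ˢ Finset.Icc (N + 1) (N + N') with hT
  have hdisj : Disjoint S T := by
    rw [Finset.disjoint_left]
    intro p hp hp'
    simp only [hS, hT, Finset.mem_product, Finset.mem_Icc] at hp hp'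
    omega
  have hind : iIndepFun (fun (p : ℕ × ℕ) (w : ℕ × ℕ → ℕ) => w p) (weightLaw q) :=
    iIndepFun_infinitePi (X := fun _ n => n) fun _ => measurable_id
  have hST := hind.indepFun_finset S T hdisj fun p => measurable_pi_apply p
  have hmul := hST.measure_inter_preimage_eq_mul
    {v | x ≤ (lppSup (extendByZero S v) M N : ℝ)}
    {v | y ≤ (lppSup (fun p => extendByZero T v (M + p.1, N + p.2)) M' N' : ℝ)}
    (Set.to_countable _).measurableSet (Set.to_countable _).measurableSet
  have hS' : {w : ℕ × ℕ → ℕ | x ≤ (lppSup w M N : ℝ)} = (fun w (i : S) => w i) ⁻¹'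
      {v | x ≤ (lppSup (extendByZero S v) M N : ℝ)} :=
    Set.ext fun w => iff_of_eq (congrArg (fun n : ℕ => x ≤ (n : ℝ)) (lppSup_eq_extendByZero w M N))
  have hT' : {w : ℕ × ℕ → ℕ | y ≤ (lppSup (fun p => w (M + p.1, N + p.2)) M' N' : ℝ)} =
      (fun w (i : T) => w i) ⁻¹'
        {v | y ≤ (lppSup (fun p => extendByZero T v (M + p.1, N + p.2)) M' N' : ℝ)} :=
    Set.ext fun w => iff_of_eq
      (congrArg (fun n : ℕ => y ≤ (n : ℝ)) (lppSup_shift_eq_extendByZero w M N M' N'))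
  rw [← hS', ← hT'] at hmul
  have hshift : weightLaw q {w | y ≤ (lppSup (fun p => w (M + p.1, N + p.2)) M' N' : ℝ)} =
      weightLaw q {w | y ≤ (lppSup w M' N' : ℝ)} := by
    have hinj : Function.Injective fun p : ℕ × ℕ => (M + p.1, N + p.2) := by
      intro p p' h
      simp only [Prod.mk.injEq] at h
      ext <;> omega
    have hm : weightLaw q = (weightLaw q).map fun w p => w (M + p.1, N + p.2) :=
      (map_infinitePi_infinitePi_of_inj (P := fun _ : ℕ × ℕ => geomLaw q) hinj).symm
    conv_rhs => rw [hm]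
    rw [map_apply (by fun_prop) (measurableSet_lppTail y M' N')]
    rfl
  rw [hshift] at hmul
  rw [measureReal_def, measureReal_def, ← ENNReal.toReal_mul, ← hmul, ← measureReal_def]
  refine measureReal_mono ?_
  rintro w ⟨h1, h2⟩
  have h1 : x ≤ (lppSup w M N : ℝ) := h1
  have h2 : y ≤ (lppSup (fun p => w (M + p.1, N + p.2)) M' N' : ℝ) := h2
  have h3 : (lppSup w M N : ℝ) + lppSup (fun p => w (M + p.1, N + p.2)) M' N' ≤
      lppSup w (M + M') (N + N') := by exact_mod_cast lppSup_superadditive w hM hN hM' hN'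
  exact (add_le_add h1 h2).trans h3

lemma lppTail_pos (q : Set.Ioo (0 : ℝ) 1) (x : ℝ) {M N : ℕ} (hM : 1 ≤ M) (hN : 1 ≤ N) :
    0 < (weightLaw q).real {w | x ≤ (lppSup w M N : ℝ)} := by
  obtain ⟨k, hk⟩ := exists_nat_ge x
  have h1 : 0 < (weightLaw q).real {w | w (1, 1) = k} := by
    have : weightLaw q {w | w (1, 1) = k} = geomLaw q {k} := by
      exact (measurePreserving_eval_infinitePi (fun _ : ℕ × ℕ => geomLaw q)
        (1, 1)).measure_preimage (measurableSet_singleton k).nullMeasurableSet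
    have hpos : (0 : ℝ) < (1 - q) * (q : ℝ) ^ k :=
      mul_pos (by linarith [q.2.2]) (pow_pos q.2.1 k)
    rw [measureReal_def, this, geomLaw_singleton, ENNReal.toReal_ofReal hpos.le]
    exact hpos
  refine h1.trans_le (measureReal_mono ?_)
  intro w hw
  have hw : w (1, 1) = k := hw
  have := weight_one_le_lppSup w hM hN
  rw [hw] at this
  exact hk.trans (by exact_mod_cast this)

lemma lppTail_le_of_stationary {a b q : Set.Ioo (0 : ℝ) 1} (hq : (q : ℝ) = a * b) {γ ε : ℝ}
    (hγ : 1 ≤ γ) (hε : 0 < ε) :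
    ∃ c > 0, ∀ N : ℕ, 1 ≤ N →
      (weightLaw q).real {w | N * (γ * (a / (1 - a)) + b / (1 - b) + ε) ≤
        (lppSup w ⌊γ * N⌋₊ N : ℝ)} ≤ 2 * Real.exp (-c * N) := by
  obtain ⟨c₁, hc₁, h₁⟩ := exists_geom_sum_tail a (by linarith : 0 < γ) (half_pos hε)
  obtain ⟨c₂, hc₂, h₂⟩ := exists_geom_sum_tail b one_pos (half_pos hε)
  refine ⟨min c₁ c₂, lt_min hc₁ hc₂, fun N hN => ?_⟩
  have hN' : (1 : ℝ) ≤ N := by exact_mod_cast hN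
  have hM : 1 ≤ ⌊γ * N⌋₊ := Nat.le_floor (by push_cast; nlinarith)
  have hMle : (⌊γ * N⌋₊ : ℝ) ≤ γ * N := Nat.floor_le (by nlinarith)
  set M := ⌊γ * N⌋₊
  set ν := infinitePi (statMarginal a b q) with hν
  have hmp := measurePreserving_sweepMap hq M N
  have hcoord : ∀ {f : ℕ → StatIdx}, Function.Injective f →
      iIndepFun (fun i (s : StatIdx → ℕ) => s (f i)) ν := fun hf =>
    (iIndepFun_infinitePi (P := statMarginal a b q) (X := fun _ n => n)
      fun _ => measurable_id).precomp hf
  have hA := h₁ ν (fun i s => s (Sum.inl i)) (fun i => measurable_pi_apply _)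
    (hcoord Sum.inl_injective) (fun i => infinitePi_map_eval _ (Sum.inl i)) N M hMle
  have hB := h₂ ν (fun i s => s (Sum.inr (Sum.inl i))) (fun i => measurable_pi_apply _)
    (hcoord (Sum.inr_injective.comp Sum.inl_injective))
    (fun i => infinitePi_map_eval _ (Sum.inr (Sum.inl i))) N N (by simp)
  set A : Set (StatIdx → ℕ) := {s | (N : ℝ) * (γ * ((a : ℝ) / (1 - a)) + ε / 2) ≤
    ∑ i ∈ Finset.range M, (s (Sum.inl i) : ℝ)} with hAdef
  set B : Set (StatIdx → ℕ) := {s | (N : ℝ) * (1 * ((b : ℝ) / (1 - b)) + ε / 2) ≤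
    ∑ i ∈ Finset.range N, (s (Sum.inr (Sum.inl i)) : ℝ)} with hBdef
  have hAm : MeasurableSet A := by
    refine measurableSet_le measurable_const (Finset.measurable_sum _ fun i _ => ?_)
    exact (measurable_of_countable fun n : ℕ => (n : ℝ)).comp (measurable_pi_apply _)
  have hA' : ν.real (sweepMap M N ⁻¹' A) = ν.real A := by
    rw [measureReal_def, hmp.measure_preimage hAm.nullMeasurableSet, measureReal_def]
  have hlaw : (weightLaw q).real {w | N * (γ * (a / (1 - a)) + b / (1 - b) + ε) ≤
      (lppSup w M N : ℝ)} = ν.real {s | N * (γ * (a / (1 - a)) + b / (1 - b) + ε) ≤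
      (lppSup (fun p => s (Sum.inr (Sum.inr p))) M N : ℝ)} := by
    have hm := map_infinitePi_infinitePi_of_inj (P := statMarginal a b q)
      (f := fun p : ℕ × ℕ => Sum.inr (Sum.inr p)) (Sum.inr_injective.comp Sum.inr_injective)
    have hm' : weightLaw q = ν.map fun s p => s (Sum.inr (Sum.inr p)) := hm.symm
    rw [hm', map_measureReal_apply (by fun_prop) (measurableSet_lppTail _ M N)]
    rfl
  rw [hlaw]
  have hsub : {s : StatIdx → ℕ | N * (γ * (a / (1 - a)) + b / (1 - b) + ε) ≤
      (lppSup (fun p => s (Sum.inr (Sum.inr p))) M N : ℝ)} ⊆ sweepMap M N ⁻¹' A ∪ B := by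
    intro s hs
    have hs : N * (γ * (a / (1 - a)) + b / (1 - b) + ε) ≤
      (lppSup (fun p => s (Sum.inr (Sum.inr p))) M N : ℝ) := hs
    have hle : (lppSup (fun p => s (Sum.inr (Sum.inr p))) M N : ℝ) ≤
        ∑ j ∈ Finset.range N, (s (Sum.inr (Sum.inl j)) : ℝ) +
          ∑ i ∈ Finset.range M, (sweepMap M N s (Sum.inl i) : ℝ) := by
      exact_mod_cast lppSup_le_boundary_sum s hM hN
    by_contra hcon
    simp only [hAdef, hBdef, Set.mem_union, Set.mem_preimage, Set.mem_ofPred_eq, not_or,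
      not_le] at hcon
    linarith [hcon.1, hcon.2]
  refine (measureReal_mono hsub).trans ((measureReal_union_le _ _).trans ?_)
  rw [hA', two_mul]
  refine add_le_add (hA.trans (Real.exp_le_exp.2 ?_)) (hB.trans (Real.exp_le_exp.2 ?_))
  · have := min_le_left c₁ c₂
    nlinarith
  · have := min_le_right c₁ c₂
    nlinarith

/-- Boundary parameters for which the mean of the stationary model matches the
last-passage constant. -/
lemma exists_stationary_parameters_s2 (q : Set.Ioo (0 : ℝ) 1) {γ : ℝ} (hγ : 1 ≤ γ) :
    ∃ a b : Set.Ioo (0 : ℝ) 1, (q : ℝ) = a * b ∧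
      γ * ((a : ℝ) / (1 - a)) + (b : ℝ) / (1 - b) =
        (1 + Real.sqrt (q * γ)) ^ 2 / (1 - q) - 1 := by
  obtain ⟨q, hq0, hq1⟩ := q
  have hγ0 : 0 < γ := by linarith
  set r := Real.sqrt q with hr
  set g := Real.sqrt γ with hg
  have hr0 : 0 < r := Real.sqrt_pos.2 hq0
  have hg0 : 0 < g := Real.sqrt_pos.2 hγ0
  have hrq : r ^ 2 = q := Real.sq_sqrt hq0.le
  have hgγ : g ^ 2 = γ := Real.sq_sqrt hγ0.le
  have hr1 : r < 1 := by nlinarith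
  have hr2 : 0 < 1 - r ^ 2 := by rw [hrq]; linarith
  have ha : 1 - r * (1 + r * g) / (g + r) = g * (1 - r ^ 2) / (g + r) := by
    field_simp
    ring
  have hb : 1 - r * (g + r) / (1 + r * g) = (1 - r ^ 2) / (1 + r * g) := by
    field_simp
    ring
  have ha1 : 0 < g * (1 - r ^ 2) / (g + r) := by positivity
  have hb1 : 0 < (1 - r ^ 2) / (1 + r * g) := by positivity
  refine ⟨⟨r * (1 + r * g) / (g + r), by positivity, by linarith⟩,
    ⟨r * (g + r) / (1 + r * g), by positivity, by linarith⟩, ?_, ?_⟩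
  · simp only
    rw [← hrq]
    field_simp
  · simp only
    rw [ha, hb, Real.sqrt_mul hq0.le, ← hr, ← hg, ← hgγ, ← hrq]
    field_simp
    ring

lemma lppTail_le_exp (q : Set.Ioo (0 : ℝ) 1) {γ ε : ℝ} (hγ : 1 ≤ γ) (hε : 0 < ε) :
    ∃ c > 0, ∀ N : ℕ, 1 ≤ N →
      (weightLaw q).real {w | N * ((1 + Real.sqrt (q * γ)) ^ 2 / (1 - q) - 1 + ε) ≤
        (lppSup w ⌊γ * N⌋₊ N : ℝ)} ≤ 2 * Real.exp (-c * N) := by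
  obtain ⟨a, b, hab, hmean⟩ := exists_stationary_parameters_s2 q hγ
  rw [← hmean]
  exact lppTail_le_of_stationary hab hγ hε

/-- A sequence of probabilities that is supermultiplicative and exponentially small has a
positive exponential rate. -/
lemma exists_pos_rate {p : ℕ → ℝ} (hp0 : ∀ N, 0 < p N) (hp1 : ∀ N, p N ≤ 1)
    (hmul : ∀ m n, p m * p n ≤ p (m + n)) {c : ℝ} (hc : 0 < c)
    (hle : ∀ N : ℕ, 1 ≤ N → p N ≤ 2 * Real.exp (-c * N)) :
    ∃ i : ℝ, 0 < i ∧
      Tendsto (fun N : ℕ => (1 / (N : ℝ)) * Real.log (p N)) atTop (nhds (-i)) := by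
  have hsub : Subadditive fun N => -Real.log (p N) := fun m n => by
    have h := Real.log_le_log (mul_pos (hp0 m) (hp0 n)) (hmul m n)
    rw [Real.log_mul (hp0 m).ne' (hp0 n).ne'] at h
    linarith
  have hbdd : BddBelow (Set.range fun N : ℕ => -Real.log (p N) / N) := by
    refine ⟨0, ?_⟩
    rintro _ ⟨N, rfl⟩
    exact div_nonneg (neg_nonneg.2 (Real.log_nonpos (hp0 N).le (hp1 N))) (Nat.cast_nonneg N)
  have hlim := hsub.tendsto_lim hbdd
  refine ⟨hsub.lim, hc.trans_le ?_, ?_⟩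
  · have hlow : Tendsto (fun N : ℕ => c - Real.log 2 / N) atTop (nhds c) := by
      simpa using (tendsto_const_div_atTop_nhds_zero_nat (Real.log 2)).const_sub c
    refine le_of_tendsto_of_tendsto hlow hlim ?_
    filter_upwards [eventually_ge_atTop 1] with N hN
    have hN' : (0 : ℝ) < N := by exact_mod_cast hN
    have h := Real.log_le_log (hp0 N) (hle N hN)
    rw [Real.log_mul two_ne_zero (Real.exp_pos _).ne', Real.log_exp] at h
    rw [le_div_iff₀ hN', sub_mul, div_mul_cancel₀ _ hN'.ne']
    linarith
  · refine hlim.neg.congr fun N => ?_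
    ring

lemma map_weights_eq_weightLaw {Ω : Type*} [MeasurableSpace Ω] (P : Measure Ω)
    [IsProbabilityMeasure P] (q : Set.Ioo (0 : ℝ) 1) {w : ℕ × ℕ → Ω → ℕ}
    (hmeas : ∀ p, Measurable (w p)) (hindep : iIndepFun w P)
    (hgeom : ∀ p k, P {ω | w p ω = k} = ENNReal.ofReal ((1 - q) * (q : ℝ) ^ k)) :
    P.map (fun ω p => w p ω) = weightLaw q := by
  rw [hindep.map_fun_eq_infinitePi_map hmeas]
  congr 1
  ext1 p
  refine Measure.ext_of_singleton fun k => ?_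
  rw [map_apply (hmeas p) (measurableSet_singleton k), geomLaw_singleton, ← hgeom p k]
  rfl

lemma tendsto_log_lppTail (q : Set.Ioo (0 : ℝ) 1) {γ ε : ℝ} (hγ : 1 ≤ γ) (hε : 0 < ε) :
    ∃ i : ℝ, 0 < i ∧
      Tendsto (fun N : ℕ => (1 / (N : ℝ)) * Real.log ((weightLaw q).real
        {w | N * ((1 + Real.sqrt (q * γ)) ^ 2 / (1 - q) - 1 + ε) ≤
          (lppSup w ⌊γ * N⌋₊ N : ℝ)})) atTop (nhds (-i)) := by
  obtain ⟨c, hc, hle⟩ := lppTail_le_exp q hγ hε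
  have hfloor : ∀ {N : ℕ}, 1 ≤ N → 1 ≤ ⌊γ * N⌋₊ := fun {N} hN => by
    have : (1 : ℝ) ≤ N := by exact_mod_cast hN
    exact Nat.le_floor (by push_cast; nlinarith)
  set x := (1 + Real.sqrt (q * γ)) ^ 2 / (1 - q) - 1 + ε
  have hzero : (weightLaw q).real {w | ((0 : ℕ) : ℝ) * x ≤ (lppSup w ⌊γ * (0 : ℕ)⌋₊ 0 : ℝ)}
      = 1 := by
    simp
  refine exists_pos_rate (fun N => ?_) (fun N => measureReal_le_one) (fun m n => ?_) hc hle
  · rcases Nat.eq_zero_or_pos N with rfl | hN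
    · rw [hzero]; exact one_pos
    · exact lppTail_pos q _ (hfloor hN) hN
  · rcases Nat.eq_zero_or_pos m with rfl | hm
    · rw [hzero, one_mul, zero_add]
    rcases Nat.eq_zero_or_pos n with rfl | hn
    · rw [hzero, mul_one, add_zero]
    refine (lppTail_superadditive q _ _ (hfloor hm) hm (hfloor hn) hn).trans
      (measureReal_mono fun w hw => ?_)
    have hw : m * x + n * x ≤
      (lppSup w (⌊γ * m⌋₊ + ⌊γ * n⌋₊) (m + n) : ℝ) := hw
    have hfl : ⌊γ * m⌋₊ + ⌊γ * n⌋₊ ≤ ⌊γ * ((m + n : ℕ) : ℝ)⌋₊ := by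
      refine Nat.le_floor ?_
      have h1 : (⌊γ * m⌋₊ : ℝ) ≤ γ * m := Nat.floor_le (by positivity)
      have h2 : (⌊γ * n⌋₊ : ℝ) ≤ γ * n := Nat.floor_le (by positivity)
      push_cast
      linarith
    have hmono := lppSup_mono_left w (N := m + n)
      (by have := hfloor hm; omega : 1 ≤ ⌊γ * m⌋₊ + ⌊γ * n⌋₊) (by omega) hfl
    change ((m + n : ℕ) : ℝ) * x ≤ _
    push_cast at hw ⊢
    rw [add_mul]
    exact hw.trans (by exact_mod_cast hmono)

end LargeDeviations

/-- Upper-tail large deviations for `G(⌊γN⌋,N)`: for each `ε > 0` there is `i(ε) > 0` with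
`lim_{N→∞} N⁻¹ log ℙ[G(⌊γN⌋,N) ≥ N(ω(γ,q)+ε)] = −i(ε)`. -/
theorem stmt2
    {Ω : Type*} [MeasurableSpace Ω] (ℙ : Measure Ω) [IsProbabilityMeasure ℙ]
    (q : ℝ) (hq0 : 0 < q) (hq1 : q < 1)
    (w : ℕ × ℕ → Ω → ℕ)
    (hmeas : ∀ p, Measurable (w p))
    (hindep : ProbabilityTheory.iIndepFun w ℙ)
    (hgeom : ∀ p k, ℙ {ω | w p ω = k} = ENNReal.ofReal ((1 - q) * q ^ k))
    (γ : ℝ) (hγ : 1 ≤ γ)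
    (ε : ℝ) (hε0 : 0 < ε) :
    ∃ i : ℝ, 0 < i ∧
      Tendsto
        (fun N : ℕ => (1 / (N : ℝ)) *
          Real.log (ℙ {ω | N * ((1 + Real.sqrt (q * γ)) ^ 2 / (1 - q) - 1 + ε) ≤
            (lppSup (fun p => w p ω) ⌊γ * N⌋₊ N : ℝ)}).toReal)
        atTop (nhds (-i)) := by
  have hlaw := map_weights_eq_weightLaw ℙ ⟨q, hq0, hq1⟩ hmeas hindep hgeom
  obtain ⟨i, hi, hlim⟩ := tendsto_log_lppTail ⟨q, hq0, hq1⟩ hγ hε0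
  refine ⟨i, hi, hlim.congr fun N => ?_⟩
  rw [← hlaw, map_measureReal_apply (measurable_pi_iff.2 hmeas) (measurableSet_lppTail _ _ _)]
  rfl
end
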